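/- Let x ≥ 2 be a real number, q ≥ 1 an integer, and ε > 0. Then Σ_{a=1}^{q} |Δ(a/q)|² ≪_ε x^{1+ε} q^{3/2}, where the implied constant depends only on ε. -/

import Mathlib

open scoped BigOperators

/-- `e(t) = exp(2πit)` -/
noncomputable def e (t : ℝ) : ℂ := Complex.exp (2 * Real.pi * Complex.I * t)

/-- the 3-fold divisor function `d₃(n) = Σ_{abc=n} 1` -/
def d3 (n : ℕ) : ℕ :=
  ((Finset.Icc 1 n ×ˢ Finset.Icc 1 n ×ˢ Finset.Icc 1 n).filter
    (fun p : ℕ × ℕ × ℕ => p.1 * p.2.1 * p.2.2 = n)).card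

namespace TernaryDivisor

/-! ### Divisor bounds -/

theorem succ_le_mul_rpow {δ : ℝ} (hδ : 0 < δ) {p : ℕ} (hp : 2 ≤ p) (a : ℕ) :
    ((a : ℝ) + 1) ≤ (1 + 1 / (δ * Real.log 2)) * ((p : ℝ) ^ a) ^ δ := by
  have hl : 0 < Real.log 2 := Real.log_pos one_lt_two
  have hd : 0 < δ * Real.log 2 := mul_pos hδ hl
  have h1 : Real.exp (a * (δ * Real.log 2)) ≤ ((p : ℝ) ^ a) ^ δ := by
    have hp' : (2 : ℝ) ≤ p := by exact_mod_cast hp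
    rw [Real.rpow_def_of_pos (by positivity), Real.log_pow]
    apply Real.exp_le_exp.2
    have : Real.log 2 ≤ Real.log p := Real.log_le_log (by norm_num) hp'
    have h2 : (a : ℝ) * δ * Real.log 2 ≤ (a : ℝ) * δ * Real.log p := by gcongr
    linarith
  have h2 : (a : ℝ) * (δ * Real.log 2) + 1 ≤ Real.exp (a * (δ * Real.log 2)) :=
    Real.add_one_le_exp _
  have h3 : (a : ℝ) + 1 ≤ (1 + 1 / (δ * Real.log 2)) * (a * (δ * Real.log 2) + 1) := by
    have : (1 + 1 / (δ * Real.log 2)) * (a * (δ * Real.log 2) + 1)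
        = a + 1 + (a * (δ * Real.log 2) + 1 / (δ * Real.log 2)) := by
      field_simp
      ring
    rw [this]
    have : 0 ≤ a * (δ * Real.log 2) + 1 / (δ * Real.log 2) := by positivity
    linarith
  calc (a : ℝ) + 1 ≤ _ := h3
    _ ≤ _ := by gcongr; linarith

theorem succ_le_rpow {δ : ℝ} (hδ : 0 < δ) {p : ℕ} (hp : (2 : ℝ) ^ (1 / δ) ≤ p) (a : ℕ) :
    ((a : ℝ) + 1) ≤ ((p : ℝ) ^ a) ^ δ := by
  have h2 : (2 : ℝ) ≤ (p : ℝ) ^ δ := by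
    calc (2 : ℝ) = ((2 : ℝ) ^ (1 / δ)) ^ δ := by
          rw [← Real.rpow_mul (by norm_num)]; field_simp; simp
      _ ≤ _ := by gcongr
  have h3 : ((p : ℝ) ^ a) ^ δ = ((p : ℝ) ^ δ) ^ a := by
    rw [← Real.rpow_natCast, ← Real.rpow_natCast, ← Real.rpow_mul (by positivity),
      ← Real.rpow_mul (by positivity), mul_comm]
  rw [h3]
  calc (a : ℝ) + 1 ≤ 2 ^ a := by exact_mod_cast Nat.lt_two_pow_self
    _ ≤ _ := by gcongr

theorem exists_card_divisors_le {δ : ℝ} (hδ : 0 < δ) :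
    ∃ C : ℝ, 1 ≤ C ∧ ∀ n : ℕ, n ≠ 0 → (n.divisors.card : ℝ) ≤ C * (n : ℝ) ^ δ := by
  set B : ℝ := 1 + 1 / (δ * Real.log 2) with hB
  have hl : 0 < Real.log 2 := Real.log_pos one_lt_two
  have hB1 : 1 ≤ B := by
    have : 0 ≤ 1 / (δ * Real.log 2) := by positivity
    linarith
  set N : ℕ := ⌈(2 : ℝ) ^ (1 / δ)⌉₊ with hN
  refine ⟨B ^ N, one_le_pow₀ hB1, fun n hn => ?_⟩
  have h1 : (n : ℝ) ^ δ = ∏ p ∈ n.primeFactors, ((p : ℝ) ^ (n.factorization p)) ^ δ := by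
    rw [Real.finsetProd_rpow _ _ (fun _ _ => by positivity)]
    congr 1
    conv_lhs => rw [← Nat.prod_factorization_pow_eq_self hn]
    rw [Finsupp.prod, Nat.support_factorization]
    push_cast
    rfl
  have h2 : B ^ ((n.primeFactors.filter (· < N)).card) ≤ B ^ N := by
    refine pow_le_pow_right₀ hB1 ?_
    calc _ ≤ (Finset.range N).card := Finset.card_le_card (fun p hp => by
            simpa using (Finset.mem_filter.1 hp).2)
      _ = N := Finset.card_range N
  rw [Nat.card_divisors hn]
  push_cast
  calc ∏ p ∈ n.primeFactors, ((n.factorization p : ℝ) + 1)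
      ≤ ∏ p ∈ n.primeFactors, ((if p < N then B else 1) *
          ((p : ℝ) ^ (n.factorization p)) ^ δ) := by
        refine Finset.prod_le_prod (fun _ _ => by positivity) (fun p hp => ?_)
        split_ifs with h
        · exact succ_le_mul_rpow hδ (Nat.prime_of_mem_primeFactors hp).two_le _
        · rw [one_mul]
          exact succ_le_rpow hδ ((Nat.ceil_le).1 (not_lt.1 h)) _
    _ = B ^ ((n.primeFactors.filter (· < N)).card) * (n : ℝ) ^ δ := by
        rw [Finset.prod_mul_distrib, h1, Finset.prod_ite]
        simp
    _ ≤ _ := by gcongr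

theorem d3_le_sq (n : ℕ) : d3 n ≤ n.divisors.card ^ 2 := by
  rw [sq, ← Finset.card_product]
  refine Finset.card_le_card_of_injOn (fun p => (p.1, p.2.1)) ?_ ?_
  · rintro ⟨a, b, c⟩ h
    simp only [Finset.coe_filter, Finset.mem_product, Finset.mem_Icc, Set.mem_ofPred_eq] at h
    obtain ⟨⟨⟨h1, h2⟩, ⟨h3, h4⟩, h5, h6⟩, rfl⟩ := h
    simp only [Finset.coe_product, Set.mem_prod, Finset.mem_coe, Nat.mem_divisors]
    have : a * b * c ≠ 0 := by positivity
    exact ⟨⟨⟨b * c, by ring⟩, this⟩, ⟨⟨a * c, by ring⟩, this⟩⟩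
  · rintro ⟨a, b, c⟩ h ⟨a', b', c'⟩ h' hh
    simp only [Finset.coe_filter, Finset.mem_product, Finset.mem_Icc, Set.mem_ofPred_eq] at h h'
    simp only [Prod.mk.injEq] at hh
    obtain ⟨rfl, rfl⟩ := hh
    have hab : 0 < a * b := Nat.mul_pos h.1.1.1 h.1.2.1.1
    have := Nat.eq_of_mul_eq_mul_left hab (h.2.trans h'.2.symm)
    simp [this]

theorem d3_le_self_sq (n : ℕ) : d3 n ≤ n ^ 2 :=
  (d3_le_sq n).trans (Nat.pow_le_pow_left (Nat.card_divisors_le_self n) 2)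

theorem exists_d3_le {δ : ℝ} (hδ : 0 < δ) :
    ∃ C : ℝ, 1 ≤ C ∧ ∀ n : ℕ, n ≠ 0 → (d3 n : ℝ) ≤ C * (n : ℝ) ^ δ := by
  obtain ⟨C, hC, h⟩ := exists_card_divisors_le (half_pos hδ)
  refine ⟨C ^ 2, one_le_pow₀ hC, fun n hn => ?_⟩
  calc (d3 n : ℝ) ≤ (n.divisors.card : ℝ) ^ 2 := by exact_mod_cast d3_le_sq n
    _ ≤ (C * (n : ℝ) ^ (δ / 2)) ^ 2 := by gcongr; exact h n hn
    _ = _ := by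
      rw [mul_pow, ← Real.rpow_natCast ((n : ℝ) ^ (δ / 2)), ← Real.rpow_mul (by positivity)]
      norm_num

/-! ### Sums of greatest common divisors -/

theorem gcd_le_sum (m q : ℕ) (hq : q ≠ 0) :
    (m.gcd q : ℝ) ≤ ∑ g ∈ q.divisors, if g ∣ m then (g : ℝ) else 0 := by
  have hmem : m.gcd q ∈ q.divisors := Nat.mem_divisors.2 ⟨Nat.gcd_dvd_right m q, hq⟩
  refine le_trans ?_ (Finset.single_le_sum (f := fun g : ℕ => if g ∣ m then (g : ℝ) else 0)
    (fun g _ => by positivity) hmem)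
  simp [Nat.gcd_dvd_left m q]

/-- The constant `Σ_{m ≥ 1} m^{-1-η}`. -/
noncomputable def zsum (η : ℝ) : ℝ := ∑' m : ℕ, ((m : ℝ) ^ (1 + η))⁻¹

theorem summable_zsum {η : ℝ} (hη : 0 < η) : Summable fun m : ℕ => ((m : ℝ) ^ (1 + η))⁻¹ :=
  Real.summable_nat_rpow_inv.2 (by linarith)

theorem sum_gcd_le {η : ℝ} (hη : 0 < η) (q : ℕ) (hq : q ≠ 0) (s : Finset ℕ)
    (hs : ∀ m ∈ s, m ≠ 0) :
    ∑ m ∈ s, (m.gcd q : ℝ) / (m : ℝ) ^ (1 + η) ≤ zsum η * q.divisors.card := by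
  have h1 : ∀ g ∈ q.divisors, ∑ m ∈ s, (if g ∣ m then (g : ℝ) else 0) / (m : ℝ) ^ (1 + η)
      ≤ zsum η := by
    intro g hg
    have hg0 : 0 < g := Nat.pos_of_mem_divisors hg
    have hg1 : (1 : ℝ) ≤ g := by exact_mod_cast hg0
    have h2 : ∀ m ∈ s, (if g ∣ m then (g : ℝ) else 0) / (m : ℝ) ^ (1 + η) ≤
        if g ∣ m then (((m / g : ℕ) : ℝ) ^ (1 + η))⁻¹ else 0 := by
      intro m hm
      split_ifs with h
      · obtain ⟨k, rfl⟩ := h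
        rw [Nat.mul_div_cancel_left _ hg0]
        have hk : 0 < k := Nat.pos_of_ne_zero (fun hk => hs _ hm (by simp [hk]))
        have hk' : (0 : ℝ) < k := by exact_mod_cast hk
        push_cast
        rw [Real.mul_rpow (by positivity) (by positivity), Real.rpow_add (by positivity),
          Real.rpow_one, ← div_div, ← div_div, div_self (by positivity)]
        rw [inv_eq_one_div]
        gcongr
        rw [div_le_one (by positivity)]
        exact Real.one_le_rpow hg1 hη.le
      · simp
    refine (Finset.sum_le_sum h2).trans ?_
    rw [← Finset.sum_filter]
    have hinj : Set.InjOn (fun m => m / g) (s.filter (g ∣ ·) : Finset ℕ) := by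
      intro a ha b hb hab
      simp only [Finset.coe_filter, Set.mem_ofPred_eq] at ha hb
      simp only at hab
      rw [← Nat.div_mul_cancel ha.2, ← Nat.div_mul_cancel hb.2, hab]
    rw [← Finset.sum_image (f := fun k : ℕ => ((k : ℝ) ^ (1 + η))⁻¹) hinj]
    exact (summable_zsum hη).sum_le_tsum _ (fun _ _ => by positivity)
  calc ∑ m ∈ s, (m.gcd q : ℝ) / (m : ℝ) ^ (1 + η)
      ≤ ∑ m ∈ s, ∑ g ∈ q.divisors, (if g ∣ m then (g : ℝ) else 0) / (m : ℝ) ^ (1 + η) := by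
        refine Finset.sum_le_sum (fun m _ => ?_)
        rw [← Finset.sum_div]
        gcongr
        exact gcd_le_sum m q hq
    _ = ∑ g ∈ q.divisors, ∑ m ∈ s, (if g ∣ m then (g : ℝ) else 0) / (m : ℝ) ^ (1 + η) :=
        Finset.sum_comm
    _ ≤ ∑ g ∈ q.divisors, zsum η := Finset.sum_le_sum h1
    _ = _ := by simp [mul_comm]

theorem zsum_pos {η : ℝ} (hη : 0 < η) : 0 < zsum η :=
  (summable_zsum hη).tsum_pos (fun _ => by positivity) 1 (by simp)

theorem exists_sum_gcd_le {η : ℝ} (hη : 0 < η) :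
    ∃ C : ℝ, 1 ≤ C ∧ ∀ q : ℕ, q ≠ 0 → ∀ s : Finset ℕ, (∀ m ∈ s, m ≠ 0) →
      ∑ m ∈ s, (m.gcd q : ℝ) / (m : ℝ) ^ (1 + η) ≤ C * (q : ℝ) ^ η := by
  obtain ⟨C, hC, h⟩ := exists_card_divisors_le hη
  refine ⟨(zsum η + 1) * C, ?_, fun q hq s hs => ?_⟩
  · have := zsum_pos hη
    nlinarith
  · have := zsum_pos hη
    calc _ ≤ zsum η * q.divisors.card := sum_gcd_le hη q hq s hs
      _ ≤ (zsum η + 1) * (C * (q : ℝ) ^ η) := by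
        gcongr
        · linarith
        · exact h q hq
      _ = _ := by ring

/-! ### Counting and orthogonality in `ZMod q` -/

section ZModSums

variable {q : ℕ} [NeZero q]

/-- The standard additive character `j ↦ e(j/q)`. -/
noncomputable abbrev χ (j : ZMod q) : ℂ := ZMod.stdAddChar j

theorem norm_χ (j : ZMod q) : ‖χ j‖ = 1 := by
  simp [χ]

theorem χ_add (i j : ZMod q) : χ (i + j) = χ i * χ j := AddChar.map_add_eq_mul _ _ _

theorem χ_neg (j : ZMod q) : χ (-j) = (starRingEnd ℂ) (χ j) := by
  simpa [χ] using AddChar.map_neg_eq_conj (ZMod.stdAddChar (N := q)) j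

theorem sum_χ_mul (d : ZMod q) : ∑ r : ZMod q, χ (r * d) = if d = 0 then (q : ℂ) else 0 := by
  have := AddChar.sum_mulShift d (ZMod.isPrimitive_stdAddChar q)
  rw [ZMod.card] at this
  simpa using this

theorem χ_natCast (n : ℕ) : χ (n : ZMod q) = e ((n : ℝ) / q) := by
  have := ZMod.stdAddChar_coe (N := q) (n : ℤ)
  simp only [Int.cast_natCast] at this
  rw [χ, this, e]
  congr 1
  push_cast
  ring

theorem card_mul_eq_zero_le (r : ZMod q) :
    (Finset.univ.filter fun b : ZMod q => r * b = 0).card ≤ r.val.gcd q := by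
  have hq : 0 < q := Nat.pos_of_ne_zero (NeZero.ne q)
  have hg : 0 < r.val.gcd q := Nat.gcd_pos_of_pos_right _ hq
  refine le_trans (Finset.card_le_card ?_) (IsAddCyclic.card_nsmul_eq_zero_le (α := ZMod q) hg)
  intro b hb
  simp only [Finset.mem_filter, Finset.mem_univ, true_and] at hb ⊢
  have hz : ((r.val.gcd q : ℕ) : ZMod q) = r * ((r.val.gcdA q : ℤ) : ZMod q) := by
    have := congrArg (fun z : ℤ => (z : ZMod q)) (Nat.gcd_eq_gcd_ab r.val q)
    simpa using this
  rw [nsmul_eq_mul, hz, mul_right_comm, hb, zero_mul]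

theorem card_mul_eq_le (r k : ZMod q) :
    (Finset.univ.filter fun b : ZMod q => r * b = k).card ≤ r.val.gcd q := by
  rcases (Finset.univ.filter fun b : ZMod q => r * b = k).eq_empty_or_nonempty with h | ⟨b₀, hb₀⟩
  · simp [h]
  · refine le_trans (Finset.card_le_card_of_injOn (fun b => b - b₀) ?_
      (fun a _ b _ h => by simpa using h)) (card_mul_eq_zero_le r)
    intro b hb
    simp only [Finset.coe_filter, Finset.mem_univ, true_and, Set.mem_ofPred_eq,
      Finset.mem_filter] at hb hb₀ ⊢
    rw [mul_sub, hb, hb₀, sub_self]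

theorem gcd_dvd_val_of_mul_eq {r b k : ZMod q} (h : r * b = k) : r.val.gcd q ∣ k.val := by
  subst h
  rw [ZMod.val_mul]
  exact (Nat.dvd_mod_iff (Nat.gcd_dvd_right _ _)).2 ((Nat.gcd_dvd_left _ _).mul_right _)

theorem gcd_dvd_gcd_of_mul_eq {r b k : ZMod q} (h : r * b = k) :
    r.val.gcd q ∣ k.val.gcd q :=
  Nat.dvd_gcd (gcd_dvd_val_of_mul_eq h) (Nat.gcd_dvd_right _ _)

theorem card_mul_eq_le_gcd (r k : ZMod q) :
    (Finset.univ.filter fun b : ZMod q => r * b = k).card ≤ k.val.gcd q := by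
  have hq : 0 < q := Nat.pos_of_ne_zero (NeZero.ne q)
  rcases (Finset.univ.filter fun b : ZMod q => r * b = k).eq_empty_or_nonempty with h | ⟨b₀, hb₀⟩
  · simp [h]
  · exact (card_mul_eq_le r k).trans (Nat.le_of_dvd (Nat.gcd_pos_of_pos_right _ hq)
      (gcd_dvd_gcd_of_mul_eq (Finset.mem_filter.1 hb₀).2))

theorem sum_norm_sq_comp_mul_le (r : ZMod q) (G : ZMod q → ℂ) :
    ∑ a, ‖G (a * r)‖ ^ 2 ≤ (r.val.gcd q : ℝ) * ∑ j, ‖G j‖ ^ 2 := by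
  rw [← Finset.sum_fiberwise (s := Finset.univ) (g := fun a => a * r), Finset.mul_sum]
  refine Finset.sum_le_sum (fun j _ => ?_)
  rw [Finset.sum_congr rfl (g := fun _ => ‖G j‖ ^ 2)
    (fun a ha => by rw [(Finset.mem_filter.1 ha).2]), Finset.sum_const, nsmul_eq_mul]
  gcongr
  simpa [mul_comm] using card_mul_eq_le r j

/-- Finite Fourier coefficient. -/
noncomputable def fcoef (G : ZMod q → ℂ) (c : ZMod q) : ℂ := (q : ℂ)⁻¹ * ∑ j, G j * χ (-(j * c))

theorem fcoef_inversion (G : ZMod q → ℂ) (b : ZMod q) : G b = ∑ c, fcoef G c * χ (c * b) := by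
  have hq : (q : ℂ) ≠ 0 := Nat.cast_ne_zero.2 (NeZero.ne q)
  simp only [fcoef, mul_assoc, Finset.sum_mul, ← Finset.mul_sum]
  rw [Finset.sum_comm]
  have : ∀ j : ZMod q, ∑ c : ZMod q, G j * (χ (-(j * c)) * χ (c * b)) =
      if b = j then G j * q else 0 := by
    intro j
    rw [← Finset.mul_sum]
    have h : ∀ c : ZMod q, χ (-(j * c)) * χ (c * b) = χ (c * (b - j)) := fun c => by
      rw [← χ_add]; congr 1; ring
    simp only [h, sum_χ_mul, sub_eq_zero]
    split_ifs <;> simp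
  simp only [this]
  rw [Finset.sum_ite_eq]
  simp only [Finset.mem_univ, if_true]
  field_simp

theorem sum_norm_sq_sum_χ (g : ZMod q → ℂ) :
    ∑ a, ‖∑ c, g c * χ (c * a)‖ ^ 2 = q * ∑ c, ‖g c‖ ^ 2 := by
  have h : (∑ a, (‖∑ c, g c * χ (c * a)‖ ^ 2 : ℝ) : ℂ) = (q * ∑ c, (‖g c‖ ^ 2 : ℝ) : ℂ) := by
    push_cast
    simp only [← Complex.mul_conj', map_sum, map_mul, ← χ_neg]
    simp only [Finset.sum_mul_sum]
    rw [Finset.sum_comm, Finset.mul_sum]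
    refine Finset.sum_congr rfl (fun c _ => ?_)
    rw [Finset.sum_comm]
    have : ∀ d : ZMod q, ∑ a : ZMod q, g c * χ (c * a) * ((starRingEnd ℂ) (g d) * χ (-(d * a)))
        = if c = d then g c * (starRingEnd ℂ) (g d) * q else 0 := by
      intro d
      have h : ∀ a : ZMod q, g c * χ (c * a) * ((starRingEnd ℂ) (g d) * χ (-(d * a)))
          = g c * (starRingEnd ℂ) (g d) * χ (a * (c - d)) := fun a => by
        rw [show a * (c - d) = c * a + -(d * a) by ring, χ_add]; ring
      simp only [h, ← Finset.mul_sum, sum_χ_mul, sub_eq_zero]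
      split_ifs <;> simp
    simp only [this]
    rw [Finset.sum_ite_eq]
    simp [mul_comm]
  exact_mod_cast h

theorem sum_norm_sq_twist_le (k : ZMod q) (G : ZMod q → ℂ) :
    ∑ a, ‖∑ r, χ (-(k * r)) * G (a * r)‖ ^ 2 ≤
      q * (k.val.gcd q : ℝ) ^ 2 * ∑ j, ‖G j‖ ^ 2 := by
  set g := fcoef G with hg
  have hG : ∑ j, ‖G j‖ ^ 2 = q * ∑ c, ‖g c‖ ^ 2 := by
    rw [← sum_norm_sq_sum_χ]
    exact Finset.sum_congr rfl (fun j _ => by rw [← fcoef_inversion])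
  have h1 : ∀ a, ∑ r, χ (-(k * r)) * G (a * r) =
      q * ∑ c ∈ Finset.univ.filter (fun c => a * c = k), g c := by
    intro a
    have : ∀ r, χ (-(k * r)) * G (a * r) = ∑ c, g c * χ (r * (a * c - k)) := fun r => by
      rw [fcoef_inversion G, Finset.mul_sum]
      refine Finset.sum_congr rfl (fun c _ => ?_)
      rw [show r * (a * c - k) = -(k * r) + c * (a * r) by ring, χ_add]
      ring
    simp only [this]
    rw [Finset.sum_comm]
    simp only [← Finset.mul_sum, sum_χ_mul, sub_eq_zero]
    rw [Finset.sum_filter, Finset.mul_sum]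
    refine Finset.sum_congr rfl (fun c _ => ?_)
    split_ifs <;> ring
  have h2 : ∀ a, ‖∑ r, χ (-(k * r)) * G (a * r)‖ ^ 2 ≤
      q ^ 2 * (k.val.gcd q : ℝ) * ∑ c, if a * c = k then ‖g c‖ ^ 2 else 0 := by
    intro a
    rw [h1, norm_mul, mul_pow, mul_assoc, Complex.norm_natCast, ← Finset.sum_filter]
    gcongr
    calc ‖∑ c ∈ Finset.univ.filter (fun c => a * c = k), g c‖ ^ 2
        ≤ (∑ c ∈ Finset.univ.filter (fun c => a * c = k), ‖g c‖) ^ 2 := by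
          gcongr; exact norm_sum_le _ _
      _ ≤ _ := sq_sum_le_card_mul_sum_sq
      _ ≤ _ := by gcongr; exact card_mul_eq_le_gcd a k
  calc _ ≤ ∑ a, q ^ 2 * (k.val.gcd q : ℝ) * ∑ c, (if a * c = k then ‖g c‖ ^ 2 else 0) :=
        Finset.sum_le_sum (fun a _ => h2 a)
    _ = q ^ 2 * (k.val.gcd q : ℝ) * ∑ c, ∑ a, (if a * c = k then ‖g c‖ ^ 2 else 0) := by
        rw [← Finset.mul_sum, Finset.sum_comm]
    _ ≤ q ^ 2 * (k.val.gcd q : ℝ) * ∑ c, (k.val.gcd q : ℝ) * ‖g c‖ ^ 2 := by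
        gcongr with c
        rw [← Finset.sum_filter, Finset.sum_const, nsmul_eq_mul]
        gcongr
        simpa [mul_comm] using card_mul_eq_le_gcd c k
    _ = _ := by rw [hG, ← Finset.mul_sum]; ring

end ZModSums

open MeasureTheory

/-! ### Counting functions in residue classes and their discrepancies -/

section Discrepancy

/-- The number of `1 ≤ n ≤ N` in the residue class `r`. -/
def cnt {q : ℕ} (r : ZMod q) (N : ℕ) : ℕ :=
  ((Finset.Icc 1 N).filter fun n : ℕ => (n : ZMod q) = r).card

/-- The discrepancy of the residue class `r` on the interval `[1, e^s]`. -/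
noncomputable def disc {q : ℕ} (r : ZMod q) (s : ℝ) : ℝ :=
  cnt r ⌊Real.exp s⌋₊ - Real.exp s / q

/-- The discrepancy of the residue class `r` on the interval `(e^s, e^{s+h}]`. -/
noncomputable def step {q : ℕ} (h : ℝ) (r : ZMod q) (s : ℝ) : ℝ := disc r (s + h) - disc r s

variable {q : ℕ} [NeZero q]

theorem q_pos : (0 : ℝ) < q := by exact_mod_cast Nat.pos_of_ne_zero (NeZero.ne q)

theorem measurable_disc (r : ZMod q) : Measurable (disc r) := by
  have h1 : Measurable fun s : ℝ => ⌊Real.exp s⌋₊ := Nat.measurable_floor.comp Real.measurable_exp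
  have h2 : Measurable fun n : ℕ => (cnt r n : ℝ) := measurable_from_nat
  exact (h2.comp h1).sub (Real.measurable_exp.div_const _)

theorem measurable_step (h : ℝ) (r : ZMod q) : Measurable (step h r) :=
  ((measurable_disc r).comp (measurable_id.add_const h)).sub (measurable_disc r)

theorem sum_cnt_mul {M : Type*} [AddCommMonoid M] (N : ℕ) (f : ZMod q → M) :
    ∑ r, cnt r N • f r = ∑ n ∈ Finset.Icc 1 N, f (n : ZMod q) := by
  rw [← Finset.sum_fiberwise (s := Finset.Icc 1 N) (g := fun n : ℕ => (n : ZMod q))]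
  refine Finset.sum_congr rfl (fun r _ => ?_)
  rw [Finset.sum_congr rfl (g := fun _ => f r)
    (fun a ha => by rw [(Finset.mem_filter.1 ha).2]), Finset.sum_const, cnt]

theorem cnt_floor_eq (r : ZMod q) {u : ℝ} (hu : 0 ≤ u) :
    (cnt r ⌊u⌋₊ : ℤ) = ⌊(u - r.val) / q⌋ - ⌊(-(r.val : ℝ)) / q⌋ := by
  have hq : 0 < q := Nat.pos_of_ne_zero (NeZero.ne q)
  have h1 : cnt r ⌊u⌋₊ = ((Finset.Ioc 0 ⌊u⌋₊).filter fun n : ℕ => n ≡ r.val [MOD q]).card := by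
    rw [cnt]
    congr 1
    ext n
    simp only [Finset.mem_filter, Finset.mem_Icc, Finset.mem_Ioc]
    rw [← ZMod.natCast_eq_natCast_iff, ZMod.natCast_zmod_val]
    rfl
  rw [h1, Nat.Ioc_filter_modEq_card _ _ hq]
  have h2 : ⌊((⌊u⌋₊ : ℚ) - (r.val : ℚ)) / (q : ℚ)⌋ = ⌊(u - r.val) / (q : ℝ)⌋ := by
    rw [Int.floor_div_natCast, Int.floor_div_natCast]
    congr 1
    rw [Int.floor_sub_natCast, Int.floor_sub_natCast, Int.floor_natCast,
      Int.natCast_floor_eq_floor hu]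
  have h3 : ⌊(((0 : ℕ) : ℚ) - (r.val : ℚ)) / (q : ℚ)⌋ = ⌊(-(r.val : ℝ)) / (q : ℝ)⌋ := by
    rw [Int.floor_div_natCast, Int.floor_div_natCast]
    congr 1
    rw [Int.floor_sub_natCast, Int.floor_natCast]
    have := Int.floor_sub_natCast (0 : ℝ) r.val
    simp only [zero_sub, Int.floor_zero] at this
    rw [this]; simp
  rw [h2, h3]
  apply max_eq_left
  rw [sub_nonneg]
  apply Int.floor_le_floor
  gcongr
  linarith

theorem disc_eq_fract (r : ZMod q) (s : ℝ) :
    disc r s = Int.fract (-(r.val : ℝ) / q) - Int.fract ((Real.exp s - r.val) / q) := by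
  have h := cnt_floor_eq r (Real.exp_pos s).le
  have h' : (cnt r ⌊Real.exp s⌋₊ : ℝ) = ((cnt r ⌊Real.exp s⌋₊ : ℤ) : ℝ) := by simp
  rw [disc, h', h, Int.fract, Int.fract]
  push_cast
  ring

theorem step_eq_fract (h : ℝ) (r : ZMod q) (s : ℝ) :
    step h r s = Int.fract ((Real.exp s - r.val) / q) -
      Int.fract ((Real.exp (s + h) - r.val) / q) := by
  rw [step, disc_eq_fract, disc_eq_fract]; ring

theorem abs_disc_le_one (r : ZMod q) (s : ℝ) : |disc r s| ≤ 1 := by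
  rw [disc_eq_fract]
  have h1 := Int.fract_nonneg (-(r.val : ℝ) / q)
  have h2 := (Int.fract_lt_one (-(r.val : ℝ) / q)).le
  have h3 := Int.fract_nonneg ((Real.exp s - r.val) / q)
  have h4 := (Int.fract_lt_one ((Real.exp s - r.val) / q)).le
  rw [abs_le]; constructor <;> linarith

theorem abs_step_le_one (h : ℝ) (r : ZMod q) (s : ℝ) : |step h r s| ≤ 1 := by
  rw [step_eq_fract]
  have h1 := Int.fract_nonneg ((Real.exp (s + h) - r.val) / q)
  have h2 := (Int.fract_lt_one ((Real.exp (s + h) - r.val) / q)).le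
  have h3 := Int.fract_nonneg ((Real.exp s - r.val) / q)
  have h4 := (Int.fract_lt_one ((Real.exp s - r.val) / q)).le
  rw [abs_le]; constructor <;> linarith

theorem cnt_floor_exp_of_neg (r : ZMod q) {s : ℝ} (hs : s < 0) : cnt r ⌊Real.exp s⌋₊ = 0 := by
  have : ⌊Real.exp s⌋₊ = 0 := Nat.floor_eq_zero.2 (Real.exp_lt_one_iff.2 hs)
  simp [this, cnt]

theorem disc_of_neg (r : ZMod q) {s : ℝ} (hs : s < 0) : disc r s = -(Real.exp s / q) := by
  rw [disc, cnt_floor_exp_of_neg r hs]; simp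

theorem abs_disc_le_exp (r : ZMod q) (s : ℝ) : |disc r s| ≤ Real.exp s := by
  rcases lt_or_ge s 0 with hs | hs
  · rw [disc_of_neg r hs, abs_neg, abs_of_nonneg (by positivity)]
    exact div_le_self (Real.exp_pos s).le (by exact_mod_cast NeZero.one_le)
  · exact (abs_disc_le_one r s).trans (Real.one_le_exp hs)

/-- `min(1, e^s) ≤ e^{s/2 - |s|/2}`. -/
theorem abs_le_exp_half {a s : ℝ} (h1 : a ≤ 1) (h2 : a ≤ Real.exp s) :
    a ≤ Real.exp (s / 2 - |s| / 2) := by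
  rcases le_total 0 s with hs | hs
  · rw [abs_of_nonneg hs]; simpa using h1
  · rw [abs_of_nonpos hs]; convert! h2 using 2; ring

theorem abs_disc_le (r : ZMod q) (s : ℝ) : |disc r s| ≤ Real.exp (s / 2 - |s| / 2) :=
  abs_le_exp_half (abs_disc_le_one r s) (abs_disc_le_exp r s)

theorem sum_abs_disc_le (s : ℝ) : ∑ r : ZMod q, |disc r s| ≤ 2 * Real.exp s := by
  have h1 : ∑ r : ZMod q, (cnt r ⌊Real.exp s⌋₊ : ℝ) ≤ Real.exp s := by
    have := sum_cnt_mul (q := q) ⌊Real.exp s⌋₊ (fun _ => (1 : ℝ))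
    simp only [nsmul_eq_mul, mul_one, Finset.sum_const, Nat.card_Icc, add_tsub_cancel_right] at this
    rw [this]
    exact Nat.floor_le (Real.exp_pos s).le
  have h2 : ∀ r : ZMod q, |disc r s| ≤ cnt r ⌊Real.exp s⌋₊ + Real.exp s / q := fun r => by
    rw [disc]
    refine (abs_sub _ _).trans ?_
    rw [abs_of_nonneg (by positivity), abs_of_nonneg (by positivity)]
  calc _ ≤ ∑ r : ZMod q, ((cnt r ⌊Real.exp s⌋₊ : ℝ) + Real.exp s / q) :=
        Finset.sum_le_sum (fun r _ => h2 r)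
    _ = ∑ r : ZMod q, (cnt r ⌊Real.exp s⌋₊ : ℝ) + Real.exp s := by
        rw [Finset.sum_add_distrib]
        have := (q_pos (q := q)).ne'
        simp [ZMod.card]
        field_simp
    _ ≤ _ := by linarith

theorem sum_abs_disc_le_card (s : ℝ) : ∑ r : ZMod q, |disc r s| ≤ q := by
  calc _ ≤ ∑ _r : ZMod q, (1 : ℝ) := Finset.sum_le_sum (fun r _ => abs_disc_le_one r s)
    _ = q := by simp [ZMod.card]

/-- The discrepancy of the solutions of `j n = 0` is a single sawtooth. -/
theorem sum_disc_annihilator (j : ZMod q) (s : ℝ) :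
    ∑ r with j * r = 0, disc r s = -Int.fract (Real.exp s / addOrderOf j) := by
  have hd : 0 < addOrderOf j := addOrderOf_pos j
  have key : ∀ N : ℕ, ∑ r with j * r = 0, cnt r N = N / addOrderOf j := by
    intro N
    have := sum_cnt_mul (q := q) N (fun r => if j * r = 0 then 1 else 0)
    simp only [smul_eq_mul, mul_ite, mul_one, mul_zero] at this
    rw [Finset.sum_filter, this, ← Finset.sum_filter, Finset.sum_const, smul_eq_mul, mul_one]
    have h2 : Finset.filter (fun n : ℕ => j * (n : ZMod q) = 0) (Finset.Icc 1 N) =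
        Finset.filter (fun n : ℕ => addOrderOf j ∣ n) (Finset.Ioc 0 N) := by
      ext n
      simp only [Finset.mem_filter, Finset.mem_Icc, Finset.mem_Ioc, addOrderOf_dvd_iff_nsmul_eq_zero,
        nsmul_eq_mul, mul_comm]
      rfl
    rw [h2, Nat.Ioc_filter_dvd_card_eq_div]
  have hcard : ∑ r : ZMod q with j * r = 0, (1 : ℕ) = q / addOrderOf j := by
    rw [← key q]
    refine Finset.sum_congr rfl (fun r _ => ?_)
    have := cnt_floor_eq r (u := q) (by positivity)
    rw [Nat.floor_natCast, sub_div, div_self q_pos.ne', neg_div,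
      show (1 : ℝ) - r.val / q = -(r.val / q : ℝ) + 1 by ring, Int.floor_add_one] at this
    omega
  have hdvd : addOrderOf j ∣ q := by
    rw [addOrderOf_dvd_iff_nsmul_eq_zero]; simp
  have hcard' : ((Finset.univ.filter fun r : ZMod q => j * r = 0).card : ℝ) =
      (q : ℝ) / addOrderOf j := by
    rw [← Nat.cast_div hdvd (by positivity), ← hcard]; simp
  simp only [disc, Finset.sum_sub_distrib, Finset.sum_const, nsmul_eq_mul]
  rw [← Nat.cast_sum, key, hcard', ← Nat.floor_div_natCast, Int.fract]
  rw [show ((⌊Real.exp s / addOrderOf j⌋₊ : ℕ) : ℝ) = (⌊Real.exp s / addOrderOf j⌋ : ℝ) from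
    natCast_floor_eq_intCast_floor (by positivity)]
  have := (q_pos (q := q)).ne'
  field_simp
  ring

theorem abs_sum_disc_annihilator_le_one (j : ZMod q) (s : ℝ) :
    |∑ r with j * r = 0, disc r s| ≤ 1 := by
  rw [sum_disc_annihilator, abs_neg, abs_of_nonneg (Int.fract_nonneg _)]
  exact (Int.fract_lt_one _).le

theorem abs_sum_disc_annihilator_le_exp (j : ZMod q) (s : ℝ) :
    |∑ r with j * r = 0, disc r s| ≤ Real.exp s := by
  rw [sum_disc_annihilator, abs_neg, abs_of_nonneg (Int.fract_nonneg _)]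
  have hd : (1 : ℝ) ≤ addOrderOf j := by exact_mod_cast addOrderOf_pos j
  calc _ ≤ Real.exp s / addOrderOf j := by
        rw [Int.fract]
        have : (0 : ℝ) ≤ ⌊Real.exp s / addOrderOf j⌋ := by
          exact_mod_cast Int.floor_nonneg.2 (by positivity)
        linarith
    _ ≤ _ := div_le_self (Real.exp_pos s).le hd

end Discrepancy

/-! ### Additive convolutions on the line -/

section Convolution

/-- Additive convolution of real functions. -/
noncomputable def conv (f g : ℝ → ℝ) (t : ℝ) : ℝ := ∫ s, f (t - s) * g s

/-- Forward difference with increment `h`. -/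
def fdiff (h : ℝ) (f : ℝ → ℝ) (s : ℝ) : ℝ := f (s + h) - f s

/-- Measurable functions that are `O(e^{s/2 - δ|s|})`. -/
def Adm (δ : ℝ) (f : ℝ → ℝ) : Prop :=
  Measurable f ∧ ∃ C : ℝ, ∀ s, |f s| ≤ C * Real.exp (s / 2 - δ * |s|)

theorem integrable_exp_neg_abs {δ : ℝ} (hδ : 0 < δ) :
    Integrable fun s : ℝ => Real.exp (-(δ * |s|)) := by
  rw [← integrableOn_univ, ← Set.Iic_union_Ioi (a := (0 : ℝ)), integrableOn_union]
  constructor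
  · refine (integrableOn_exp_mul_Iic hδ 0).congr_fun (fun s hs => ?_) measurableSet_Iic
    simp only [abs_of_nonpos (Set.mem_Iic.1 hs)]; congr 1; ring
  · refine (integrableOn_exp_mul_Ioi (neg_neg_of_pos hδ) 0).congr_fun (fun s hs => ?_)
      measurableSet_Ioi
    simp only [abs_of_pos (Set.mem_Ioi.1 hs)]; congr 1; ring

theorem integral_exp_neg_abs {δ : ℝ} (hδ : 0 < δ) :
    ∫ s : ℝ, Real.exp (-(δ * |s|)) = 2 / δ := by
  rw [integral_comp_abs (f := fun s => Real.exp (-(δ * s)))]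
  have h : ∀ s : ℝ, Real.exp (-(δ * s)) = Real.exp (-δ * s) := fun s => by congr 1; ring
  simp only [h]
  rw [integral_exp_mul_Ioi (neg_neg_of_pos hδ)]
  simp
  field_simp

theorem abs_conv_le {f g : ℝ → ℝ} {A B δ θ c : ℝ} (hδ : 0 < δ)
    (hf : ∀ s, |f s| ≤ A * Real.exp (θ * s - δ * |s - c|))
    (hg : ∀ s, |g s| ≤ B * Real.exp (θ * s)) (t : ℝ) :
    |conv f g t| ≤ A * B * (2 / δ) * Real.exp (θ * t) := by
  have hi : Integrable fun s : ℝ => A * B * Real.exp (θ * t) * Real.exp (-(δ * |s - (t - c)|)) :=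
    ((integrable_exp_neg_abs hδ).comp_sub_right (t - c)).const_mul _
  have hb : ∀ s, ‖f (t - s) * g s‖ ≤
      A * B * Real.exp (θ * t) * Real.exp (-(δ * |s - (t - c)|)) := by
    intro s
    rw [norm_mul, Real.norm_eq_abs, Real.norm_eq_abs]
    calc _ ≤ (A * Real.exp (θ * (t - s) - δ * |t - s - c|)) * (B * Real.exp (θ * s)) :=
          mul_le_mul (hf _) (hg _) (abs_nonneg _) ((abs_nonneg _).trans (hf _))
      _ = A * B * (Real.exp (θ * (t - s) - δ * |t - s - c|) * Real.exp (θ * s)) := by ring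
      _ = _ := by
        rw [mul_assoc (A * B), ← Real.exp_add, ← Real.exp_add, abs_sub_comm s,
          show t - c - s = t - s - c by ring]
        congr 2; ring
  have := norm_integral_le_of_norm_le hi (Filter.Eventually.of_forall hb)
  rw [integral_const_mul, integral_sub_right_eq_self (fun s : ℝ => Real.exp (-(δ * |s|))),
    integral_exp_neg_abs hδ] at this
  calc _ ≤ _ := this
    _ = _ := by ring

variable {f g k : ℝ → ℝ} {δ : ℝ}

theorem Adm.measurable (hf : Adm δ f) : Measurable f := hf.1

theorem Adm.exists_nonneg (hf : Adm δ f) :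
    ∃ C : ℝ, 0 ≤ C ∧ ∀ s, |f s| ≤ C * Real.exp (s / 2 - δ * |s|) := by
  obtain ⟨C, hC⟩ := hf.2
  refine ⟨C, ?_, hC⟩
  have := (abs_nonneg _).trans (hC 0)
  simpa using this

theorem Adm.mono {δ' : ℝ} (hf : Adm δ f) (h : δ' ≤ δ) : Adm δ' f := by
  obtain ⟨C, hC0, hC⟩ := hf.exists_nonneg
  refine ⟨hf.1, C, fun s => (hC s).trans ?_⟩
  gcongr

theorem Adm.sub (hf : Adm δ f) (hg : Adm δ g) : Adm δ (fun s => f s - g s) := by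
  obtain ⟨C, hC⟩ := hf.2
  obtain ⟨D, hD⟩ := hg.2
  refine ⟨hf.1.sub hg.1, C + D, fun s => ?_⟩
  rw [add_mul]
  exact (abs_sub _ _).trans (add_le_add (hC s) (hD s))

theorem Adm.comp_add (hf : Adm δ f) (hδ : 0 ≤ δ) (h : ℝ) : Adm δ (fun s => f (s + h)) := by
  obtain ⟨C, hC0, hC⟩ := hf.exists_nonneg
  refine ⟨hf.1.comp (measurable_id.add_const h), C * Real.exp (h / 2 + δ * |h|), fun s => ?_⟩
  refine (hC _).trans ?_
  rw [mul_assoc, ← Real.exp_add]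
  gcongr
  have : |s| ≤ |s + h| + |h| := by
    have := abs_sub (s + h) h
    rwa [add_sub_cancel_right] at this
  nlinarith

theorem Adm.fdiff (hf : Adm δ f) (hδ : 0 ≤ δ) (h : ℝ) : Adm δ (fdiff h f) :=
  (hf.comp_add hδ h).sub hf

theorem Adm.norm_mul_le (hf : Adm δ f) (hg : Adm δ g) (hδ : 0 < δ) :
    ∃ C : ℝ, 0 ≤ C ∧ ∀ t s, ‖f (t - s) * g s‖ ≤
      C * Real.exp (t / 2 - δ / 2 * |t|) * Real.exp (-(δ / 2 * |s|)) := by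
  obtain ⟨C, hC0, hC⟩ := hf.exists_nonneg
  obtain ⟨D, hD0, hD⟩ := hg.exists_nonneg
  refine ⟨C * D, by positivity, fun t s => ?_⟩
  rw [norm_mul, Real.norm_eq_abs, Real.norm_eq_abs]
  calc _ ≤ (C * Real.exp ((t - s) / 2 - δ * |t - s|)) * (D * Real.exp (s / 2 - δ * |s|)) :=
        mul_le_mul (hC _) (hD _) (abs_nonneg _) ((abs_nonneg _).trans (hC _))
    _ = C * D * (Real.exp ((t - s) / 2 - δ * |t - s| + (s / 2 - δ * |s|))) := by
        rw [Real.exp_add]; ring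
    _ ≤ C * D * (Real.exp (t / 2 - δ / 2 * |t| + -(δ / 2 * |s|))) := by
        refine mul_le_mul_of_nonneg_left (Real.exp_le_exp.2 ?_) (by positivity)
        have : |t| ≤ |t - s| + |s| := by
          have := abs_add_le (t - s) s
          rwa [sub_add_cancel] at this
        nlinarith [abs_nonneg (t - s)]
    _ = _ := by rw [Real.exp_add]; ring

theorem Adm.integrable_conv (hf : Adm δ f) (hg : Adm δ g) (hδ : 0 < δ) (t : ℝ) :
    Integrable fun s => f (t - s) * g s := by
  obtain ⟨C, -, hC⟩ := hf.norm_mul_le hg hδ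
  refine Integrable.mono' ((integrable_exp_neg_abs (half_pos hδ)).const_mul
    (C * Real.exp (t / 2 - δ / 2 * |t|))) ?_ (Filter.Eventually.of_forall (hC t))
  exact ((hf.1.comp (measurable_const.sub measurable_id)).mul hg.1).aestronglyMeasurable

theorem measurable_conv (hf : Measurable f) (hg : Measurable g) : Measurable (conv f g) := by
  have : Measurable fun p : ℝ × ℝ => f (p.1 - p.2) * g p.2 :=
    (hf.comp (measurable_fst.sub measurable_snd)).mul (hg.comp measurable_snd)
  exact this.stronglyMeasurable.integral_prod_right.measurable

theorem Adm.conv (hf : Adm δ f) (hg : Adm δ g) (hδ : 0 < δ) : Adm (δ / 2) (conv f g) := by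
  obtain ⟨C, hC0, hC⟩ := hf.norm_mul_le hg hδ
  refine ⟨measurable_conv hf.1 hg.1, C * (2 / (δ / 2)), fun t => ?_⟩
  have := norm_integral_le_of_norm_le (((integrable_exp_neg_abs (half_pos hδ)).const_mul
    (C * Real.exp (t / 2 - δ / 2 * |t|)))) (Filter.Eventually.of_forall (hC t))
  rw [integral_const_mul, integral_exp_neg_abs (half_pos hδ)] at this
  calc _ ≤ _ := this
    _ = _ := by ring

theorem conv_fdiff_left (hf : Adm δ f) (hg : Adm δ g) (hδ : 0 < δ) (h : ℝ) :
    TernaryDivisor.conv (TernaryDivisor.fdiff h f) g =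
      TernaryDivisor.fdiff h (TernaryDivisor.conv f g) := by
  ext t
  simp only [TernaryDivisor.conv, TernaryDivisor.fdiff]
  rw [← integral_sub (hf.integrable_conv hg hδ _) (hf.integrable_conv hg hδ _)]
  congr 1; ext s
  rw [show t - s + h = t + h - s by ring]; ring

theorem conv_comm (f g : ℝ → ℝ) : TernaryDivisor.conv f g = TernaryDivisor.conv g f := by
  ext t
  simp only [TernaryDivisor.conv]
  rw [← integral_sub_left_eq_self _ _ t]
  congr 1; ext s
  rw [sub_sub_cancel, mul_comm]

theorem conv_fdiff_right (hf : Adm δ f) (hg : Adm δ g) (hδ : 0 < δ) (h : ℝ) :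
    TernaryDivisor.conv f (TernaryDivisor.fdiff h g) =
      TernaryDivisor.fdiff h (TernaryDivisor.conv f g) := by
  rw [conv_comm, conv_fdiff_left hg hf hδ, conv_comm]

variable {q : ℕ} [NeZero q]

theorem adm_disc (r : ZMod q) : Adm (1 / 2) (disc r) :=
  ⟨measurable_disc r, 1, fun s => by
    rw [one_mul]; convert! abs_disc_le r s using 2; ring⟩

theorem adm_step (h : ℝ) (r : ZMod q) : Adm (1 / 2) (step h r) :=
  (adm_disc r).fdiff (by norm_num) h

/-- The three-fold convolution attached to a family of functions. -/
noncomputable def tri (f : ZMod q → ℝ → ℝ) (a : ZMod q) (t : ℝ) : ℂ :=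
  ∑ r₁, ∑ r₂, ∑ r₃, χ (a * r₁ * r₂ * r₃) *
    (TernaryDivisor.conv (f r₁) (TernaryDivisor.conv (f r₂) (f r₃)) t : ℂ)

theorem tri_step (h : ℝ) (a : ZMod q) (t : ℝ) :
    tri (step h) a t = tri disc a (t + 3 * h) - 3 * tri disc a (t + 2 * h) +
      3 * tri disc a (t + h) - tri disc a t := by
  have key : ∀ r₁ r₂ r₃ : ZMod q,
      TernaryDivisor.conv (step h r₁) (TernaryDivisor.conv (step h r₂) (step h r₃)) =
      TernaryDivisor.fdiff h (TernaryDivisor.fdiff h (TernaryDivisor.fdiff h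
        (TernaryDivisor.conv (disc r₁) (TernaryDivisor.conv (disc r₂) (disc r₃))))) := by
    intro r₁ r₂ r₃
    have h0 : ∀ r : ZMod q, step h r = TernaryDivisor.fdiff h (disc r) := fun r => rfl
    have h23 := (adm_disc r₂).conv (adm_disc r₃) (by norm_num)
    have h1 := (adm_disc r₁).mono (show (1 / 2 / 2 : ℝ) ≤ 1 / 2 by norm_num)
    have hp : (0 : ℝ) < 1 / 2 / 2 := by norm_num
    rw [h0, h0, h0, conv_fdiff_left (adm_disc r₂) ((adm_disc r₃).fdiff (by norm_num) h)
      (by norm_num), conv_fdiff_right (adm_disc r₂) (adm_disc r₃) (by norm_num),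
      conv_fdiff_left h1 ((h23.fdiff hp.le h).fdiff hp.le h) hp,
      conv_fdiff_right h1 (h23.fdiff hp.le h) hp, conv_fdiff_right h1 h23 hp]
  simp only [tri, key, Finset.mul_sum, ← Finset.sum_sub_distrib, ← Finset.sum_add_distrib]
  refine Finset.sum_congr rfl (fun r₁ _ => Finset.sum_congr rfl (fun r₂ _ =>
    Finset.sum_congr rfl (fun r₃ _ => ?_)))
  simp only [TernaryDivisor.fdiff]
  rw [show t + h + h + h = t + 3 * h by ring, show t + h + h = t + 2 * h by ring]
  push_cast
  ring

end Convolution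

/-! ### Main terms of the convolutions of discrepancies -/

section MainTerms

variable {q : ℕ} [NeZero q]

/-- The counting function in the logarithmic variable. -/
noncomputable def lcnt (r : ZMod q) (s : ℝ) : ℝ := cnt r ⌊Real.exp s⌋₊

theorem disc_eq_lcnt (r : ZMod q) (s : ℝ) : disc r s = lcnt r s - Real.exp s / q := rfl

theorem lcnt_of_neg (r : ZMod q) {s : ℝ} (hs : s < 0) : lcnt r s = 0 := by
  rw [lcnt, cnt_floor_exp_of_neg r hs]; simp

/-- The weighted discrepancy `e^{-s} disc_r(s)` on `s ≥ 0`. -/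
noncomputable def wdisc (r : ZMod q) (s : ℝ) : ℝ :=
  Set.indicator (Set.Ici 0) (fun s => Real.exp (-s) * disc r s) s

theorem integrable_wdisc (r : ZMod q) (k : ℕ) : Integrable fun s => s ^ k * wdisc r s := by
  have h : (fun s => s ^ k * wdisc r s) =
      Set.indicator (Set.Ici 0) (fun s => s ^ k * (Real.exp (-s) * disc r s)) := by
    ext s; by_cases hs : s ∈ Set.Ici (0 : ℝ) <;> simp [wdisc, hs]
  rw [h, integrable_indicator_iff measurableSet_Ici, integrableOn_Ici_iff_integrableOn_Ioi]
  have h1 := Real.GammaIntegral_convergent (s := k + 1) (by positivity)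
  refine Integrable.mono' h1 ?_ ?_
  · exact ((measurable_id.pow_const k).mul
      (Real.measurable_exp.comp measurable_neg |>.mul (measurable_disc r))).aestronglyMeasurable
  · refine (ae_restrict_iff' measurableSet_Ioi).2 (Filter.Eventually.of_forall fun s hs => ?_)
    have hs' : 0 < s := hs
    rw [add_sub_cancel_right, Real.rpow_natCast, norm_mul, norm_mul, Real.norm_eq_abs,
      Real.norm_eq_abs, Real.norm_eq_abs, abs_of_pos (Real.exp_pos _), abs_of_pos (by positivity)]
    have := abs_disc_le_one r s
    have h2 : 0 < Real.exp (-s) := Real.exp_pos _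
    have h3 : 0 < s ^ k := by positivity
    calc s ^ k * (Real.exp (-s) * |disc r s|) ≤ s ^ k * (Real.exp (-s) * 1) := by gcongr
      _ = _ := by ring

/-- Correction function collecting the contributions of the smooth parts. -/
noncomputable def corr (F P : ℝ → ℝ) (t y : ℝ) : ℝ :=
  Set.indicator (Set.Ici 0) (fun y => Real.exp (-y) * F y) y +
    (Set.indicator (Set.Icc 0 t) P y - Set.indicator (Set.Ioo t 0) P y)

theorem disc_mul_eq (r : ZMod q) {F S P : ℝ → ℝ} (hF : ∀ t, F t = S t - Real.exp t * P t)
    (hS : ∀ t < 0, S t = 0) (t s : ℝ) :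
    disc r s * F (t - s) = lcnt r s * S (t - s) - Real.exp t * (wdisc r s * P (t - s)) -
      Real.exp t / q * corr F P t (t - s) := by
  have hq := (q_pos (q := q)).ne'
  obtain ⟨y, rfl⟩ : ∃ y, s = t - y := ⟨t - s, by ring⟩
  rw [sub_sub_cancel]
  have he : Real.exp t = Real.exp (t - y) * Real.exp y := by rw [← Real.exp_add]; ring_nf
  have he1 : Real.exp (t - y) * Real.exp (-(t - y)) = 1 := by rw [← Real.exp_add]; simp
  have he2 : Real.exp y * Real.exp (-y) = 1 := by rw [← Real.exp_add]; simp
  have hFy := hF y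
  rcases le_or_gt y t with hyt | hyt
  · have hw : wdisc r (t - y) = Real.exp (-(t - y)) * disc r (t - y) := by
      rw [wdisc, Set.indicator_of_mem (by simpa using hyt)]
    have hc : Real.exp y * corr F P t y = S y := by
      rcases le_or_gt 0 y with hy | hy
      · rw [corr, Set.indicator_of_mem (by simpa using hy), Set.indicator_of_mem (Set.mem_Icc.2 ⟨hy, hyt⟩),
          Set.indicator_of_notMem (by simp [hy]), hFy]
        linear_combination (S y - Real.exp y * P y) * he2
      · rw [corr, Set.indicator_of_notMem (by simpa using hy),
          Set.indicator_of_notMem (by simp [hy]), Set.indicator_of_notMem (by simp [hyt]),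
          hS y hy]
        ring
    rw [hw, hFy, he]
    have hd := disc_eq_lcnt r (t - y)
    linear_combination (Real.exp y * disc r (t - y) * P y) * he1 + S y * hd
      + Real.exp (t - y) / q * hc
  · have hw : wdisc r (t - y) = 0 := by
      rw [wdisc, Set.indicator_of_notMem (by simpa using hyt)]
    have hc : Real.exp y * corr F P t y = F y := by
      rcases le_or_gt 0 y with hy | hy
      · rw [corr, Set.indicator_of_mem (by simpa using hy),
          Set.indicator_of_notMem (by simp [hyt]), Set.indicator_of_notMem (by simp [hy])]
        linear_combination F y * he2
      · rw [corr, Set.indicator_of_notMem (by simpa using hy),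
          Set.indicator_of_notMem (by simp [hy]), Set.indicator_of_mem (Set.mem_Ioo.2 ⟨hyt, hy⟩), hFy, hS y hy]
        ring
    have hl : lcnt r (t - y) = 0 := lcnt_of_neg r (by linarith)
    rw [hw, he, disc_eq_lcnt, hl]
    linear_combination Real.exp (t - y) / q * hc

theorem Adm.integrable_exp_neg_mul {F : ℝ → ℝ} {δ : ℝ} (hδ : 0 ≤ δ) (hF : Adm δ F) :
    Integrable (Set.indicator (Set.Ici 0) fun y => Real.exp (-y) * F y) := by
  obtain ⟨C, hC0, hC⟩ := hF.exists_nonneg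
  rw [integrable_indicator_iff measurableSet_Ici, integrableOn_Ici_iff_integrableOn_Ioi]
  refine Integrable.mono' ((integrableOn_exp_mul_Ioi (a := -(1 / 2)) (by norm_num) 0).const_mul C)
    ((Real.measurable_exp.comp measurable_neg).mul hF.1).aestronglyMeasurable ?_
  refine Filter.Eventually.of_forall fun y => ?_
  rw [norm_mul, Real.norm_eq_abs, Real.norm_eq_abs, abs_of_pos (Real.exp_pos _)]
  calc _ ≤ Real.exp (-y) * (C * Real.exp (y / 2 - δ * |y|)) := by gcongr; exact hC y
    _ = C * Real.exp (-y + (y / 2 - δ * |y|)) := by rw [Real.exp_add]; ring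
    _ ≤ _ := by
      gcongr
      have : 0 ≤ δ * |y| := by positivity
      linarith

theorem integrable_corr {F : ℝ → ℝ} {δ : ℝ} (hδ : 0 ≤ δ) (hF : Adm δ F) (c₀ c₁ t : ℝ) :
    Integrable (corr F (fun y => c₀ + c₁ * y) t) := by
  have hP : Continuous fun y : ℝ => c₀ + c₁ * y := by fun_prop
  refine (hF.integrable_exp_neg_mul hδ).add (Integrable.sub ?_ ?_)
  · exact (hP.integrableOn_Icc).integrable_indicator measurableSet_Icc
  · exact (hP.integrableOn_Icc.mono_set Set.Ioo_subset_Icc_self).integrable_indicator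
      measurableSet_Ioo

theorem integral_corr {F : ℝ → ℝ} {δ : ℝ} (hδ : 0 ≤ δ) (hF : Adm δ F) (c₀ c₁ t : ℝ) :
    ∫ y, corr F (fun y => c₀ + c₁ * y) t y =
      (∫ y, Set.indicator (Set.Ici 0) (fun y => Real.exp (-y) * F y) y) +
        (c₀ * t + c₁ * t ^ 2 / 2) := by
  have hP : Continuous fun y : ℝ => c₀ + c₁ * y := by fun_prop
  have h1 : Integrable (Set.indicator (Set.Icc 0 t) fun y : ℝ => c₀ + c₁ * y) :=
    (hP.integrableOn_Icc).integrable_indicator measurableSet_Icc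
  have h2 : Integrable (Set.indicator (Set.Ioo t 0) fun y : ℝ => c₀ + c₁ * y) :=
    (hP.integrableOn_Icc.mono_set Set.Ioo_subset_Icc_self).integrable_indicator measurableSet_Ioo
  simp only [corr]
  have h12 : Integrable fun y : ℝ => Set.indicator (Set.Icc 0 t) (fun y : ℝ => c₀ + c₁ * y) y -
      Set.indicator (Set.Ioo t 0) (fun y : ℝ => c₀ + c₁ * y) y := h1.sub h2
  rw [integral_add (hF.integrable_exp_neg_mul hδ) h12, integral_sub h1 h2,
    integral_indicator measurableSet_Icc, integral_indicator measurableSet_Ioo]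
  congr 1
  have h_int : ∫ y in (0 : ℝ)..t, (c₀ + c₁ * y) = c₀ * t + c₁ * t ^ 2 / 2 := by
    have hi : IntervalIntegrable (fun y : ℝ => c₁ * y) volume 0 t :=
      (by fun_prop : Continuous fun y : ℝ => c₁ * y).intervalIntegrable _ _
    rw [intervalIntegral.integral_add (by simp) hi,
      intervalIntegral.integral_const_mul, integral_id]
    simp; ring
  rw [← h_int]
  rcases le_total 0 t with ht | ht
  · rw [intervalIntegral.integral_of_le ht, integral_Icc_eq_integral_Ioc, Set.Ioo_eq_empty
      (by simpa using ht)]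
    simp
  · rw [intervalIntegral.integral_of_ge ht, ← integral_Ioc_eq_integral_Ioo]
    rcases ht.lt_or_eq with ht' | rfl
    · rw [Set.Icc_eq_empty (by simpa using ht')]; simp
    · simp

/-- Convolution with a discrepancy separates into a counting convolution and a main term. -/
theorem exists_conv_disc_eq (r : ZMod q) {F S : ℝ → ℝ} {c₀ c₁ δ : ℝ} (hδ : 0 < δ) (hδ' : δ ≤ 1 / 2)
    (hA : Adm δ F) (hF : ∀ t, F t = S t - Real.exp t * (c₀ + c₁ * t)) (hS : ∀ t < 0, S t = 0) :
    ∃ d₀ d₁ d₂ : ℝ, (c₁ = 0 → d₂ = 0) ∧ ∀ t, conv (disc r) F t =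
      (∫ s, lcnt r s * S (t - s)) - Real.exp t * (d₀ + d₁ * t + d₂ * t ^ 2) := by
  set M₀ := ∫ s, wdisc r s
  set M₁ := ∫ s, s * wdisc r s
  set I := ∫ y, Set.indicator (Set.Ici 0) (fun y => Real.exp (-y) * F y) y
  refine ⟨c₀ * M₀ - c₁ * M₁ + I / q, c₁ * M₀ + c₀ / q, c₁ / (2 * q), by simp +contextual,
    fun t => ?_⟩
  have i0 : Integrable (wdisc r) := by simpa using integrable_wdisc r 0
  have i1 : Integrable fun s => s * wdisc r s := by simpa using integrable_wdisc r 1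
  have hexp : ∀ s, wdisc r s * (c₀ + c₁ * (t - s)) =
      (c₀ + c₁ * t) * wdisc r s - c₁ * (s * wdisc r s) := fun s => by ring
  have j1 : Integrable fun s => disc r s * F (t - s) := by
    have := (((adm_disc r).mono hδ').integrable_conv hA hδ t).comp_sub_left t
    simpa only [sub_sub_cancel] using this
  have j2 : Integrable fun s => wdisc r s * (c₀ + c₁ * (t - s)) := by
    simp only [hexp]; exact (i0.const_mul _).sub (i1.const_mul _)
  have j3 : Integrable fun s => corr F (fun y => c₀ + c₁ * y) t (t - s) :=
    (integrable_corr hδ.le hA c₀ c₁ t).comp_sub_left t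
  have hid := disc_mul_eq r hF hS t
  have j4 : Integrable fun s => lcnt r s * S (t - s) := by
    have := (j1.add (j2.const_mul (Real.exp t))).add (j3.const_mul (Real.exp t / q))
    refine this.congr (Filter.Eventually.of_forall fun s => ?_)
    have := hid s
    simp only [Pi.add_apply]
    linarith
  have h1 : conv (disc r) F t = ∫ s, disc r s * F (t - s) := by
    rw [conv_comm, conv]; simp only [mul_comm]
  rw [h1]
  simp only [hid]
  have j24 : Integrable fun s => lcnt r s * S (t - s) -
      Real.exp t * (wdisc r s * (c₀ + c₁ * (t - s))) := j4.sub (j2.const_mul _)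
  rw [integral_sub j24 (j3.const_mul _), integral_sub j4 (j2.const_mul _),
    integral_const_mul, integral_const_mul,
    integral_sub_left_eq_self (fun y => corr F (fun y => c₀ + c₁ * y) t y),
    integral_corr hδ.le hA]
  simp only [hexp]
  rw [integral_sub (i0.const_mul _) (i1.const_mul _), integral_const_mul, integral_const_mul]
  have := (q_pos (q := q)).ne'
  field_simp
  ring

end MainTerms

section Ramp

/-- Heaviside function jumping at `c`. -/
noncomputable def heav (c s : ℝ) : ℝ := if c ≤ s then 1 else 0

/-- Truncated power. -/
noncomputable def ramp (k : ℕ) (c s : ℝ) : ℝ := max (s - c) 0 ^ k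

theorem heav_mul_heav (a b t s : ℝ) :
    heav a s * heav b (t - s) = Set.indicator (Set.Icc a (t - b)) (fun _ => (1 : ℝ)) s := by
  simp only [heav, Set.indicator, Set.mem_Icc]
  have : b ≤ t - s ↔ s ≤ t - b := by constructor <;> intro <;> linarith
  simp only [this]
  split_ifs <;> simp_all

theorem heav_mul_ramp (a b t s : ℝ) :
    heav a s * ramp 1 b (t - s) = Set.indicator (Set.Icc a (t - b)) (fun s => t - b - s) s := by
  simp only [heav, ramp, Set.indicator, Set.mem_Icc, pow_one]
  rcases le_or_gt s (t - b) with h | h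
  · rw [max_eq_left (by linarith)]
    simp only [h, and_true]
    split_ifs <;> ring
  · rw [max_eq_right (by linarith)]
    simp [not_le.2 h]

theorem integrable_heav_mul_heav (a b t : ℝ) :
    Integrable fun s => heav a s * heav b (t - s) := by
  simp only [heav_mul_heav]
  exact (continuous_const.integrableOn_Icc).integrable_indicator measurableSet_Icc

theorem integrable_heav_mul_ramp (a b t : ℝ) :
    Integrable fun s => heav a s * ramp 1 b (t - s) := by
  simp only [heav_mul_ramp]
  exact ((by fun_prop : Continuous fun s => t - b - s).integrableOn_Icc).integrable_indicator
    measurableSet_Icc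

theorem integral_heav_mul_heav (a b t : ℝ) :
    ∫ s, heav a s * heav b (t - s) = ramp 1 (a + b) t := by
  simp only [heav_mul_heav]
  rw [integral_indicator measurableSet_Icc, ramp]
  simp
  congr 1; ring

theorem integral_heav_mul_ramp (a b t : ℝ) :
    ∫ s, heav a s * ramp 1 b (t - s) = ramp 2 (a + b) t / 2 := by
  simp only [heav_mul_ramp]
  rw [integral_indicator measurableSet_Icc, ramp]
  rcases le_or_gt a (t - b) with h | h
  · rw [integral_Icc_eq_integral_Ioc, ← intervalIntegral.integral_of_le h,
      max_eq_left (by linarith),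
      intervalIntegral.integral_comp_sub_left (fun s => s) (t - b)]
    rw [integral_id]; ring
  · rw [Set.Icc_eq_empty (not_le.2 h), max_eq_right (by linarith)]; simp

variable {q : ℕ} [NeZero q]

/-- The integers of `[1, N]` in a residue class. -/
def cls (r : ZMod q) (N : ℕ) : Finset ℕ := (Finset.Icc 1 N).filter fun n : ℕ => (n : ZMod q) = r

theorem log_nonneg_of_mem_cls {r : ZMod q} {N n : ℕ} (_ : n ∈ cls r N) : 0 ≤ Real.log n :=
  Real.log_natCast_nonneg n

theorem lcnt_eq_sum (r : ZMod q) {N : ℕ} {s : ℝ} (hs : Real.exp s < N + 1) :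
    lcnt r s = ∑ n ∈ cls r N, heav (Real.log n) s := by
  simp only [lcnt, cnt, heav, cls]
  rw [← Finset.sum_filter, Finset.sum_const, nsmul_eq_mul, mul_one, Finset.filter_filter]
  congr 2
  ext n
  simp only [Finset.mem_filter, Finset.mem_Icc]
  have key : 1 ≤ n → (n ≤ ⌊Real.exp s⌋₊ ↔ Real.log n ≤ s) := fun h1 => by
    rw [Nat.le_floor_iff (Real.exp_pos s).le, Real.log_le_iff_le_exp (by exact_mod_cast h1)]
  constructor
  · rintro ⟨⟨h1, h2⟩, h3⟩
    refine ⟨⟨h1, ?_⟩, h3, (key h1).1 h2⟩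
    have h4 := (Nat.le_floor_iff (Real.exp_pos s).le).1 h2
    have : (n : ℝ) < N + 1 := h4.trans_lt hs
    exact Nat.lt_succ_iff.1 (by exact_mod_cast this)
  · rintro ⟨⟨h1, h2⟩, h3, h4⟩
    exact ⟨⟨h1, (key h1).2 h4⟩, h3⟩

theorem exp_lt_of_le {N : ℕ} {t s : ℝ} (ht : Real.exp t < N + 1) (hs : s ≤ t) :
    Real.exp s < N + 1 := (Real.exp_le_exp.2 hs).trans_lt ht

theorem lcnt_mul_lcnt (r₁ r₂ : ZMod q) {N : ℕ} {t : ℝ} (ht : Real.exp t < N + 1) (s : ℝ) :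
    lcnt r₁ s * lcnt r₂ (t - s) =
      ∑ m ∈ cls r₁ N, ∑ n ∈ cls r₂ N, heav (Real.log m) s * heav (Real.log n) (t - s) := by
  rw [← Finset.sum_mul_sum]
  have hz : ∀ (r : ZMod q) (y : ℝ), y < 0 → ∑ n ∈ cls r N, heav (Real.log n) y = 0 := by
    intro r y hy
    refine Finset.sum_eq_zero (fun n hn => ?_)
    rw [heav, if_neg]
    have := log_nonneg_of_mem_cls hn
    linarith
  rcases lt_or_ge s 0 with h | h
  · rw [lcnt_of_neg r₁ h, hz r₁ s h, zero_mul, zero_mul]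
  rcases lt_or_ge (t - s) 0 with h' | h'
  · rw [lcnt_of_neg r₂ h', hz r₂ _ h', mul_zero, mul_zero]
  rw [lcnt_eq_sum r₁ (exp_lt_of_le ht (by linarith)), lcnt_eq_sum r₂ (exp_lt_of_le ht (by linarith))]

theorem integral_lcnt_mul_lcnt (r₁ r₂ : ZMod q) {N : ℕ} {t : ℝ} (ht : Real.exp t < N + 1) :
    ∫ s, lcnt r₁ s * lcnt r₂ (t - s) =
      ∑ m ∈ cls r₁ N, ∑ n ∈ cls r₂ N, ramp 1 (Real.log m + Real.log n) t := by
  simp only [lcnt_mul_lcnt r₁ r₂ ht]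
  rw [integral_finsetSum _ (fun m _ => integrable_finsetSum _
    (fun n _ => integrable_heav_mul_heav _ _ _))]
  refine Finset.sum_congr rfl (fun m _ => ?_)
  rw [integral_finsetSum _ (fun n _ => integrable_heav_mul_heav _ _ _)]
  simp only [integral_heav_mul_heav]

theorem ramp_of_le {k : ℕ} (hk : k ≠ 0) {c s : ℝ} (h : s ≤ c) : ramp k c s = 0 := by
  rw [ramp, max_eq_right (by linarith), zero_pow hk]

theorem integral_lcnt_of_neg (r₁ r₂ : ZMod q) {t : ℝ} (ht : t < 0) :
    ∫ s, lcnt r₁ s * lcnt r₂ (t - s) = 0 := by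
  have : ∀ s, lcnt r₁ s * lcnt r₂ (t - s) = 0 := fun s => by
    rcases lt_or_ge s 0 with h | h
    · rw [lcnt_of_neg r₁ h, zero_mul]
    · rw [lcnt_of_neg r₂ (by linarith), mul_zero]
  simp [this]

theorem lcnt_mul_integral (r₁ r₂ r₃ : ZMod q) {N : ℕ} {t : ℝ} (ht : Real.exp t < N + 1) (s : ℝ) :
    lcnt r₁ s * ∫ y, lcnt r₂ y * lcnt r₃ (t - s - y) =
      ∑ l ∈ cls r₁ N, ∑ m ∈ cls r₂ N, ∑ n ∈ cls r₃ N,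
        heav (Real.log l) s * ramp 1 (Real.log m + Real.log n) (t - s) := by
  rcases lt_or_ge s 0 with h | h
  · rw [lcnt_of_neg r₁ h, zero_mul]
    refine (Finset.sum_eq_zero fun l hl => Finset.sum_eq_zero fun m _ =>
      Finset.sum_eq_zero fun n _ => ?_).symm
    rw [heav, if_neg, zero_mul]
    have := log_nonneg_of_mem_cls hl
    linarith
  rcases lt_or_ge (t - s) 0 with h' | h'
  · rw [integral_lcnt_of_neg r₂ r₃ h', mul_zero]
    refine (Finset.sum_eq_zero fun l _ => Finset.sum_eq_zero fun m hm =>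
      Finset.sum_eq_zero fun n hn => ?_).symm
    rw [ramp_of_le one_ne_zero, mul_zero]
    have := log_nonneg_of_mem_cls hm
    have := log_nonneg_of_mem_cls hn
    linarith
  rw [lcnt_eq_sum r₁ (exp_lt_of_le ht (by linarith)),
    integral_lcnt_mul_lcnt r₂ r₃ (exp_lt_of_le ht (by linarith)), Finset.sum_mul]
  refine Finset.sum_congr rfl (fun l _ => ?_)
  rw [Finset.mul_sum]
  exact Finset.sum_congr rfl (fun m _ => by rw [Finset.mul_sum])

theorem integral_lcnt_mul_integral (r₁ r₂ r₃ : ZMod q) {N : ℕ} {t : ℝ}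
    (ht : Real.exp t < N + 1) :
    ∫ s, lcnt r₁ s * ∫ y, lcnt r₂ y * lcnt r₃ (t - s - y) =
      ∑ l ∈ cls r₁ N, ∑ m ∈ cls r₂ N, ∑ n ∈ cls r₃ N,
        ramp 2 (Real.log l + (Real.log m + Real.log n)) t / 2 := by
  simp only [lcnt_mul_integral r₁ r₂ r₃ ht]
  rw [integral_finsetSum _ (fun l _ => integrable_finsetSum _ (fun m _ => integrable_finsetSum _
    (fun n _ => integrable_heav_mul_ramp _ _ _)))]
  refine Finset.sum_congr rfl (fun l _ => ?_)
  rw [integral_finsetSum _ (fun m _ => integrable_finsetSum _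
    (fun n _ => integrable_heav_mul_ramp _ _ _))]
  refine Finset.sum_congr rfl (fun m _ => ?_)
  rw [integral_finsetSum _ (fun n _ => integrable_heav_mul_ramp _ _ _)]
  simp only [integral_heav_mul_ramp]

theorem exists_conv_disc_disc_disc_eq (r₁ r₂ r₃ : ZMod q) :
    ∃ d₀ d₁ d₂ : ℝ, ∀ t, ∀ N : ℕ, Real.exp t < N + 1 →
      conv (disc r₁) (conv (disc r₂) (disc r₃)) t =
      (∑ l ∈ cls r₁ N, ∑ m ∈ cls r₂ N, ∑ n ∈ cls r₃ N,
        ramp 2 (Real.log l + (Real.log m + Real.log n)) t / 2) -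
        Real.exp t * (d₀ + d₁ * t + d₂ * t ^ 2) := by
  obtain ⟨a, b, c, hc, h⟩ := exists_conv_disc_eq r₂ (F := disc r₃) (S := lcnt r₃) (c₀ := 1 / q)
    (c₁ := 0) (by norm_num) le_rfl (adm_disc r₃)
    (fun t => by rw [disc_eq_lcnt]; ring) (fun t ht => lcnt_of_neg r₃ ht)
  obtain rfl := hc rfl
  obtain ⟨d₀, d₁, d₂, -, h'⟩ := exists_conv_disc_eq r₁ (F := conv (disc r₂) (disc r₃))
    (S := fun t => ∫ s, lcnt r₂ s * lcnt r₃ (t - s)) (c₀ := a)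
    (c₁ := b) (by norm_num) (by norm_num) ((adm_disc r₂).conv (adm_disc r₃) (by norm_num))
    (fun t => by rw [h]; ring) (fun t ht => integral_lcnt_of_neg r₂ r₃ ht)
  refine ⟨d₀, d₁, d₂, fun t N hN => ?_⟩
  rw [h', integral_lcnt_mul_integral r₁ r₂ r₃ hN]

theorem sum_cls {M : Type*} [AddCommMonoid M] (N : ℕ) (f : ZMod q → ℕ → M) :
    ∑ r, ∑ n ∈ cls r N, f r n = ∑ n ∈ Finset.Icc 1 N, f (n : ZMod q) n := by
  rw [← Finset.sum_fiberwise (s := Finset.Icc 1 N) (g := fun n : ℕ => (n : ZMod q))]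
  refine Finset.sum_congr rfl (fun r _ => Finset.sum_congr rfl (fun n hn => ?_))
  rw [(Finset.mem_filter.1 hn).2]

theorem d3_eq_card {k N : ℕ} (hk : k ∈ Finset.Icc 1 N) :
    d3 k = ((Finset.Icc 1 N ×ˢ Finset.Icc 1 N ×ˢ Finset.Icc 1 N).filter
      (fun p : ℕ × ℕ × ℕ => p.1 * p.2.1 * p.2.2 = k)).card := by
  rw [d3]
  congr 1
  ext ⟨a, b, c⟩
  simp only [Finset.mem_filter, Finset.mem_product, Finset.mem_Icc] at hk ⊢
  constructor
  · rintro ⟨h, rfl⟩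
    simp; omega
  · rintro ⟨h, rfl⟩
    have ha : 0 < a := h.1.1
    have hb : 0 < b := h.2.1.1
    have hc : 0 < c := h.2.2.1
    refine ⟨⟨⟨ha, ?_⟩, ⟨hb, ?_⟩, ⟨hc, ?_⟩⟩, rfl⟩
    · rw [mul_assoc]; exact Nat.le_mul_of_pos_right _ (by positivity)
    · rw [mul_right_comm]; exact Nat.le_mul_of_pos_left _ (by positivity)
    · exact Nat.le_mul_of_pos_left _ (by positivity)

theorem sum_triple_eq_sum_d3 (N : ℕ) (F : ℕ → ℂ) (hF : ∀ k, N < k → F k = 0) :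
    ∑ l ∈ Finset.Icc 1 N, ∑ m ∈ Finset.Icc 1 N, ∑ n ∈ Finset.Icc 1 N, F (l * m * n) =
      ∑ k ∈ Finset.Icc 1 N, (d3 k : ℂ) * F k := by
  have h1 : ∑ l ∈ Finset.Icc 1 N, ∑ m ∈ Finset.Icc 1 N, ∑ n ∈ Finset.Icc 1 N, F (l * m * n) =
      ∑ p ∈ Finset.Icc 1 N ×ˢ Finset.Icc 1 N ×ˢ Finset.Icc 1 N, F (p.1 * p.2.1 * p.2.2) := by
    rw [Finset.sum_product]
    exact Finset.sum_congr rfl (fun l _ => by rw [Finset.sum_product])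
  rw [h1, ← Finset.sum_filter_add_sum_filter_not _
    (fun p : ℕ × ℕ × ℕ => p.1 * p.2.1 * p.2.2 ∈ Finset.Icc 1 N)]
  rw [Finset.sum_eq_zero (s := Finset.filter (fun p : ℕ × ℕ × ℕ =>
    ¬ p.1 * p.2.1 * p.2.2 ∈ Finset.Icc 1 N) _), add_zero]
  · rw [← Finset.sum_fiberwise_of_maps_to (t := Finset.Icc 1 N)
      (g := fun p : ℕ × ℕ × ℕ => p.1 * p.2.1 * p.2.2)
      (fun p hp => (Finset.mem_filter.1 hp).2)]
    refine Finset.sum_congr rfl (fun k hk => ?_)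
    rw [Finset.sum_congr rfl (g := fun _ => F k)
      (fun p hp => by rw [(Finset.mem_filter.1 hp).2]), Finset.sum_const, nsmul_eq_mul,
      d3_eq_card hk, Finset.filter_filter]
    congr 3
    ext p
    simp only [Finset.mem_filter]
    constructor
    · rintro ⟨h, -, h'⟩; exact ⟨h, h'⟩
    · rintro ⟨h, h'⟩; exact ⟨h, by rw [h']; exact hk, h'⟩
  · rintro ⟨a, b, c⟩ hp
    simp only [Finset.mem_filter, Finset.mem_product, Finset.mem_Icc, not_and, not_le] at hp
    apply hF
    apply hp.2
    have h1 := hp.1.1.1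
    have h2 := hp.1.2.1.1
    have h3 := hp.1.2.2.1
    show 0 < a * b * c
    positivity

theorem sum_cls_triple {M : Type*} [AddCommMonoid M] (N : ℕ)
    (f : ZMod q → ZMod q → ZMod q → ℕ → ℕ → ℕ → M) :
    ∑ r₁, ∑ r₂, ∑ r₃, ∑ l ∈ cls r₁ N, ∑ m ∈ cls r₂ N, ∑ n ∈ cls r₃ N, f r₁ r₂ r₃ l m n =
      ∑ l ∈ Finset.Icc 1 N, ∑ m ∈ Finset.Icc 1 N, ∑ n ∈ Finset.Icc 1 N,
        f (l : ZMod q) (m : ZMod q) (n : ZMod q) l m n := by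
  calc _ = ∑ r₁, ∑ l ∈ cls r₁ N, ∑ r₂, ∑ m ∈ cls r₂ N, ∑ r₃, ∑ n ∈ cls r₃ N,
        f r₁ r₂ r₃ l m n := by
        refine Finset.sum_congr rfl (fun r₁ _ => ?_)
        rw [Finset.sum_comm (s := cls r₁ N)]
        refine Finset.sum_congr rfl (fun r₂ _ => ?_)
        rw [Finset.sum_comm]
        refine Finset.sum_congr rfl (fun l _ => ?_)
        rw [Finset.sum_comm]
    _ = _ := by
        rw [sum_cls N (fun r₁ l => ∑ r₂, ∑ m ∈ cls r₂ N, ∑ r₃, ∑ n ∈ cls r₃ N,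
          f r₁ r₂ r₃ l m n)]
        refine Finset.sum_congr rfl (fun l _ => ?_)
        rw [sum_cls N (fun r₂ m => ∑ r₃, ∑ n ∈ cls r₃ N, f l r₂ r₃ l m n)]
        refine Finset.sum_congr rfl (fun m _ => ?_)
        rw [sum_cls N (fun r₃ n => f l m r₃ l m n)]

/-- The threefold discrepancy convolution is a smoothed divisor sum minus its main term. -/
theorem exists_tri_disc_eq (a : ZMod q) :
    ∃ γ₀ γ₁ γ₂ : ℂ, ∀ t : ℝ, ∀ N : ℕ, Real.exp t < N + 1 →
      tri disc a t =
      (∑ k ∈ Finset.Icc 1 N, (d3 k : ℂ) * (χ (a * (k : ZMod q)) * (ramp 2 (Real.log k) t / 2 : ℝ))) -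
        Real.exp t * (γ₀ + γ₁ * t + γ₂ * t ^ 2) := by
  choose d₀ d₁ d₂ h using fun r₁ r₂ r₃ : ZMod q => exists_conv_disc_disc_disc_eq r₁ r₂ r₃
  refine ⟨∑ r₁, ∑ r₂, ∑ r₃, χ (a * r₁ * r₂ * r₃) * d₀ r₁ r₂ r₃,
    ∑ r₁, ∑ r₂, ∑ r₃, χ (a * r₁ * r₂ * r₃) * d₁ r₁ r₂ r₃,
    ∑ r₁, ∑ r₂, ∑ r₃, χ (a * r₁ * r₂ * r₃) * d₂ r₁ r₂ r₃, fun t N hN => ?_⟩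
  have hL : ∑ k ∈ Finset.Icc 1 N, (d3 k : ℂ) * (χ (a * (k : ZMod q)) * (ramp 2 (Real.log k) t / 2 : ℝ)) =
      ∑ r₁ : ZMod q, ∑ r₂ : ZMod q, ∑ r₃ : ZMod q, χ (a * r₁ * r₂ * r₃) *
        ((∑ l ∈ cls r₁ N, ∑ m ∈ cls r₂ N, ∑ n ∈ cls r₃ N,
        ramp 2 (Real.log l + (Real.log m + Real.log n)) t / 2 : ℝ) : ℂ) := by
    rw [← sum_triple_eq_sum_d3 N (fun k => χ (a * (k : ZMod q)) * (ramp 2 (Real.log k) t / 2 : ℝ))]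
    · push_cast
      simp only [Finset.mul_sum]
      rw [sum_cls_triple N (fun r₁ r₂ r₃ l m n => χ (a * r₁ * r₂ * r₃) *
        ((ramp 2 (Real.log l + (Real.log m + Real.log n)) t : ℂ) / 2))]
      refine Finset.sum_congr rfl fun l hl => Finset.sum_congr rfl fun m hm =>
        Finset.sum_congr rfl fun n hn => ?_
      have h1 : (l : ℝ) ≠ 0 := by have := (Finset.mem_Icc.1 hl).1; positivity
      have h2 : (m : ℝ) ≠ 0 := by have := (Finset.mem_Icc.1 hm).1; positivity
      have h3 : (n : ℝ) ≠ 0 := by have := (Finset.mem_Icc.1 hn).1; positivity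
      rw [Real.log_mul (mul_ne_zero h1 h2) h3, Real.log_mul h1 h2]
      simp only [mul_assoc, add_assoc]
    · intro k hk
      rw [ramp_of_le two_ne_zero]
      · simp
      · rw [← Real.log_exp t]
        refine Real.log_le_log (Real.exp_pos t) (hN.le.trans ?_)
        exact_mod_cast hk
  rw [hL, tri]
  simp only [Finset.mul_sum, Finset.sum_mul, ← Finset.sum_add_distrib, ← Finset.sum_sub_distrib]
  refine Finset.sum_congr rfl fun r₁ _ => Finset.sum_congr rfl fun r₂ _ =>
    Finset.sum_congr rfl fun r₃ _ => ?_
  rw [h r₁ r₂ r₃ t N hN]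
  push_cast
  ring

end Ramp

/-! ### Uniform bounds for the threefold convolution and the main-term coefficients -/

section Coefficients

theorem Adm.abs {f : ℝ → ℝ} {δ : ℝ} (hf : Adm δ f) : Adm δ (fun s => |f s|) := by
  obtain ⟨C, hC⟩ := hf.2
  exact ⟨hf.1.abs, C, fun s => by rw [abs_abs]; exact hC s⟩

theorem Adm.sum {ι : Type*} {f : ι → ℝ → ℝ} {δ : ℝ} (s : Finset ι) (hf : ∀ i, Adm δ (f i)) :
    Adm δ (fun t => ∑ i ∈ s, f i t) := by
  choose C hC using fun i => (hf i).2
  refine ⟨Finset.measurable_fun_sum _ (fun i _ => (hf i).1), ∑ i ∈ s, C i, fun t => ?_⟩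
  rw [Finset.sum_mul]
  exact (Finset.abs_sum_le_sum_abs _ _).trans (Finset.sum_le_sum (fun i _ => hC i t))

theorem conv_sum_left {ι : Type*} {f : ι → ℝ → ℝ} {g : ℝ → ℝ} {δ : ℝ} (s : Finset ι)
    (hf : ∀ i, Adm δ (f i)) (hg : Adm δ g) (hδ : 0 < δ) (t : ℝ) :
    conv (fun y => ∑ i ∈ s, f i y) g t = ∑ i ∈ s, conv (f i) g t := by
  simp only [conv, Finset.sum_mul]
  exact integral_finsetSum _ (fun i _ => (hf i).integrable_conv hg hδ t)

theorem conv_sum_right {ι : Type*} {f : ℝ → ℝ} {g : ι → ℝ → ℝ} {δ : ℝ} (s : Finset ι)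
    (hf : Adm δ f) (hg : ∀ i, Adm δ (g i)) (hδ : 0 < δ) (t : ℝ) :
    conv f (fun y => ∑ i ∈ s, g i y) t = ∑ i ∈ s, conv f (g i) t := by
  simp only [conv, Finset.mul_sum]
  exact integral_finsetSum _ (fun i _ => hf.integrable_conv (hg i) hδ t)

theorem abs_conv_le_conv_abs (f g : ℝ → ℝ) (t : ℝ) :
    |conv f g t| ≤ conv (fun s => |f s|) (fun s => |g s|) t := by
  simp only [conv, ← abs_mul]
  exact abs_integral_le_integral_abs

theorem conv_mono_right {f g k : ℝ → ℝ} {δ : ℝ} (hδ : 0 < δ) (hf : Adm δ f) (hg : Adm δ g)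
    (hk : Adm δ k) (h0 : ∀ s, 0 ≤ f s) (h : ∀ s, g s ≤ k s) (t : ℝ) : conv f g t ≤ conv f k t :=
  integral_mono (hf.integrable_conv hg hδ t) (hf.integrable_conv hk hδ t)
    (fun s => mul_le_mul_of_nonneg_left (h s) (h0 _))

variable {q : ℕ} [NeZero q]

theorem norm_tri_le_conv {f : ZMod q → ℝ → ℝ} {δ : ℝ} (hδ : 0 < δ) (hf : ∀ r, Adm δ (f r))
    (a : ZMod q) (t : ℝ) :
    ‖tri f a t‖ ≤ conv (fun s => ∑ r, |f r s|)
      (conv (fun s => ∑ r, |f r s|) (fun s => ∑ r, |f r s|)) t := by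
  have ha := fun r => (hf r).abs
  have hβ : Adm δ (fun s => ∑ r, |f r s|) := Adm.sum _ ha
  have hm : δ / 2 ≤ δ := by linarith
  have h2 : (TernaryDivisor.conv (fun s => ∑ r, |f r s|) (fun s => ∑ r, |f r s|)) =
      fun y => ∑ r₂, ∑ r₃, TernaryDivisor.conv (fun s => |f r₂ s|) (fun s => |f r₃ s|) y := by
    ext y
    rw [conv_sum_left _ ha hβ hδ]
    exact Finset.sum_congr rfl (fun r _ => conv_sum_right _ (ha r) ha hδ y)
  have hc : ∀ r₂ r₃, Adm (δ / 2)
      (TernaryDivisor.conv (fun s => |f r₂ s|) (fun s => |f r₃ s|)) :=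
    fun r₂ r₃ => (ha r₂).conv (ha r₃) hδ
  have hs : ∀ r₂, Adm (δ / 2)
      (fun y => ∑ r₃, TernaryDivisor.conv (fun s => |f r₂ s|) (fun s => |f r₃ s|) y) :=
    fun r₂ => Adm.sum _ (hc r₂)
  have key : ∀ r₁ r₂ r₃, |TernaryDivisor.conv (f r₁) (TernaryDivisor.conv (f r₂) (f r₃)) t| ≤
      TernaryDivisor.conv (fun s => |f r₁ s|)
        (TernaryDivisor.conv (fun s => |f r₂ s|) (fun s => |f r₃ s|)) t := fun r₁ r₂ r₃ =>
    (abs_conv_le_conv_abs _ _ t).trans (conv_mono_right (half_pos hδ) ((ha r₁).mono hm)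
      ((hf r₂).conv (hf r₃) hδ).abs (hc r₂ r₃) (fun s => abs_nonneg _)
      (fun s => abs_conv_le_conv_abs _ _ s) t)
  rw [h2, conv_sum_left _ (fun r => (ha r).mono hm) (Adm.sum _ hs) (half_pos hδ)]
  refine (norm_sum_le _ _).trans (Finset.sum_le_sum fun r₁ _ => ?_)
  rw [conv_sum_right _ ((ha r₁).mono hm) hs (half_pos hδ)]
  refine (norm_sum_le _ _).trans (Finset.sum_le_sum fun r₂ _ => ?_)
  rw [conv_sum_right _ ((ha r₁).mono hm) (hc r₂) (half_pos hδ)]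
  refine (norm_sum_le _ _).trans (Finset.sum_le_sum fun r₃ _ => ?_)
  rw [norm_mul, norm_χ, one_mul, Complex.norm_real]
  exact key r₁ r₂ r₃

theorem sum_abs_disc_le_exp {δ : ℝ} (hδ : δ ≤ 1 / 2) (s : ℝ) :
    ∑ r : ZMod q, |disc r s| ≤
      2 * (q : ℝ) ^ δ * Real.exp ((1 - δ) * s - δ * |s - Real.log q|) := by
  have hq : (0 : ℝ) < q := q_pos
  rw [Real.rpow_def_of_pos hq, mul_assoc, ← Real.exp_add]
  rcases le_total s (Real.log q) with h | h
  · refine (sum_abs_disc_le s).trans (le_of_eq ?_)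
    rw [abs_of_nonpos (by linarith)]
    congr 2; ring
  · refine (sum_abs_disc_le_card s).trans ?_
    rw [abs_of_nonneg (by linarith)]
    have h1 : (q : ℝ) = Real.exp (Real.log q) := (Real.exp_log hq).symm
    have h2 : Real.exp (Real.log q) ≤
        Real.exp (Real.log q * δ + ((1 - δ) * s - δ * (s - Real.log q))) := by
      apply Real.exp_le_exp.2; nlinarith
    have h3 := Real.exp_pos (Real.log q * δ + ((1 - δ) * s - δ * (s - Real.log q)))
    linarith

theorem norm_tri_disc_le {δ : ℝ} (hδ : 0 < δ) (hδ' : δ ≤ 1 / 2) (a : ZMod q) (t : ℝ) :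
    ‖tri disc a t‖ ≤ 32 / δ ^ 2 * (q : ℝ) ^ (3 * δ) * Real.exp ((1 - δ) * t) := by
  have hq : (0 : ℝ) < q := q_pos
  have h0 := sum_abs_disc_le_exp (q := q) hδ'
  have h1 : ∀ s, |∑ r : ZMod q, (|disc r s|)| ≤
      2 * (q : ℝ) ^ δ * Real.exp ((1 - δ) * s - δ * |s - Real.log q|) := fun s => by
    rw [abs_of_nonneg (Finset.sum_nonneg fun _ _ => abs_nonneg _)]; exact h0 s
  have h2 : ∀ s, |∑ r : ZMod q, (|disc r s|)| ≤
      2 * (q : ℝ) ^ δ * Real.exp ((1 - δ) * s) := fun s => (h1 s).trans (by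
    gcongr; have : 0 ≤ δ * |s - Real.log q| := by positivity
    linarith)
  have h3 := abs_conv_le hδ h1 (abs_conv_le hδ h1 h2) t
  refine (norm_tri_le_conv (by norm_num) adm_disc a t).trans ((le_abs_self _).trans (h3.trans
    (le_of_eq ?_)))
  rw [show (q : ℝ) ^ (3 * δ) = (q : ℝ) ^ δ * (q : ℝ) ^ δ * (q : ℝ) ^ δ by
    rw [← Real.rpow_add hq, ← Real.rpow_add hq]; ring_nf]
  field_simp
  ring

theorem measurable_tri {f : ZMod q → ℝ → ℝ} (hf : ∀ r, Measurable (f r)) (a : ZMod q) :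
    Measurable (tri f a) := by
  unfold tri
  refine Finset.measurable_fun_sum _ fun r₁ _ => Finset.measurable_fun_sum _ fun r₂ _ =>
    Finset.measurable_fun_sum _ fun r₃ _ => Measurable.const_mul ?_ _
  exact Complex.measurable_ofReal.comp (measurable_conv (hf r₁) (measurable_conv (hf r₂) (hf r₃)))

/-- The main-term polynomial coefficients of `tri disc a`. -/
structure MainCoeff (a : ZMod q) (γ : Fin 3 → ℂ) : Prop where
  eq : ∀ t : ℝ, ∀ N : ℕ, Real.exp t < N + 1 → tri disc a t =
      (∑ k ∈ Finset.Icc 1 N, (d3 k : ℂ) * (χ (a * (k : ZMod q)) *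
        (ramp 2 (Real.log k) t / 2 : ℝ))) - Real.exp t * (γ 0 + γ 1 * t + γ 2 * t ^ 2)

theorem exists_mainCoeff (a : ZMod q) : ∃ γ, MainCoeff a γ := by
  obtain ⟨γ₀, γ₁, γ₂, h⟩ := exists_tri_disc_eq a
  exact ⟨![γ₀, γ₁, γ₂], ⟨by simpa using h⟩⟩

theorem MainCoeff.norm_le {a : ZMod q} {γ : Fin 3 → ℂ} (h : MainCoeff a γ) (i : Fin 3) :
    ‖γ i‖ ≤ 10 ^ 7 * (q : ℝ) ^ ((1 : ℝ) / 8) := by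
  have hq : (0 : ℝ) < q := q_pos
  have key : ∀ t : ℝ, t < 0 → -3 ≤ t → ‖γ 0 + γ 1 * t + γ 2 * t ^ 2‖ ≤
      21100 * (q : ℝ) ^ ((1 : ℝ) / 8) := by
    intro t ht ht'
    have h1 := h.eq t 0 (by simpa using ht)
    simp only [Nat.zero_lt_one, Finset.Icc_eq_empty_of_lt, Finset.sum_empty, zero_sub] at h1
    have h2 := norm_tri_disc_le (q := q) (δ := 1 / 24) (by norm_num) (by norm_num) a t
    rw [h1, norm_neg, norm_mul, Complex.norm_real, Real.norm_eq_abs,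
      abs_of_pos (Real.exp_pos t)] at h2
    have h3 : Real.exp ((1 - 1 / 24) * t) ≤ Real.exp t * (8 / 7) := by
      have h4 : Real.exp (1 / 8) ≤ 8 / 7 := by
        have := Real.one_sub_le_exp_neg (1 / 8)
        rw [Real.exp_neg, le_inv_comm₀ (by norm_num) (Real.exp_pos _)] at this
        exact this.trans (by norm_num)
      calc _ ≤ Real.exp (t + 1 / 8) := Real.exp_le_exp.2 (by linarith)
        _ = Real.exp t * Real.exp (1 / 8) := Real.exp_add _ _
        _ ≤ _ := by gcongr
    have h5 : (3 * (1 / 24) : ℝ) = 1 / 8 := by norm_num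
    rw [h5] at h2
    have hQ : 0 < (q : ℝ) ^ ((1 : ℝ) / 8) := Real.rpow_pos_of_pos hq _
    refine le_of_mul_le_mul_left ?_ (Real.exp_pos t)
    calc _ ≤ _ := h2
      _ ≤ 32 / (1 / 24) ^ 2 * (q : ℝ) ^ ((1 : ℝ) / 8) * (Real.exp t * (8 / 7)) := by gcongr
      _ = (32 / (1 / 24) ^ 2 * (8 / 7)) * (Real.exp t * (q : ℝ) ^ ((1 : ℝ) / 8)) := by ring
      _ ≤ 21100 * (Real.exp t * (q : ℝ) ^ ((1 : ℝ) / 8)) := by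
        gcongr; norm_num
      _ = _ := by ring
  set M := 21100 * (q : ℝ) ^ ((1 : ℝ) / 8) with hM
  have hM0 : 0 ≤ M := by positivity
  have hA := key (-1) (by norm_num) (by norm_num)
  have hB := key (-2) (by norm_num) (by norm_num)
  have hC := key (-3) (by norm_num) le_rfl
  set A := γ 0 + γ 1 * (-1 : ℝ) + γ 2 * (-1 : ℝ) ^ 2 with hA'
  set B := γ 0 + γ 1 * (-2 : ℝ) + γ 2 * (-2 : ℝ) ^ 2 with hB'
  set C := γ 0 + γ 1 * (-3 : ℝ) + γ 2 * (-3 : ℝ) ^ 2 with hC'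
  have comb : ∀ u v w : ℂ, ‖u‖ ≤ 3 → ‖v‖ ≤ 4 → ‖w‖ ≤ 2 → ‖u * A + v * B + w * C‖ ≤ 10 * M := by
    intro u v w hu hv hw
    calc _ ≤ ‖u * A‖ + ‖v * B‖ + ‖w * C‖ := norm_add₃_le
      _ ≤ 3 * M + 4 * M + 2 * M := by
        rw [norm_mul, norm_mul, norm_mul]; gcongr
      _ ≤ 10 * M := by linarith
  have e0 : γ 0 = 3 * A + (-3) * B + 1 * C := by rw [hA', hB', hC']; push_cast; ring
  have e1 : γ 1 = (5 / 2) * A + (-4) * B + (3 / 2) * C := by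
    rw [hA', hB', hC']; push_cast; ring
  have e2 : γ 2 = (1 / 2) * A + (-1) * B + (1 / 2) * C := by
    rw [hA', hB', hC']; push_cast; ring
  have fin : 10 * M ≤ 10 ^ 7 * (q : ℝ) ^ ((1 : ℝ) / 8) := by
    rw [hM]
    nlinarith [Real.rpow_pos_of_pos hq ((1 : ℝ) / 8)]
  refine le_trans ?_ fin
  fin_cases i
  · show ‖γ 0‖ ≤ _
    rw [e0]; apply comb <;> norm_num
  · show ‖γ 1‖ ≤ _
    rw [e1]; apply comb <;> norm_num
  · show ‖γ 2‖ ≤ _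
    rw [e2]; apply comb <;> norm_num

end Coefficients

/-! ### The residue in terms of the main-term coefficients -/

section Residue

theorem integrableOn_pow_mul_exp (k : ℕ) {η : ℝ} (hη : 0 < η) :
    IntegrableOn (fun t : ℝ => t ^ k * Real.exp (-(η * t))) (Set.Ioi 0) := by
  have := integrableOn_rpow_mul_exp_neg_mul_rpow (s := k) (p := 1) (b := η)
    (by have : (0 : ℝ) ≤ k := k.cast_nonneg
        linarith) one_pos hη
  simpa only [Real.rpow_natCast, Real.rpow_one, neg_mul] using this

theorem integral_pow_mul_exp (k : ℕ) {η : ℝ} (hη : 0 < η) :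
    ∫ t in Set.Ioi (0 : ℝ), t ^ k * Real.exp (-(η * t)) = k.factorial / η ^ (k + 1) := by
  have := Real.integral_rpow_mul_exp_neg_mul_Ioi (a := k + 1) (r := η) (by positivity) hη
  rw [Real.Gamma_nat_eq_factorial] at this
  simp only [add_sub_cancel_right, Real.rpow_natCast] at this
  rw [this]
  rw [show ((k : ℝ) + 1) = ((k + 1 : ℕ) : ℝ) by push_cast; ring, Real.rpow_natCast, one_div, inv_pow]
  field_simp

theorem ramp_mul_exp (c σ t : ℝ) : ramp 2 c t * Real.exp (-(σ * t)) =
    Real.exp (-(σ * c)) * Set.indicator (Set.Ioi 0)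
      (fun t => t ^ 2 * Real.exp (-(σ * t))) (t - c) := by
  rcases lt_or_ge c t with h | h
  · rw [Set.indicator_of_mem (by simpa using h), ramp, max_eq_left (by linarith), mul_left_comm,
      ← Real.exp_add]
    ring_nf
  · rw [Set.indicator_of_notMem (by simpa using h), ramp_of_le two_ne_zero h]; simp

theorem integrable_ramp_mul_exp (c : ℝ) {σ : ℝ} (hσ : 0 < σ) :
    Integrable fun t => ramp 2 c t * Real.exp (-(σ * t)) := by
  simp only [ramp_mul_exp]
  exact (((integrableOn_pow_mul_exp 2 hσ).integrable_indicator
    measurableSet_Ioi).comp_sub_right c).const_mul _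

theorem integral_ramp_mul_exp (c : ℝ) {σ : ℝ} (hσ : 0 < σ) :
    ∫ t, ramp 2 c t * Real.exp (-(σ * t)) = 2 * Real.exp (-(σ * c)) / σ ^ 3 := by
  simp only [ramp_mul_exp]
  rw [integral_const_mul, integral_sub_right_eq_self (fun t => Set.indicator (Set.Ioi 0)
      (fun t => t ^ 2 * Real.exp (-(σ * t))) t), integral_indicator measurableSet_Ioi,
    integral_pow_mul_exp 2 hσ]
  norm_num [Nat.factorial]
  ring

/-- Analytic functions that are `O(η³)` along `1 + η`, `η → 0+`, have vanishing second derivative. -/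
theorem iteratedDeriv_two_eq_zero {f : ℂ → ℂ} (hf : AnalyticAt ℂ f 1) {C : ℝ}
    (h : ∀ᶠ η : ℝ in nhdsWithin 0 (Set.Ioi 0), ‖f (1 + η)‖ ≤ C * η ^ 3) :
    iteratedDeriv 2 f 1 = 0 := by
  refine (natCast_le_analyticOrderAt_iff_iteratedDeriv_eq_zero (n := 3) hf).1 ?_ 2 (by norm_num)
  by_contra hlt
  rw [not_le] at hlt
  obtain ⟨n, hn⟩ : ∃ n : ℕ, analyticOrderAt f 1 = n := by
    refine ⟨(analyticOrderAt f 1).toNat, (ENat.natCast_toNat hlt.ne_top).symm⟩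
  rw [hn] at hlt
  have hn3 : n < 3 := by exact_mod_cast hlt
  obtain ⟨g, hg, hg1, hfg⟩ := (hf.analyticOrderAt_eq_natCast).1 hn
  have hmap : Filter.Tendsto (fun η : ℝ => (1 + η : ℂ)) (nhdsWithin 0 (Set.Ioi 0)) (nhds 1) := by
    have : Filter.Tendsto (fun η : ℝ => (1 + η : ℂ)) (nhds 0) (nhds (1 + (0 : ℝ) : ℂ)) :=
      (by fun_prop : Continuous fun η : ℝ => (1 + η : ℂ)).tendsto 0
    rw [Complex.ofReal_zero, add_zero] at this
    exact this.mono_left nhdsWithin_le_nhds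
  have h1 : Filter.Tendsto (fun η : ℝ => ‖g (1 + η)‖) (nhdsWithin 0 (Set.Ioi 0)) (nhds ‖g 1‖) :=
    (hg.continuousAt.tendsto.comp hmap).norm
  have h2 : Filter.Tendsto (fun η : ℝ => C * η ^ (3 - n)) (nhdsWithin 0 (Set.Ioi 0))
      (nhds 0) := by
    have : Filter.Tendsto (fun η : ℝ => C * η ^ (3 - n)) (nhds 0) (nhds (C * 0 ^ (3 - n))) :=
      (by fun_prop : Continuous fun η : ℝ => C * η ^ (3 - n)).tendsto 0
    rw [zero_pow (by omega), mul_zero] at this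
    exact this.mono_left nhdsWithin_le_nhds
  have h3 : ‖g 1‖ ≤ 0 := by
    refine le_of_tendsto_of_tendsto h1 h2 ?_
    filter_upwards [h, hmap.eventually hfg, self_mem_nhdsWithin] with η hη hη2 hη0
    have hη0 : 0 < η := hη0
    rw [hη2, norm_smul, norm_pow, add_sub_cancel_left, Complex.norm_real, Real.norm_eq_abs,
      abs_of_pos hη0, show η ^ 3 = η ^ n * η ^ (3 - n) by rw [← pow_add]; congr 1; omega] at hη
    have : 0 < η ^ n := by positivity
    refine le_of_mul_le_mul_left ?_ this
    linarith
  exact hg1 (norm_le_zero_iff.1 h3)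

theorem iteratedDeriv_two_model (γ : Fin 3 → ℂ) (x l : ℂ) (hl : Complex.exp l = x) :
    iteratedDeriv 2 (fun s => s ^ 2 * Complex.exp (l * s) *
      (γ 0 * (s - 1) ^ 2 + γ 1 * (s - 1) + 2 * γ 2)) 1 =
      2 * (x * (γ 0 + γ 1 * (2 + l) + γ 2 * (2 + 4 * l + l ^ 2))) := by
  have hE : ∀ s : ℂ, HasDerivAt (fun s => Complex.exp (l * s)) (Complex.exp (l * s) * l) s :=
    fun s => by simpa using ((hasDerivAt_id s).const_mul l).cexp
  have hX : ∀ s : ℂ, HasDerivAt (fun s : ℂ => s - 1) 1 s := fun s => (hasDerivAt_id s).sub_const 1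
  have hp : ∀ s : ℂ, HasDerivAt (fun s : ℂ => s ^ 2) (2 * s) s := fun s => by
    simpa using hasDerivAt_pow 2 s
  have hu : ∀ s : ℂ, HasDerivAt (fun s : ℂ => γ 0 * (s - 1) ^ 2 + γ 1 * (s - 1) + 2 * γ 2)
      (γ 0 * (2 * (s - 1)) + γ 1) s := fun s => by
    have := ((((hX s).fun_pow 2).const_mul (γ 0)).add ((hX s).const_mul (γ 1))).add_const (2 * γ 2)
    simpa using this
  have hu' : ∀ s : ℂ, HasDerivAt (fun s : ℂ => γ 0 * (2 * (s - 1)) + γ 1)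
      (γ 0 * 2) s := fun s => by
    simpa using (((hX s).const_mul 2).const_mul (γ 0)).add_const (γ 1)
  have hd : deriv (fun s => s ^ 2 * Complex.exp (l * s) *
      (γ 0 * (s - 1) ^ 2 + γ 1 * (s - 1) + 2 * γ 2)) = fun s =>
      (2 * s * Complex.exp (l * s) + s ^ 2 * (Complex.exp (l * s) * l)) *
      (γ 0 * (s - 1) ^ 2 + γ 1 * (s - 1) + 2 * γ 2) + s ^ 2 * Complex.exp (l * s) *
      (γ 0 * (2 * (s - 1)) + γ 1) := by
    ext s
    exact (((hp s).mul (hE s)).mul (hu s)).deriv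
  rw [iteratedDeriv_succ, iteratedDeriv_one, hd]
  have h2 : HasDerivAt (fun s : ℂ => 2 * s) 2 1 := by
    simpa using (hasDerivAt_id (1 : ℂ)).const_mul 2
  have := (((h2.mul (hE 1)).add ((hp 1).mul ((hE 1).mul_const l))).mul (hu 1)).add
    (((hp 1).mul (hE 1)).mul (hu' 1))
  refine this.deriv.trans ?_
  simp [hl]
  ring

variable {q : ℕ} [NeZero q]

theorem d3_zero : d3 0 = 0 := by simp [d3]

/-- Half the Laplace kernel of the `n`-th term. -/
noncomputable def laplaceTerm (a : ZMod q) (σ : ℝ) (n : ℕ) (t : ℝ) : ℂ :=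
  (d3 n : ℂ) * χ (a * (n : ZMod q)) * ((ramp 2 (Real.log n) t * Real.exp (-(σ * t)) : ℝ) / 2)

theorem integrable_laplaceTerm (a : ZMod q) {σ : ℝ} (hσ : 0 < σ) (n : ℕ) :
    Integrable (laplaceTerm a σ n) := by
  unfold laplaceTerm
  exact ((integrable_ramp_mul_exp _ hσ).ofReal.div_const 2).const_mul _

theorem exp_neg_mul_log (σ : ℝ) {n : ℕ} (hn : n ≠ 0) :
    (Real.exp (-(σ * Real.log n)) : ℂ) = ((n : ℂ) ^ (σ : ℂ))⁻¹ := by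
  have : (0 : ℝ) < n := by positivity
  rw [Real.exp_neg, mul_comm, ← Real.rpow_def_of_pos this]
  push_cast
  rw [Complex.ofReal_cpow this.le]
  simp

theorem integral_laplaceTerm (a : ZMod q) {σ : ℝ} (hσ : 0 < σ) (n : ℕ) :
    ∫ t, laplaceTerm a σ n t =
      (d3 n : ℂ) * χ (a * (n : ZMod q)) / (n : ℂ) ^ (σ : ℂ) / (σ : ℂ) ^ 3 := by
  rcases eq_or_ne n 0 with rfl | hn
  · simp [laplaceTerm, d3_zero]
  unfold laplaceTerm
  rw [integral_const_mul, integral_div, integral_complex_ofReal, integral_ramp_mul_exp _ hσ]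
  rw [Complex.ofReal_div, Complex.ofReal_mul, exp_neg_mul_log σ hn]
  push_cast
  field_simp

theorem integral_norm_laplaceTerm (a : ZMod q) {σ : ℝ} (hσ : 0 < σ) (n : ℕ) :
    ∫ t, ‖laplaceTerm a σ n t‖ =
      ‖(d3 n : ℂ) * χ (a * (n : ZMod q)) / (n : ℂ) ^ (σ : ℂ)‖ / σ ^ 3 := by
  rcases eq_or_ne n 0 with rfl | hn
  · simp [laplaceTerm, d3_zero]
  have h : ∀ t, ‖laplaceTerm a σ n t‖ =
      ‖(d3 n : ℂ) * χ (a * (n : ZMod q))‖ * (ramp 2 (Real.log n) t * Real.exp (-(σ * t)) / 2) := by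
    intro t
    have h0 : 0 ≤ ramp 2 (Real.log n) t * Real.exp (-(σ * t)) := by unfold ramp; positivity
    rw [laplaceTerm, norm_mul, norm_div, Complex.norm_real, Real.norm_eq_abs, abs_of_nonneg h0]
    simp
  simp only [h]
  rw [integral_const_mul, integral_div, integral_ramp_mul_exp _ hσ, norm_div,
    div_eq_mul_inv _ ‖(n : ℂ) ^ (σ : ℂ)‖, ← norm_inv, ← exp_neg_mul_log σ hn,
    Complex.norm_real, Real.norm_eq_abs, abs_of_pos (Real.exp_pos _)]
  field_simp

theorem MainCoeff.tsum_laplaceTerm {a : ZMod q} {γ : Fin 3 → ℂ} (h : MainCoeff a γ) (σ t : ℝ) :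
    ∑' n, laplaceTerm a σ n t = Set.indicator (Set.Ioi 0) (fun t : ℝ =>
      (tri disc a t + Real.exp t * (γ 0 + γ 1 * t + γ 2 * t ^ 2)) * Real.exp (-(σ * t))) t := by
  rcases lt_or_ge 0 t with ht | ht
  · rw [Set.indicator_of_mem (by simpa using ht)]
    have hN : Real.exp t < (⌊Real.exp t⌋₊ : ℝ) + 1 := Nat.lt_floor_add_one _
    rw [h.eq t _ hN, sub_add_cancel, tsum_eq_sum (s := Finset.Icc 1 ⌊Real.exp t⌋₊),
      Finset.sum_mul]
    · refine Finset.sum_congr rfl (fun n _ => ?_)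
      rw [laplaceTerm]; push_cast; ring
    · intro n hn
      rcases eq_or_ne n 0 with rfl | hn0
      · simp [laplaceTerm, d3_zero]
      have h1 : ⌊Real.exp t⌋₊ < n := by
        simp only [Finset.mem_Icc, not_and, not_le] at hn
        exact hn (by omega)
      rw [laplaceTerm, ramp_of_le two_ne_zero]
      · simp
      · rw [← Real.log_exp t]
        exact Real.log_le_log (Real.exp_pos t) ((Nat.floor_lt (Real.exp_pos t).le).1 h1).le
  · rw [Set.indicator_of_notMem (by simpa using ht)]
    refine (tsum_congr fun n => ?_).trans tsum_zero
    rw [laplaceTerm, ramp_of_le two_ne_zero (ht.trans (Real.log_natCast_nonneg n))]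
    simp

theorem norm_tri_disc_mul_exp_le (a : ZMod q) {σ : ℝ} (hσ : 1 ≤ σ) {t : ℝ} (ht : 0 < t) :
    ‖tri disc a t * Real.exp (-(σ * t))‖ ≤
      128 * (q : ℝ) ^ ((3 : ℝ) / 2) * Real.exp (-(1 / 2) * t) := by
  have h := norm_tri_disc_le (q := q) (δ := 1 / 2) (by norm_num) le_rfl a t
  rw [norm_mul, Complex.norm_real, Real.norm_eq_abs, abs_of_pos (Real.exp_pos _)]
  calc _ ≤ (32 / (1 / 2) ^ 2 * (q : ℝ) ^ (3 * (1 / 2) : ℝ) * Real.exp ((1 - 1 / 2) * t)) *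
        Real.exp (-(σ * t)) := by gcongr
    _ = 128 * (q : ℝ) ^ ((3 : ℝ) / 2) * Real.exp ((1 - 1 / 2) * t + -(σ * t)) := by
      rw [Real.exp_add]; norm_num; ring
    _ ≤ _ := by
      gcongr
      nlinarith

theorem integrableOn_tri_disc_mul_exp (a : ZMod q) {σ : ℝ} (hσ : 1 ≤ σ) :
    IntegrableOn (fun t => tri disc a t * Real.exp (-(σ * t))) (Set.Ioi 0) := by
  refine Integrable.mono' ((integrableOn_exp_mul_Ioi (a := -(1 / 2)) (by norm_num) 0).const_mul
    (128 * (q : ℝ) ^ ((3 : ℝ) / 2))) ?_ ?_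
  · refine ((measurable_tri measurable_disc a).mul ?_).aestronglyMeasurable
    fun_prop
  · exact (ae_restrict_iff' measurableSet_Ioi).2 (Filter.Eventually.of_forall fun t ht =>
      norm_tri_disc_mul_exp_le a hσ ht)

theorem norm_integral_tri_disc_mul_exp_le (a : ZMod q) {σ : ℝ} (hσ : 1 ≤ σ) :
    ‖∫ t in Set.Ioi (0 : ℝ), tri disc a t * Real.exp (-(σ * t))‖ ≤
      256 * (q : ℝ) ^ ((3 : ℝ) / 2) := by
  have h := norm_integral_le_of_norm_le ((integrableOn_exp_mul_Ioi (a := -(1 / 2)) (by norm_num)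
    0).const_mul (128 * (q : ℝ) ^ ((3 : ℝ) / 2))) ((ae_restrict_iff' measurableSet_Ioi).2
      (Filter.Eventually.of_forall fun t ht => norm_tri_disc_mul_exp_le a hσ ht))
  refine h.trans (le_of_eq ?_)
  rw [integral_const_mul, integral_exp_mul_Ioi (by norm_num)]
  norm_num
  ring

theorem MainCoeff.laplace_eq {a : ZMod q} {γ : Fin 3 → ℂ} (h : MainCoeff a γ) {η : ℝ}
    (hη : 0 < η) {z : ℂ} (hz : HasSum (fun n : ℕ => (d3 n : ℂ) * χ (a * (n : ZMod q)) /
      (n : ℂ) ^ ((1 + η : ℝ) : ℂ)) z) :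
    z / ((1 + η : ℝ) : ℂ) ^ 3 = γ 0 / η + γ 1 / η ^ 2 + 2 * γ 2 / η ^ 3 +
      ∫ t in Set.Ioi (0 : ℝ), tri disc a t * Real.exp (-((1 + η) * t)) := by
  have hσ : 0 < 1 + η := by linarith
  have h1 := hasSum_integral_of_summable_integral_norm (μ := volume)
    (F := laplaceTerm a (1 + η)) (integrable_laplaceTerm a hσ) (by
      simp only [integral_norm_laplaceTerm a hσ]
      exact (summable_norm_iff.2 hz.summable).div_const _)
  simp only [integral_laplaceTerm a hσ, h.tsum_laplaceTerm] at h1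
  rw [(hz.div_const _).unique h1, integral_indicator measurableSet_Ioi]
  have hk : ∀ k : ℕ, Integrable (fun t : ℝ => ((t ^ k * Real.exp (-(η * t)) : ℝ) : ℂ))
      (volume.restrict (Set.Ioi 0)) := fun k => (integrableOn_pow_mul_exp k hη).ofReal
  have hi : ∀ k : ℕ, ∫ t in Set.Ioi (0 : ℝ), ((t ^ k * Real.exp (-(η * t)) : ℝ) : ℂ) =
      k.factorial / (η : ℂ) ^ (k + 1) := fun k => by
    rw [integral_complex_ofReal, integral_pow_mul_exp k hη]; push_cast; rfl
  have hsplit : ∀ t : ℝ, (tri disc a t + Real.exp t * (γ 0 + γ 1 * t + γ 2 * t ^ 2)) *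
      Real.exp (-((1 + η) * t)) = tri disc a t * Real.exp (-((1 + η) * t)) +
      (γ 0 * ((t ^ 0 * Real.exp (-(η * t)) : ℝ) : ℂ) +
       γ 1 * ((t ^ 1 * Real.exp (-(η * t)) : ℝ) : ℂ) +
       γ 2 * ((t ^ 2 * Real.exp (-(η * t)) : ℝ) : ℂ)) := by
    intro t
    have he : (Real.exp t : ℂ) * Real.exp (-((1 + η) * t)) = Real.exp (-(η * t)) := by
      rw [← Complex.ofReal_mul, ← Real.exp_add]; ring_nf
    push_cast at he ⊢
    linear_combination (γ 0 + γ 1 * t + γ 2 * t ^ 2) * he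
  simp only [hsplit]
  have i0 := (hk 0).const_mul (γ 0)
  have i1 := (hk 1).const_mul (γ 1)
  have i2 := (hk 2).const_mul (γ 2)
  have i01 : Integrable (fun t : ℝ => γ 0 * ((t ^ 0 * Real.exp (-(η * t)) : ℝ) : ℂ) +
       γ 1 * ((t ^ 1 * Real.exp (-(η * t)) : ℝ) : ℂ)) (volume.restrict (Set.Ioi 0)) := i0.add i1
  have i012 : Integrable (fun t : ℝ => γ 0 * ((t ^ 0 * Real.exp (-(η * t)) : ℝ) : ℂ) +
       γ 1 * ((t ^ 1 * Real.exp (-(η * t)) : ℝ) : ℂ) +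
       γ 2 * ((t ^ 2 * Real.exp (-(η * t)) : ℝ) : ℂ)) (volume.restrict (Set.Ioi 0)) := i01.add i2
  have iK := integrableOn_tri_disc_mul_exp a (show 1 ≤ 1 + η by linarith)
  rw [integral_add iK i012, integral_add i01 i2, integral_add i0 i1, integral_const_mul,
    integral_const_mul, integral_const_mul, hi, hi, hi]
  simp [Nat.factorial]
  ring

/-- The residue is determined by the main-term coefficients. -/
theorem MainCoeff.residue_eq {a : ZMod q} {γ : Fin 3 → ℂ} (h : MainCoeff a γ) {x : ℝ}
    (hx : 0 < x) {E g : ℂ → ℂ} (hE : ∀ s : ℂ, 1 < s.re → HasSum (fun n : ℕ =>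
      (d3 n : ℂ) * χ (a * (n : ZMod q)) / (n : ℂ) ^ s) (E s)) (hg : AnalyticAt ℂ g 1)
    (hgE : ∀ᶠ s in nhdsWithin (1 : ℂ) {(1 : ℂ)}ᶜ, g s = (s - 1) ^ 3 * E s * (x : ℂ) ^ s / s) :
    iteratedDeriv 2 g 1 / 2 = x * (γ 0 + γ 1 * (2 + Real.log x) +
      γ 2 * (2 + 4 * Real.log x + Real.log x ^ 2)) := by
  set P : ℂ → ℂ := fun s => s ^ 2 * Complex.exp ((Real.log x : ℂ) * s) *
      (γ 0 * (s - 1) ^ 2 + γ 1 * (s - 1) + 2 * γ 2) with hP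
  have hexp : Complex.exp (Real.log x : ℂ) = x := by
    rw [← Complex.ofReal_exp, Real.exp_log hx]
  have hPd := iteratedDeriv_two_model γ x (Real.log x) hexp
  have hPan : AnalyticAt ℂ P 1 := by rw [hP]; fun_prop
  have hzero : iteratedDeriv 2 (g - P) 1 = 0 := by
    refine iteratedDeriv_two_eq_zero (hg.sub hPan)
      (C := (2 ^ 2 * (x * max 1 x)) * (256 * (q : ℝ) ^ ((3 : ℝ) / 2))) ?_
    have hmap : Filter.Tendsto (fun η : ℝ => (1 + η : ℂ)) (nhdsWithin 0 (Set.Ioi 0))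
        (nhdsWithin 1 {(1 : ℂ)}ᶜ) := by
      refine tendsto_nhdsWithin_iff.2 ⟨?_, ?_⟩
      · have : Filter.Tendsto (fun η : ℝ => (1 + η : ℂ)) (nhds 0) (nhds (1 + (0 : ℝ) : ℂ)) :=
          (by fun_prop : Continuous fun η : ℝ => (1 + η : ℂ)).tendsto 0
        rw [Complex.ofReal_zero, add_zero] at this
        exact this.mono_left nhdsWithin_le_nhds
      · filter_upwards [self_mem_nhdsWithin] with η hη
        have hη : 0 < η := hη
        simpa using hη.ne'
    have h1 : ∀ᶠ η : ℝ in nhdsWithin 0 (Set.Ioi 0), η < 1 :=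
      (eventually_lt_nhds one_pos).filter_mono nhdsWithin_le_nhds
    filter_upwards [hmap.eventually hgE, self_mem_nhdsWithin, h1] with η hη hη0 hη1
    have hη0 : 0 < η := hη0
    have hηc : (η : ℂ) ≠ 0 := by exact_mod_cast hη0.ne'
    have hσ : (1 + η : ℂ) ≠ 0 := by
      have : (1 + η : ℝ) ≠ 0 := by positivity
      exact_mod_cast this
    have hz := hE ((1 + η : ℝ) : ℂ) (by simpa using hη0)
    have hl := h.laplace_eq hη0 hz
    set κ := ∫ t in Set.Ioi (0 : ℝ), tri disc a t * Real.exp (-((1 + η) * t)) with hκ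
    have hκb : ‖κ‖ ≤ 256 * (q : ℝ) ^ ((3 : ℝ) / 2) :=
      norm_integral_tri_disc_mul_exp_le a (by linarith)
    have hxp : (x : ℂ) ^ (1 + η : ℂ) = Complex.exp ((Real.log x : ℂ) * (1 + η)) := by
      rw [Complex.cpow_def_of_ne_zero (by exact_mod_cast hx.ne'), Complex.ofReal_log hx.le]
    have hdiff : (g - P) (1 + η) = (1 + η) ^ 2 * Complex.exp ((Real.log x : ℂ) * (1 + η)) *
        (η ^ 3 * κ) := by
      rw [Pi.sub_apply, hη, hP, hxp]
      push_cast at hl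
      rw [div_eq_iff (pow_ne_zero 3 hσ)] at hl
      rw [hl]
      field_simp
      ring
    rw [hdiff, norm_mul, norm_mul, norm_mul, norm_pow, norm_pow, Complex.norm_exp]
    have n1 : ‖(1 + η : ℂ)‖ ≤ 2 := by
      refine (norm_add_le _ _).trans ?_
      rw [Complex.norm_real, Real.norm_eq_abs, abs_of_pos hη0, norm_one]; linarith
    have n2 : Real.exp ((Real.log x : ℂ) * (1 + η)).re ≤ x * max 1 x := by
      have : ((Real.log x : ℂ) * (1 + η)).re = Real.log x * (1 + η) := by
        rw [← Complex.ofReal_one, ← Complex.ofReal_add, ← Complex.ofReal_mul, Complex.ofReal_re]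
      rw [this, mul_add, Real.exp_add, mul_one, Real.exp_log hx]
      refine mul_le_mul_of_nonneg_left ?_ hx.le
      rcases le_total (Real.log x) 0 with hl0 | hl0
      · refine le_max_of_le_left (Real.exp_le_one_iff.2 ?_)
        nlinarith
      · refine le_max_of_le_right ?_
        calc _ ≤ Real.exp (Real.log x) := Real.exp_le_exp.2 (by nlinarith)
          _ = x := Real.exp_log hx
    rw [Complex.norm_real, Real.norm_eq_abs, abs_of_pos hη0]
    calc _ ≤ 2 ^ 2 * (x * max 1 x) * (η ^ 3 * (256 * (q : ℝ) ^ ((3 : ℝ) / 2))) := by gcongr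
      _ = _ := by ring
  rw [iteratedDeriv_sub hg.contDiffAt hPan.contDiffAt, sub_eq_zero] at hzero
  rw [hzero, hPd]
  ring

end Residue

/-! ### The operator bound for short intervals -/

section Operator

variable {q : ℕ} [NeZero q]

/-- The Euclidean norm on functions on `ZMod q`. -/
noncomputable def l2 (G : ZMod q → ℂ) : ℝ := ‖WithLp.toLp 2 G‖

theorem l2_nonneg (G : ZMod q → ℂ) : 0 ≤ l2 G := norm_nonneg _

theorem l2_sq (G : ZMod q → ℂ) : l2 G ^ 2 = ∑ a, ‖G a‖ ^ 2 := EuclideanSpace.norm_sq_eq _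

theorem l2_add_le (F G : ZMod q → ℂ) : l2 (fun a => F a + G a) ≤ l2 F + l2 G :=
  norm_add_le (WithLp.toLp 2 F) (WithLp.toLp 2 G)

theorem l2_sub_le (F G : ZMod q → ℂ) : l2 (fun a => F a - G a) ≤ l2 F + l2 G :=
  norm_sub_le (WithLp.toLp 2 F) (WithLp.toLp 2 G)

theorem l2_const_mul (c : ℂ) (G : ZMod q → ℂ) : l2 (fun a => c * G a) = ‖c‖ * l2 G :=
  norm_smul c (WithLp.toLp 2 G)

theorem l2_sum_le {ι : Type*} (s : Finset ι) (F : ι → ZMod q → ℂ) :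
    l2 (fun a => ∑ i ∈ s, F i a) ≤ ∑ i ∈ s, l2 (F i) := by
  classical
  induction s using Finset.induction_on with
  | empty => simp [l2, show (fun _ : ZMod q => (0 : ℂ)) = 0 from rfl]
  | insert i s hi ih =>
    simp only [Finset.sum_insert hi]
    exact (l2_add_le _ _).trans (by gcongr)

theorem l2_le_of_sq_le {F : ZMod q → ℂ} {B : ℝ} (hB : 0 ≤ B) (h : ∑ a, ‖F a‖ ^ 2 ≤ B ^ 2) :
    l2 F ≤ B := by
  rw [← l2_sq] at h
  exact (sq_le_sq₀ (l2_nonneg _) hB).1 h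

theorem l2_comp_mul_le (r : ZMod q) (G : ZMod q → ℂ) :
    l2 (fun a => G (a * r)) ≤ Real.sqrt (r.val.gcd q) * l2 G := by
  refine l2_le_of_sq_le (by have := l2_nonneg G; positivity) ?_
  rw [mul_pow, Real.sq_sqrt (by positivity), l2_sq]
  exact sum_norm_sq_comp_mul_le r G

theorem l2_twist_le (k : ZMod q) (G : ZMod q → ℂ) :
    l2 (fun a => ∑ r, χ (-(k * r)) * G (a * r)) ≤ Real.sqrt q * (k.val.gcd q) * l2 G := by
  refine l2_le_of_sq_le (by have := l2_nonneg G; positivity) ?_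
  rw [mul_pow, mul_pow, Real.sq_sqrt (by positivity), l2_sq]
  exact sum_norm_sq_twist_le k G

theorem gcd_val_natCast (n : ℕ) : (n : ZMod q).val.gcd q = n.gcd q := by
  rw [ZMod.val_natCast, ← Nat.gcd_rec, Nat.gcd_comm]

theorem sum_sqrt_gcd_le : ∑ r : ZMod q, Real.sqrt (r.val.gcd q) ≤ q * q.divisors.card := by
  have hq : q ≠ 0 := NeZero.ne q
  have h1 : ∑ r : ZMod q, Real.sqrt (r.val.gcd q) = ∑ n ∈ Finset.Icc 1 q, Real.sqrt (n.gcd q) := by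
    have := sum_cnt_mul (q := q) q (fun r => Real.sqrt (r.val.gcd q))
    simp only [gcd_val_natCast] at this
    rw [← this]
    refine Finset.sum_congr rfl (fun r _ => ?_)
    have hc : cnt r q = 1 := by
      have := cnt_floor_eq r (u := q) (by positivity)
      rw [Nat.floor_natCast, show ((q : ℝ) - r.val) / q = -(r.val : ℝ) / q + 1 by
        rw [sub_div, div_self (by exact_mod_cast hq)]; ring, Int.floor_add_one] at this
      omega
    rw [hc, one_smul]
  rw [h1]
  calc _ ≤ ∑ n ∈ Finset.Icc 1 q, ∑ g ∈ q.divisors, (if g ∣ n then (g : ℝ) else 0) := by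
        refine Finset.sum_le_sum (fun n _ => le_trans ?_ (gcd_le_sum n q hq))
        rw [Real.sqrt_le_left (by positivity)]
        have : (1 : ℝ) ≤ n.gcd q := by
          exact_mod_cast Nat.gcd_pos_of_pos_right _ (Nat.pos_of_ne_zero hq)
        nlinarith
    _ = ∑ g ∈ q.divisors, ∑ n ∈ Finset.Icc 1 q, (if g ∣ n then (g : ℝ) else 0) := Finset.sum_comm
    _ ≤ ∑ g ∈ q.divisors, (q : ℝ) := by
        refine Finset.sum_le_sum (fun g hg => ?_)
        rw [← Finset.sum_filter, Finset.sum_const, nsmul_eq_mul]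
        have hc : ((Finset.Icc 1 q).filter fun n => g ∣ n).card = q / g := by
          have := Nat.Ioc_filter_dvd_card_eq_div q g
          rwa [show Finset.Ioc 0 q = Finset.Icc 1 q from rfl] at this
        rw [hc, ← Nat.cast_mul, Nat.div_mul_cancel (Nat.dvd_of_mem_divisors hg)]
    _ = _ := by simp [mul_comm]

/-- The operator attached to the short-interval discrepancy. -/
noncomputable def stepOp (h z : ℝ) (G : ZMod q → ℂ) (a : ZMod q) : ℂ :=
  ∑ r, (step h r z : ℂ) * G (a * r)

theorem sum_Icc_sub_sum_Icc {M : Type*} [AddCommGroup M] {m n : ℕ} (hmn : m ≤ n) (f : ℕ → M) :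
    ∑ k ∈ Finset.Icc 1 n, f k - ∑ k ∈ Finset.Icc 1 m, f k = ∑ k ∈ Finset.Ioc m n, f k := by
  have h : ∀ N, Finset.Icc 1 N = Finset.Ioc 0 N := fun N => rfl
  rw [h, h, sub_eq_iff_eq_add', Finset.sum_Ioc_consecutive _ (Nat.zero_le m) hmn]

theorem sum_step_mul {h z : ℝ} (hh : 0 ≤ h) (f : ZMod q → ℂ) :
    ∑ r, (step h r z : ℂ) * f r =
      ∑ n ∈ Finset.Ioc ⌊Real.exp z⌋₊ ⌊Real.exp (z + h)⌋₊, f (n : ZMod q) -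
        (((Real.exp (z + h) - Real.exp z) / q : ℝ) : ℂ) * ∑ r, f r := by
  have hle : ⌊Real.exp z⌋₊ ≤ ⌊Real.exp (z + h)⌋₊ :=
    Nat.floor_mono (Real.exp_le_exp.2 (by linarith))
  rw [← sum_Icc_sub_sum_Icc hle, ← sum_cnt_mul, ← sum_cnt_mul, Finset.mul_sum,
    ← Finset.sum_sub_distrib, ← Finset.sum_sub_distrib]
  refine Finset.sum_congr rfl (fun r _ => ?_)
  rw [step, disc, disc]
  push_cast
  simp only [nsmul_eq_mul]
  ring

theorem l2_stepOp_le_sum {h z : ℝ} (hh : 0 ≤ h) (G : ZMod q → ℂ) :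
    l2 (stepOp h z G) ≤ (∑ n ∈ Finset.Ioc ⌊Real.exp z⌋₊ ⌊Real.exp (z + h)⌋₊, Real.sqrt (n.gcd q) +
      (Real.exp (z + h) - Real.exp z) * q.divisors.card) * l2 G := by
  have hq : (0 : ℝ) < q := q_pos
  have hd : 0 ≤ Real.exp (z + h) - Real.exp z :=
    sub_nonneg.2 (Real.exp_le_exp.2 (by linarith))
  have h0 : stepOp h z G = fun a =>
      ∑ n ∈ Finset.Ioc ⌊Real.exp z⌋₊ ⌊Real.exp (z + h)⌋₊, G (a * (n : ZMod q)) -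
        (((Real.exp (z + h) - Real.exp z) / q : ℝ) : ℂ) * ∑ r, G (a * r) := by
    ext a
    exact sum_step_mul hh (fun r => G (a * r))
  rw [h0, add_mul]
  refine (l2_sub_le _ _).trans (add_le_add ?_ ?_)
  · refine (l2_sum_le _ (fun (n : ℕ) a => G (a * (n : ZMod q)))).trans ?_
    rw [Finset.sum_mul]
    refine Finset.sum_le_sum (fun n _ => ?_)
    rw [← gcd_val_natCast]
    exact l2_comp_mul_le _ _
  · rw [l2_const_mul, Complex.norm_real, Real.norm_eq_abs, abs_of_nonneg (by positivity)]
    calc _ ≤ (Real.exp (z + h) - Real.exp z) / q *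
          ∑ r : ZMod q, Real.sqrt (r.val.gcd q) * l2 G := by
          gcongr
          exact (l2_sum_le _ (fun (r : ZMod q) a => G (a * r))).trans
            (Finset.sum_le_sum fun r _ => l2_comp_mul_le _ _)
      _ ≤ (Real.exp (z + h) - Real.exp z) / q * (q * q.divisors.card * l2 G) := by
          rw [← Finset.sum_mul]
          have := l2_nonneg G
          gcongr
          exact sum_sqrt_gcd_le
      _ = _ := by field_simp

theorem inv_norm_one_sub_χ_le {c : ZMod q} (hc : c ≠ 0) :
    ‖1 - χ c‖⁻¹ ≤ q / 4 * (1 / (c.val : ℝ) + 1 / ((q : ℝ) - c.val)) := by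
  have hq : (0 : ℝ) < q := q_pos
  set k := c.val with hk
  have hk0 : (0 : ℝ) < k := by
    exact_mod_cast Nat.pos_of_ne_zero (fun h => hc ((ZMod.val_eq_zero c).1 h))
  have hkq : (k : ℝ) < q := by exact_mod_cast ZMod.val_lt c
  have hχ : χ c = Complex.exp (Complex.I * ((2 * Real.pi * (k / q) : ℝ) : ℂ)) := by
    conv_lhs => rw [← ZMod.natCast_zmod_val c]
    rw [χ_natCast, e]
    congr 1
    push_cast
    ring
  have hn : ‖1 - χ c‖ = 2 * |Real.sin (Real.pi * (k / q))| := by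
    rw [norm_sub_rev, hχ, Complex.norm_exp_I_mul_ofReal_sub_one, norm_mul, Real.norm_eq_abs,
      Real.norm_eq_abs, abs_of_pos (by norm_num : (0 : ℝ) < 2)]
    congr 3
    ring
  have hπ := Real.pi_pos
  have hmin : ∀ y : ℝ, 0 < y → y ≤ q / 2 → 2 * (y / q) ≤ Real.sin (Real.pi * (y / q)) := by
    intro y hy hy2
    have h1 : Real.pi * (y / q) ≤ Real.pi / 2 := by
      rw [show Real.pi / 2 = Real.pi * (1 / 2) by ring]
      exact mul_le_mul_of_nonneg_left (by rw [div_le_iff₀ hq]; linarith) hπ.le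
    have := Real.mul_le_sin (x := Real.pi * (y / q)) (by positivity) h1
    refine le_trans (le_of_eq ?_) this
    field_simp
  have key : ∀ y : ℝ, 0 < y → y ≤ q / 2 →
      |Real.sin (Real.pi * (k / q))| = |Real.sin (Real.pi * (y / q))| →
      ‖1 - χ c‖⁻¹ ≤ q / 4 * (1 / y) := by
    intro y hy hy2 h
    rw [hn, h]
    have h1 := (hmin y hy hy2).trans (le_abs_self _)
    have h2 : q / 4 * (1 / y) = (2 * (2 * (y / q)))⁻¹ := by field_simp; norm_num
    rw [h2]
    gcongr
  have p1 : 0 < 1 / (k : ℝ) := by positivity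
  have p2 : 0 < 1 / ((q : ℝ) - k) := by
    have : (0 : ℝ) < q - k := by linarith
    positivity
  rcases le_total (k : ℝ) (q / 2) with h | h
  · refine (key k hk0 h rfl).trans ?_
    gcongr
    linarith
  · refine (key (q - k) (by linarith) (by linarith) ?_).trans ?_
    · have : Real.pi * ((q - k) / q) = Real.pi - Real.pi * (k / q) := by field_simp
      rw [this, Real.sin_pi_sub]
    · gcongr
      linarith

theorem norm_sum_χ_Ioc_le {c : ZMod q} (hc : c ≠ 0) (m n : ℕ) (hmn : m ≤ n) :
    ‖∑ k ∈ Finset.Ioc m n, χ ((k : ZMod q) * c)‖ ≤ 2 * ‖1 - χ c‖⁻¹ := by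
  have hχ1 : χ c ≠ 1 := fun h => hc (ZMod.injective_stdAddChar (by simpa using h))
  have h1 : ∀ k : ℕ, χ ((k : ZMod q) * c) = χ c ^ k := fun k => by
    rw [← nsmul_eq_mul, χ, AddChar.map_nsmul_eq_pow]
  have h2 : ∑ k ∈ Finset.Ioc m n, χ ((k : ZMod q) * c) =
      (χ c ^ (n + 1) - χ c ^ (m + 1)) / (χ c - 1) := by
    simp only [h1]
    have := geom_sum_Ico hχ1 (Nat.succ_le_succ hmn)
    rw [← this]
    refine Finset.sum_congr ?_ (fun _ _ => rfl)
    ext k; simp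
  rw [h2, norm_div, norm_sub_rev (χ c) 1, div_eq_mul_inv]
  gcongr
  refine (norm_sub_le _ _).trans (le_of_eq ?_)
  rw [norm_pow, norm_pow, norm_χ]; norm_num

end Operator

section OperatorLong

variable {q : ℕ} [NeZero q]

theorem stepOp_eq_sum_fcoef (h z : ℝ) (G : ZMod q → ℂ) (a : ZMod q) :
    stepOp h z G a = ∑ c, fcoef (fun r => (step h r z : ℂ)) c *
      ∑ r, χ (-(-c * r)) * G (a * r) := by
  simp only [stepOp, Finset.mul_sum]
  rw [Finset.sum_comm]
  refine Finset.sum_congr rfl (fun r _ => ?_)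
  rw [fcoef_inversion (fun r => (step h r z : ℂ)) r, Finset.sum_mul]
  refine Finset.sum_congr rfl (fun c _ => ?_)
  rw [neg_mul, neg_neg, mul_assoc]

theorem norm_fcoef_step_zero_le (h z : ℝ) :
    ‖fcoef (fun r : ZMod q => (step h r z : ℂ)) 0‖ ≤ 2 / q := by
  have h1 : ∀ s, |∑ r : ZMod q, disc r s| ≤ 1 := fun s => by
    simpa using abs_sum_disc_annihilator_le_one (0 : ZMod q) s
  have h2 : ∑ r : ZMod q, step h r z = ∑ r : ZMod q, disc r (z + h) - ∑ r : ZMod q, disc r z := by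
    simp only [step, Finset.sum_sub_distrib]
  have h3 : |∑ r : ZMod q, step h r z| ≤ 2 := by
    rw [h2]
    have := abs_sub (∑ r : ZMod q, disc r (z + h)) (∑ r : ZMod q, disc r z)
    linarith [h1 (z + h), h1 z]
  have h4 : fcoef (fun r : ZMod q => (step h r z : ℂ)) 0 =
      (((q : ℝ)⁻¹ * ∑ r : ZMod q, step h r z : ℝ) : ℂ) := by
    rw [fcoef]
    simp [χ]
  rw [h4, Complex.norm_real, Real.norm_eq_abs, abs_mul, abs_of_nonneg (by positivity),
    div_eq_inv_mul]
  gcongr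

theorem norm_fcoef_step_le {h z : ℝ} (hh : 0 ≤ h) {c : ZMod q} (hc : c ≠ 0) :
    ‖fcoef (fun r : ZMod q => (step h r z : ℂ)) c‖ ≤
      1 / 2 * (1 / ((-c).val : ℝ) + 1 / ((q : ℝ) - (-c).val)) := by
  have hq : (0 : ℝ) < q := q_pos
  have hc' : -c ≠ 0 := neg_ne_zero.2 hc
  have hle : ⌊Real.exp z⌋₊ ≤ ⌊Real.exp (z + h)⌋₊ :=
    Nat.floor_mono (Real.exp_le_exp.2 (by linarith))
  have h1 : ∑ r, χ (-(r * c)) = 0 := by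
    have := sum_χ_mul (-c)
    rw [if_neg hc'] at this
    simpa [mul_neg] using this
  rw [fcoef, sum_step_mul hh, h1, mul_zero, sub_zero, norm_mul, norm_inv, Complex.norm_natCast]
  have h2 := norm_sum_χ_Ioc_le hc' _ _ hle
  have h3 := inv_norm_one_sub_χ_le hc'
  simp only [← mul_neg]
  calc _ ≤ (q : ℝ)⁻¹ * (2 * (q / 4 * (1 / ((-c).val : ℝ) + 1 / ((q : ℝ) - (-c).val)))) := by
        gcongr
        linarith
    _ = _ := by field_simp; norm_num

theorem sum_gcd_div_val_le {η C : ℝ} (hη : 0 < η)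
    (hC : ∀ s : Finset ℕ, (∀ m ∈ s, m ≠ 0) →
      ∑ m ∈ s, (m.gcd q : ℝ) / (m : ℝ) ^ (1 + η) ≤ C * (q : ℝ) ^ η)
    (φ : ZMod q → ℕ) (hφ : ∀ c, c ≠ 0 → φ c ≠ 0 ∧ φ c ≤ q) (hinj : Function.Injective φ) :
    ∑ c ∈ Finset.univ.erase (0 : ZMod q), ((φ c).gcd q : ℝ) / (φ c : ℝ) ≤
      C * (q : ℝ) ^ (2 * η) := by
  have hq : (0 : ℝ) < q := q_pos
  calc _ ≤ ∑ c ∈ Finset.univ.erase (0 : ZMod q),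
        (q : ℝ) ^ η * (((φ c).gcd q : ℝ) / (φ c : ℝ) ^ (1 + η)) := by
        refine Finset.sum_le_sum (fun c hc => ?_)
        obtain ⟨h0, h1⟩ := hφ c (Finset.ne_of_mem_erase hc)
        have h0' : (0 : ℝ) < φ c := by exact_mod_cast Nat.pos_of_ne_zero h0
        rw [Real.rpow_add h0', Real.rpow_one]
        have h2 : (φ c : ℝ) ^ η ≤ (q : ℝ) ^ η :=
          Real.rpow_le_rpow h0'.le (by exact_mod_cast h1) hη.le
        have h3 : (0 : ℝ) < (φ c : ℝ) ^ η := by positivity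
        rw [div_le_iff₀ h0']
        calc (((φ c).gcd q : ℕ) : ℝ) = (φ c : ℝ) ^ η *
              (((φ c).gcd q : ℝ) / (φ c * (φ c : ℝ) ^ η)) * φ c := by field_simp
          _ ≤ _ := by gcongr
    _ = (q : ℝ) ^ η * ∑ m ∈ (Finset.univ.erase (0 : ZMod q)).image φ,
          (m.gcd q : ℝ) / (m : ℝ) ^ (1 + η) := by
        rw [Finset.sum_image (fun a _ b _ h => hinj h), Finset.mul_sum]
    _ ≤ (q : ℝ) ^ η * (C * (q : ℝ) ^ η) := by
        gcongr
        refine hC _ (fun m hm => ?_)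
        obtain ⟨c, hc, rfl⟩ := Finset.mem_image.1 hm
        exact (hφ c (Finset.ne_of_mem_erase hc)).1
    _ = _ := by
        rw [two_mul, Real.rpow_add hq]; ring

theorem exists_l2_stepOp_le {η : ℝ} (hη : 0 < η) : ∃ C : ℝ, 1 ≤ C ∧
    ∀ (q : ℕ) [NeZero q] (h z : ℝ) (G : ZMod q → ℂ), 0 ≤ h →
      l2 (stepOp h z G) ≤ C * (q : ℝ) ^ (2 * η) * Real.sqrt q * l2 G := by
  obtain ⟨C, hC1, hC⟩ := exists_sum_gcd_le hη
  refine ⟨2 + C, by linarith, fun q _ h z G hh => ?_⟩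
  have hq : (0 : ℝ) < q := q_pos
  have hq1 : (1 : ℝ) ≤ q := by exact_mod_cast Nat.pos_of_ne_zero (NeZero.ne q)
  have hl := l2_nonneg G
  set F : ZMod q → ℂ := fcoef (fun r => (step h r z : ℂ)) with hF
  have h1 : l2 (stepOp h z G) ≤ ∑ c, ‖F c‖ * (Real.sqrt q * ((-c).val.gcd q) * l2 G) := by
    have : stepOp h z G = fun a => ∑ c, F c * ∑ r, χ (-(-c * r)) * G (a * r) := by
      ext a; exact stepOp_eq_sum_fcoef h z G a
    rw [this]
    refine (l2_sum_le _ (fun c a => F c * ∑ r, χ (-(-c * r)) * G (a * r))).trans ?_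
    refine Finset.sum_le_sum (fun c _ => ?_)
    rw [l2_const_mul]
    gcongr
    exact l2_twist_le (-c) G
  have h2 : ∑ c, ‖F c‖ * ((-c).val.gcd q : ℝ) ≤ (2 + C) * (q : ℝ) ^ (2 * η) := by
    rw [← Finset.add_sum_erase _ _ (Finset.mem_univ (0 : ZMod q))]
    have h0 : ‖F 0‖ * ((-(0 : ZMod q)).val.gcd q : ℝ) ≤ 2 := by
      rw [neg_zero, ZMod.val_zero, Nat.gcd_zero_left, ← le_div_iff₀ hq]
      exact norm_fcoef_step_zero_le h z
    have hval : ∀ c : ZMod q, c ≠ 0 → c.val ≠ 0 ∧ c.val ≤ q := fun c hc =>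
      ⟨fun h => hc ((ZMod.val_eq_zero c).1 h), (ZMod.val_lt c).le⟩
    have e1 : ∑ c ∈ Finset.univ.erase (0 : ZMod q), ((-c).val.gcd q : ℝ) / ((-c).val : ℝ) ≤
        C * (q : ℝ) ^ (2 * η) :=
      sum_gcd_div_val_le hη (hC q (NeZero.ne q)) (fun c => (-c).val)
        (fun c hc => hval _ (neg_ne_zero.2 hc))
        (fun a b h => neg_injective (ZMod.val_injective q h))
    have e2 : ∑ c ∈ Finset.univ.erase (0 : ZMod q),
        ((q - (-c).val).gcd q : ℝ) / ((q - (-c).val : ℕ) : ℝ) ≤ C * (q : ℝ) ^ (2 * η) := by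
      refine sum_gcd_div_val_le hη (hC q (NeZero.ne q)) (fun c => q - (-c).val)
        (fun c _ => ⟨?_, Nat.sub_le _ _⟩) (fun a b h => neg_injective (ZMod.val_injective q ?_))
      · have := ZMod.val_lt (-c); omega
      · have h1 := ZMod.val_lt (-a)
        have h2 := ZMod.val_lt (-b)
        simp only at h
        omega
    have e3 : ∑ c ∈ Finset.univ.erase (0 : ZMod q), ‖F c‖ * ((-c).val.gcd q : ℝ) ≤
        ∑ c ∈ Finset.univ.erase (0 : ZMod q), (1 / 2 * (((-c).val.gcd q : ℝ) / ((-c).val : ℝ)) +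
          1 / 2 * (((q - (-c).val).gcd q : ℝ) / ((q - (-c).val : ℕ) : ℝ))) := by
      refine Finset.sum_le_sum (fun c hc => ?_)
      have hlt := (ZMod.val_lt (-c)).le
      have hg : (q - (-c).val).gcd q = (-c).val.gcd q := Nat.gcd_self_sub_left hlt
      rw [hg, Nat.cast_sub hlt]
      calc _ ≤ 1 / 2 * (1 / ((-c).val : ℝ) + 1 / ((q : ℝ) - (-c).val)) *
            ((-c).val.gcd q : ℝ) := by
            gcongr
            exact norm_fcoef_step_le hh (Finset.ne_of_mem_erase hc)
        _ = _ := by ring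
    rw [Finset.sum_add_distrib, ← Finset.mul_sum, ← Finset.mul_sum] at e3
    have h3 : (1 : ℝ) ≤ (q : ℝ) ^ (2 * η) := Real.one_le_rpow hq1 (by positivity)
    nlinarith
  refine h1.trans ?_
  have h3 : ∑ c, ‖F c‖ * (Real.sqrt q * ((-c).val.gcd q) * l2 G) =
      (∑ c, ‖F c‖ * ((-c).val.gcd q : ℝ)) * (Real.sqrt q * l2 G) := by
    rw [Finset.sum_mul]
    exact Finset.sum_congr rfl (fun c _ => by ring)
  rw [h3, mul_assoc _ (Real.sqrt q)]
  gcongr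

end OperatorLong

section OperatorMean

theorem exp_sub_one_le_two_mul {h : ℝ} (h0 : 0 ≤ h) (h1 : h ≤ 1) : Real.exp h - 1 ≤ 2 * h := by
  have := Real.abs_exp_sub_one_le (x := h) (by rwa [abs_of_nonneg h0])
  rw [abs_of_nonneg h0] at this
  exact (le_abs_self _).trans this

variable {q : ℕ} [NeZero q]

theorem sq_l2_stepOp_le {h z : ℝ} (h0 : 0 < h) (h1 : h ≤ 1) (hz : Real.exp z ≤ Real.sqrt q / h)
    (G : ZMod q → ℂ) :
    l2 (stepOp h z G) ^ 2 ≤ (6 * Real.sqrt q *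
      ∑ n ∈ Finset.Ioc ⌊Real.exp z⌋₊ ⌊Real.exp (z + h)⌋₊, (n.gcd q : ℝ) +
      8 * h ^ 2 * (q.divisors.card : ℝ) ^ 2 * Real.exp (2 * z)) * l2 G ^ 2 := by
  set S := Finset.Ioc ⌊Real.exp z⌋₊ ⌊Real.exp (z + h)⌋₊ with hS
  have hmass : Real.exp (z + h) - Real.exp z ≤ 2 * h * Real.exp z := by
    have := exp_sub_one_le_two_mul h0.le h1
    rw [Real.exp_add]
    nlinarith [Real.exp_pos z]
  have hmass0 : 0 ≤ Real.exp (z + h) - Real.exp z :=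
    sub_nonneg.2 (Real.exp_le_exp.2 (by linarith))
  have hsq1 : 1 ≤ Real.sqrt q := by
    rw [Real.one_le_sqrt]; exact_mod_cast Nat.pos_of_ne_zero (NeZero.ne q)
  have hcard : (S.card : ℝ) ≤ 3 * Real.sqrt q := by
    have hle : ⌊Real.exp z⌋₊ ≤ ⌊Real.exp (z + h)⌋₊ :=
      Nat.floor_mono (Real.exp_le_exp.2 (by linarith))
    rw [hS, Nat.card_Ioc, Nat.cast_sub hle]
    have e1 := Nat.floor_le (Real.exp_pos (z + h)).le
    have e2 := Nat.lt_floor_add_one (Real.exp z)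
    rw [le_div_iff₀ h0] at hz
    nlinarith
  have hA : (∑ n ∈ S, Real.sqrt (n.gcd q)) ^ 2 ≤ 3 * Real.sqrt q * ∑ n ∈ S, (n.gcd q : ℝ) := by
    refine sq_sum_le_card_mul_sum_sq.trans ?_
    simp only [Real.sq_sqrt (Nat.cast_nonneg _)]
    gcongr
  have hB : ((Real.exp (z + h) - Real.exp z) * q.divisors.card) ^ 2 ≤
      4 * h ^ 2 * (q.divisors.card : ℝ) ^ 2 * Real.exp (2 * z) := by
    have : Real.exp (2 * z) = Real.exp z ^ 2 := by rw [two_mul, Real.exp_add, sq]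
    rw [this]
    calc _ ≤ (2 * h * Real.exp z * q.divisors.card) ^ 2 := by gcongr
      _ = _ := by ring
  have hl := l2_nonneg G
  calc l2 (stepOp h z G) ^ 2 ≤ ((∑ n ∈ S, Real.sqrt (n.gcd q) +
        (Real.exp (z + h) - Real.exp z) * q.divisors.card) * l2 G) ^ 2 := by
        have := l2_nonneg (stepOp h z G)
        gcongr
        exact l2_stepOp_le_sum h0.le G
    _ = (∑ n ∈ S, Real.sqrt (n.gcd q) +
        (Real.exp (z + h) - Real.exp z) * q.divisors.card) ^ 2 * l2 G ^ 2 := mul_pow _ _ _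
    _ ≤ _ := by
        gcongr
        nlinarith [sq_nonneg (∑ n ∈ S, Real.sqrt (n.gcd q) -
          (Real.exp (z + h) - Real.exp z) * q.divisors.card)]

theorem mem_Ioc_floor_exp_iff {h z : ℝ} {n : ℕ} (hn : n ≠ 0) :
    n ∈ Finset.Ioc ⌊Real.exp z⌋₊ ⌊Real.exp (z + h)⌋₊ ↔
      z ∈ Set.Ico (Real.log n - h) (Real.log n) := by
  have hn' : (0 : ℝ) < n := by exact_mod_cast Nat.pos_of_ne_zero hn
  rw [Finset.mem_Ioc, Nat.floor_lt (Real.exp_pos z).le, Nat.le_floor_iff (Real.exp_pos _).le,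
    Set.mem_Ico, Real.lt_log_iff_exp_lt hn', sub_le_iff_le_add, Real.log_le_iff_le_exp hn', and_comm]

/-- A majorant of the squared norm of `stepOp h z`. -/
noncomputable def opBound (q : ℕ) (h A Z : ℝ) (M : ℕ) (z : ℝ) : ℝ :=
  (Set.Iic Z).indicator (fun z => 6 * Real.sqrt q *
      ∑ n ∈ Finset.Icc 1 M, (Set.Ico (Real.log n - h) (Real.log n)).indicator
        (fun _ => (n.gcd q : ℝ)) z +
      8 * h ^ 2 * (q.divisors.card : ℝ) ^ 2 * Real.exp (2 * z)) z +
    (Set.Ioi Z).indicator (fun _ => A) z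

theorem measurable_opBound (q : ℕ) (h A Z : ℝ) (M : ℕ) : Measurable (opBound q h A Z M) := by
  unfold opBound
  refine Measurable.add (Measurable.indicator (Measurable.add (Measurable.const_mul
    (Finset.measurable_fun_sum _ fun n _ => measurable_const.indicator measurableSet_Ico) _)
    (by fun_prop)) measurableSet_Iic) (measurable_const.indicator measurableSet_Ioi)

theorem opBound_nonneg {A : ℝ} (hA : 0 ≤ A) (q : ℕ) (h Z : ℝ) (M : ℕ) (z : ℝ) :
    0 ≤ opBound q h A Z M z := by
  refine add_nonneg (Set.indicator_nonneg (fun z _ => ?_) _)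
    (Set.indicator_nonneg (fun _ _ => hA) _)
  have : ∀ n ∈ Finset.Icc 1 M, 0 ≤ (Set.Ico (Real.log n - h) (Real.log n)).indicator
      (fun _ => (n.gcd q : ℝ)) z := fun n _ => Set.indicator_nonneg (fun _ _ => by positivity) _
  have := Finset.sum_nonneg this
  positivity

theorem lintegral_opBound_le {q : ℕ} {h A Z η K : ℝ} (h0 : 0 < h) (h1 : h ≤ 1) (hη : 0 < η)
    (hη1 : η ≤ 1 / 2) (hA : 0 ≤ A) (hZ : 0 ≤ Z) (M : ℕ)
    (hK : ∑ n ∈ Finset.Icc 1 M, (n.gcd q : ℝ) / (n : ℝ) ^ (1 + η) ≤ K) :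
    ∫⁻ z, ENNReal.ofReal (opBound q h A Z M z * Real.exp (-(1 + η) * z)) ≤
      ENNReal.ofReal (48 * Real.sqrt q * K * h +
        16 * h ^ 2 * (q.divisors.card : ℝ) ^ 2 * Real.exp Z + A * Real.exp (-Z)) := by
  set τ := (q.divisors.card : ℝ) with hτ
  set F1 : ℝ → ℝ := fun z => ∑ n ∈ Finset.Icc 1 M,
    (Set.Ico (Real.log n - h) (Real.log n)).indicator
      (fun _ => 48 * Real.sqrt q * ((n.gcd q : ℝ) / (n : ℝ) ^ (1 + η))) z with hF1
  set F2 : ℝ → ℝ := (Set.Iic Z).indicator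
    (fun z => 8 * h ^ 2 * τ ^ 2 * Real.exp ((1 - η) * z)) with hF2
  set F3 : ℝ → ℝ := (Set.Ioi Z).indicator (fun z => A * Real.exp (-(1 + η) * z)) with hF3
  have i1' : ∀ n ∈ Finset.Icc 1 M, Integrable
      ((Set.Ico (Real.log n - h) (Real.log n)).indicator
      (fun _ => 48 * Real.sqrt q * ((n.gcd q : ℝ) / (n : ℝ) ^ (1 + η)))) := fun n _ =>
    (integrable_indicator_iff measurableSet_Ico).2 (integrableOn_const (by simp))
  have i1 : Integrable F1 := integrable_finsetSum _ i1'
  have i2 : Integrable F2 := (integrable_indicator_iff measurableSet_Iic).2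
    ((integrableOn_exp_mul_Iic (by linarith) Z).const_mul _)
  have i3 : Integrable F3 := (integrable_indicator_iff measurableSet_Ioi).2
    ((integrableOn_exp_mul_Ioi (by linarith) Z).const_mul _)
  have n1 : ∀ z, 0 ≤ F1 z := fun z =>
    Finset.sum_nonneg fun n _ => Set.indicator_nonneg (fun _ _ => by positivity) _
  have n2 : ∀ z, 0 ≤ F2 z := fun z => Set.indicator_nonneg (fun _ _ => by positivity) _
  have n3 : ∀ z, 0 ≤ F3 z := fun z => Set.indicator_nonneg (fun _ _ => by positivity) _
  have hpt : ∀ z, opBound q h A Z M z * Real.exp (-(1 + η) * z) ≤ F1 z + F2 z + F3 z := by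
    intro z
    rcases le_or_gt z Z with hz | hz
    · have a1 : z ∈ Set.Iic Z := hz
      have a2 : z ∉ Set.Ioi Z := not_lt.2 hz
      rw [opBound, Set.indicator_of_mem a1, Set.indicator_of_notMem a2, hF3, hF2,
        Set.indicator_of_notMem a2, Set.indicator_of_mem a1, add_zero, add_zero, add_mul]
      refine add_le_add ?_ (le_of_eq ?_)
      · rw [hF1, Finset.mul_sum, Finset.sum_mul]
        refine Finset.sum_le_sum (fun n hn => ?_)
        by_cases hm : z ∈ Set.Ico (Real.log n - h) (Real.log n)
        · rw [Set.indicator_of_mem hm, Set.indicator_of_mem hm]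
          have hn' : (0 : ℝ) < n := by exact_mod_cast (Finset.mem_Icc.1 hn).1
          have : Real.exp (-(1 + η) * z) ≤ 8 * ((n : ℝ) ^ (1 + η))⁻¹ := by
            calc Real.exp (-(1 + η) * z) ≤ Real.exp (2 + (-(1 + η) * Real.log n)) := by
                  refine Real.exp_le_exp.2 ?_
                  nlinarith [hm.1]
              _ = Real.exp 1 ^ 2 * ((n : ℝ) ^ (1 + η))⁻¹ := by
                  rw [Real.exp_add, ← Real.rpow_neg hn'.le, Real.rpow_def_of_pos hn',
                    ← Real.exp_nat_mul]
                  congr 2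
                  · norm_num
                  · ring
              _ ≤ _ := by
                  gcongr
                  nlinarith [Real.exp_one_lt_d9, Real.exp_pos 1]
          calc _ ≤ 6 * Real.sqrt q * (n.gcd q : ℝ) * (8 * ((n : ℝ) ^ (1 + η))⁻¹) := by gcongr
            _ = _ := by ring
        · rw [Set.indicator_of_notMem hm, Set.indicator_of_notMem hm]; simp
      · rw [mul_assoc, ← Real.exp_add]; congr 2; ring
    · have a1 : z ∉ Set.Iic Z := not_le.2 hz
      have a2 : z ∈ Set.Ioi Z := hz
      rw [opBound, Set.indicator_of_notMem a1, Set.indicator_of_mem a2, hF3, hF2,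
        Set.indicator_of_mem a2, Set.indicator_of_notMem a1]
      have := n1 z
      linarith
  calc _ ≤ ∫⁻ z, ENNReal.ofReal (F1 z + F2 z + F3 z) :=
        lintegral_mono fun z => ENNReal.ofReal_le_ofReal (hpt z)
    _ = ENNReal.ofReal (∫ z, (F1 z + F2 z + F3 z)) := by
        have i123 : Integrable fun z => F1 z + F2 z + F3 z := (i1.add i2).add i3
        rw [ofReal_integral_eq_lintegral_ofReal i123
          (Filter.Eventually.of_forall fun z => add_nonneg (add_nonneg (n1 z) (n2 z)) (n3 z))]
    _ ≤ _ := by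
        have i12 : Integrable fun z => F1 z + F2 z := i1.add i2
        refine ENNReal.ofReal_le_ofReal ?_
        rw [integral_add i12 i3, integral_add i1 i2]
        refine add_le_add (add_le_add ?_ ?_) ?_
        · rw [hF1, integral_finsetSum _ i1']
          calc _ = ∑ n ∈ Finset.Icc 1 M,
                h * (48 * Real.sqrt q * ((n.gcd q : ℝ) / (n : ℝ) ^ (1 + η))) := by
                refine Finset.sum_congr rfl (fun n _ => ?_)
                rw [integral_indicator measurableSet_Ico, setIntegral_const, smul_eq_mul]
                congr 1
                simp [Measure.real, h0.le]
            _ = h * (48 * Real.sqrt q) * ∑ n ∈ Finset.Icc 1 M,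
                (n.gcd q : ℝ) / (n : ℝ) ^ (1 + η) := by
                rw [Finset.mul_sum]
                exact Finset.sum_congr rfl fun n _ => by ring
            _ ≤ h * (48 * Real.sqrt q) * K := by gcongr
            _ = _ := by ring
        · rw [hF2, integral_indicator measurableSet_Iic, integral_const_mul,
            integral_exp_mul_Iic (by linarith)]
          have e1 : Real.exp ((1 - η) * Z) / (1 - η) ≤ 2 * Real.exp Z := by
            rw [div_le_iff₀ (by linarith)]
            have : Real.exp ((1 - η) * Z) ≤ Real.exp Z := Real.exp_le_exp.2 (by nlinarith)
            nlinarith [Real.exp_pos Z]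
          calc _ ≤ 8 * h ^ 2 * τ ^ 2 * (2 * Real.exp Z) := by gcongr
            _ = _ := by ring
        · rw [hF3, integral_indicator measurableSet_Ioi, integral_const_mul,
            integral_exp_mul_Ioi (by linarith)]
          gcongr
          rw [neg_div_neg_eq, div_le_iff₀ (by linarith)]
          have : Real.exp (-(1 + η) * Z) ≤ Real.exp (-Z) := Real.exp_le_exp.2 (by nlinarith)
          nlinarith [Real.exp_pos (-Z)]

theorem exists_opBound {η : ℝ} (hη : 0 < η) (hη1 : η ≤ 1 / 2) : ∃ C : ℝ, 1 ≤ C ∧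
    ∀ (q : ℕ) [NeZero q] (h : ℝ), 0 < h → h ≤ 1 → ∃ W : ℝ → ℝ, Measurable W ∧ (∀ z, 0 ≤ W z) ∧
      (∀ z (G : ZMod q → ℂ), l2 (stepOp h z G) ^ 2 ≤ W z * l2 G ^ 2) ∧
      ∫⁻ z, ENNReal.ofReal (W z * Real.exp (-(1 + η) * z)) ≤
        ENNReal.ofReal (C * (Real.sqrt q * h * (q : ℝ) ^ (4 * η))) := by
  obtain ⟨C1, hC1, H1⟩ := exists_sum_gcd_le hη
  obtain ⟨C2, hC2, H2⟩ := exists_card_divisors_le hη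
  obtain ⟨C3, hC3, H3⟩ := exists_l2_stepOp_le hη
  refine ⟨48 * C1 + 16 * C2 ^ 2 + C3 ^ 2, by nlinarith, fun q _ h h0 h1 => ?_⟩
  have hq : (0 : ℝ) < q := q_pos
  have hq1 : (1 : ℝ) ≤ q := by exact_mod_cast Nat.pos_of_ne_zero (NeZero.ne q)
  have hs : 0 < Real.sqrt q := Real.sqrt_pos.2 hq
  have hs1 : 1 ≤ Real.sqrt q := by rwa [Real.one_le_sqrt]
  have hss : Real.sqrt q * Real.sqrt q = q := Real.mul_self_sqrt hq.le
  set A := (C3 * (q : ℝ) ^ (2 * η) * Real.sqrt q) ^ 2 with hA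
  set Z := Real.log (Real.sqrt q / h) with hZ
  have hpos : 0 < Real.sqrt q / h := by positivity
  have hge : 1 ≤ Real.sqrt q / h := by rw [le_div_iff₀ h0]; linarith
  have hZ0 : 0 ≤ Z := Real.log_nonneg hge
  have hexpZ : Real.exp Z = Real.sqrt q / h := Real.exp_log hpos
  set M := ⌊Real.exp (Z + h)⌋₊ with hM
  refine ⟨opBound q h A Z M, measurable_opBound _ _ _ _ _, opBound_nonneg (by positivity) _ _ _ _,
    fun z G => ?_, ?_⟩
  · rcases le_or_gt z Z with hz | hz
    · refine (sq_l2_stepOp_le h0 h1 (by rw [← hexpZ]; exact Real.exp_le_exp.2 hz) G).trans ?_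
      have a1 : z ∈ Set.Iic Z := hz
      have a2 : z ∉ Set.Ioi Z := not_lt.2 hz
      rw [opBound, Set.indicator_of_mem a1, Set.indicator_of_notMem a2, add_zero]
      gcongr
      have hsub : Finset.Ioc ⌊Real.exp z⌋₊ ⌊Real.exp (z + h)⌋₊ ⊆ Finset.Icc 1 M := by
        intro n hn
        rw [Finset.mem_Ioc] at hn
        rw [Finset.mem_Icc]
        exact ⟨by omega, hn.2.trans (Nat.floor_mono (Real.exp_le_exp.2 (by linarith)))⟩
      calc _ = ∑ n ∈ Finset.Ioc ⌊Real.exp z⌋₊ ⌊Real.exp (z + h)⌋₊,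
            (Set.Ico (Real.log n - h) (Real.log n)).indicator (fun _ => (n.gcd q : ℝ)) z := by
            refine Finset.sum_congr rfl (fun n hn => ?_)
            have hn0 : n ≠ 0 := by rw [Finset.mem_Ioc] at hn; omega
            rw [Set.indicator_of_mem ((mem_Ioc_floor_exp_iff hn0).1 hn)]
        _ ≤ _ := Finset.sum_le_sum_of_subset_of_nonneg hsub
            fun n _ _ => Set.indicator_nonneg (fun _ _ => by positivity) _
    · have a1 : z ∉ Set.Iic Z := not_le.2 hz
      have a2 : z ∈ Set.Ioi Z := hz
      rw [opBound, Set.indicator_of_notMem a1, Set.indicator_of_mem a2, zero_add, hA, ← mul_pow]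
      have := l2_nonneg (stepOp h z G)
      gcongr
      exact H3 q h z G h0.le
  · refine (lintegral_opBound_le (K := C1 * (q : ℝ) ^ η) h0 h1 hη hη1 (by positivity) hZ0 M
      (H1 q (NeZero.ne q) _ fun m hm => by rw [Finset.mem_Icc] at hm; omega)).trans ?_
    refine ENNReal.ofReal_le_ofReal ?_
    have p1 : (q : ℝ) ^ η ≤ (q : ℝ) ^ (4 * η) := Real.rpow_le_rpow_of_exponent_le hq1 (by linarith)
    have p2 : ((q : ℝ) ^ η) ^ 2 ≤ (q : ℝ) ^ (4 * η) := by
      rw [← Real.rpow_mul_natCast hq.le]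
      exact Real.rpow_le_rpow_of_exponent_le hq1 (by push_cast; linarith)
    have p3 : ((q : ℝ) ^ (2 * η)) ^ 2 = (q : ℝ) ^ (4 * η) := by
      rw [← Real.rpow_mul_natCast hq.le]
      congr 1; push_cast; ring
    have t1 : 48 * Real.sqrt q * (C1 * (q : ℝ) ^ η) * h ≤
        48 * C1 * (Real.sqrt q * h * (q : ℝ) ^ (4 * η)) := by
      calc _ ≤ 48 * Real.sqrt q * (C1 * (q : ℝ) ^ (4 * η)) * h := by gcongr
        _ = _ := by ring
    have t2 : 16 * h ^ 2 * (q.divisors.card : ℝ) ^ 2 * Real.exp Z ≤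
        16 * C2 ^ 2 * (Real.sqrt q * h * (q : ℝ) ^ (4 * η)) := by
      rw [hexpZ]
      calc _ ≤ 16 * h ^ 2 * (C2 * (q : ℝ) ^ η) ^ 2 * (Real.sqrt q / h) := by
            gcongr
            exact H2 q (NeZero.ne q)
        _ = 16 * C2 ^ 2 * (Real.sqrt q * h * ((q : ℝ) ^ η) ^ 2) := by field_simp
        _ ≤ _ := by gcongr
    have t3 : A * Real.exp (-Z) = C3 ^ 2 * (Real.sqrt q * h * (q : ℝ) ^ (4 * η)) := by
      rw [hA, Real.exp_neg, hexpZ, mul_pow, mul_pow, p3]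
      field_simp
    linarith

end OperatorMean

section Kernel

theorem sum_natAbs_le {f : ℕ → ℝ} (hf : ∀ n, 0 ≤ f n) (S : Finset ℤ) :
    ∑ l ∈ S, f l.natAbs ≤ 2 * ∑ n ∈ S.image Int.natAbs, f n := by
  rw [← Finset.sum_fiberwise_of_maps_to (t := S.image Int.natAbs) (g := Int.natAbs)
    (fun l hl => Finset.mem_image_of_mem _ hl), Finset.mul_sum]
  refine Finset.sum_le_sum (fun n _ => ?_)
  rw [Finset.sum_congr rfl (g := fun _ => f n)
    (fun l hl => by rw [(Finset.mem_filter.1 hl).2]), Finset.sum_const, nsmul_eq_mul]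
  refine mul_le_mul_of_nonneg_right ?_ (hf n)
  have : S.filter (fun l => l.natAbs = n) ⊆ {(n : ℤ), -(n : ℤ)} := by
    intro l hl
    have := (Finset.mem_filter.1 hl).2
    simp only [Finset.mem_insert, Finset.mem_singleton]
    omega
  have := (Finset.card_le_card this).trans Finset.card_le_two
  exact_mod_cast this

theorem sum_int_rpow_le {θ : ℝ} (hθ : 0 < θ) (S : Finset ℤ) :
    ∑ l ∈ S, ((1 + |(l : ℝ)|) ^ (1 + θ))⁻¹ ≤ 2 * zsum θ := by
  have h1 : ∀ l : ℤ, ((1 + |(l : ℝ)|) ^ (1 + θ))⁻¹ =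
      (fun n : ℕ => (((n + 1 : ℕ) : ℝ) ^ (1 + θ))⁻¹) l.natAbs := fun l => by
    simp only [Nat.cast_add, Nat.cast_one, Nat.cast_natAbs, Int.cast_abs, add_comm]
  rw [Finset.sum_congr rfl fun l _ => h1 l]
  refine (sum_natAbs_le (f := fun n : ℕ => (((n + 1 : ℕ) : ℝ) ^ (1 + θ))⁻¹)
    (fun n => by positivity) S).trans ?_
  have h2 : ∑ n ∈ S.image Int.natAbs, (((n + 1 : ℕ) : ℝ) ^ (1 + θ))⁻¹ =
      ∑ m ∈ (S.image Int.natAbs).image Nat.succ, ((m : ℝ) ^ (1 + θ))⁻¹ := by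
    rw [Finset.sum_image (fun a _ b _ h => Nat.succ_injective h)]
  rw [h2]
  gcongr
  exact (summable_zsum hθ).sum_le_tsum _ (fun m _ => by positivity)

/-- The arithmetic kernel of the large sieve inequality. -/
noncomputable def kern (q : ℕ) (η : ℝ) (P P' : ℤ) : ℝ :=
  if (q : ℤ) ∣ P - P' then (P.natAbs.gcd q : ℝ) * ((|(P : ℝ)| * |(P' : ℝ)|) ^ (1 / 2 + η))⁻¹ /
    (1 + |(P : ℝ) - P'| / q) else 0

theorem kern_nonneg (q : ℕ) (η : ℝ) (P P' : ℤ) : 0 ≤ kern q η P P' := by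
  unfold kern; split_ifs <;> positivity

theorem natAbs_gcd_eq_of_dvd_sub {q : ℕ} {P P' : ℤ} (h : (q : ℤ) ∣ P - P') :
    P.natAbs.gcd q = P'.natAbs.gcd q := by
  have h1 : Int.gcd P q = Int.gcd P' q := by
    obtain ⟨k, hk⟩ := h
    rw [show P = P' + q * k by linarith, Int.gcd_add_mul_left_left]
  simpa [Int.gcd] using h1

theorem kern_le {q : ℕ} (hq : q ≠ 0) {η : ℝ} (hη : 0 < η) {P P' : ℤ} (hP : P ≠ 0) (hP' : P' ≠ 0) :
    (|(P : ℝ)| * |(P' : ℝ)|) ^ (η / 4) * kern q η P P' ≤ 3 ^ (η / 4) *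
      (if (q : ℤ) ∣ P - P' then
        ((P.natAbs.gcd q : ℝ) * (|(P : ℝ)| ^ (1 + η))⁻¹ +
          (P'.natAbs.gcd q : ℝ) * (|(P' : ℝ)| ^ (1 + η))⁻¹) *
        ((1 + |(P : ℝ) - P'| / q) ^ (1 + η / 4))⁻¹ else 0) := by
  unfold kern
  split_ifs with hd
  swap
  · simp
  rw [← natAbs_gcd_eq_of_dvd_sub hd]
  have hq1 : (1 : ℝ) ≤ q := by exact_mod_cast Nat.pos_of_ne_zero hq
  have hq0 : (0 : ℝ) < q := by linarith
  set x := |(P : ℝ)| with hx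
  set y := |(P' : ℝ)| with hy
  have hx1 : 1 ≤ x := by rw [hx]; exact_mod_cast Int.one_le_abs hP
  have hy1 : 1 ≤ y := by rw [hy]; exact_mod_cast Int.one_le_abs hP'
  set L := 1 + |(P : ℝ) - P'| / q with hL
  have hL1 : 1 ≤ L := by
    have : 0 ≤ |(P : ℝ) - P'| / q := by positivity
    linarith
  have hL3 : L ≤ 3 * (x * y) := by
    have h1 : |(P : ℝ) - P'| ≤ x + y := abs_sub _ _
    have h2 : |(P : ℝ) - P'| / q ≤ x + y := by
      rw [div_le_iff₀ hq0]; nlinarith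
    nlinarith [mul_nonneg (sub_nonneg.2 hx1) (sub_nonneg.2 hy1)]
  set g := (P.natAbs.gcd q : ℝ) with hg
  have hg0 : 0 ≤ g := by positivity
  have hx0 : 0 < x := by linarith
  have hy0 : 0 < y := by linarith
  have hxy : 0 < x * y := by positivity
  have hL0 : 0 < L := by linarith
  have e1 : L⁻¹ ≤ (3 : ℝ) ^ (η / 4) * (x * y) ^ (η / 4) * (L ^ (1 + η / 4))⁻¹ := by
    rw [← Real.mul_rpow (by norm_num) hxy.le, Real.rpow_add hL0, Real.rpow_one, mul_inv]
    have h1 : L ^ (η / 4) ≤ (3 * (x * y)) ^ (η / 4) := by gcongr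
    have h2 : 0 < L ^ (η / 4) := by positivity
    calc L⁻¹ = L ^ (η / 4) * (L⁻¹ * (L ^ (η / 4))⁻¹) := by field_simp
      _ ≤ _ := by gcongr
  have e2 : (x * y) ^ (η / 4) * ((x * y) ^ (1 / 2 + η))⁻¹ * (x * y) ^ (η / 4) =
      (x ^ ((1 + η) / 2))⁻¹ * (y ^ ((1 + η) / 2))⁻¹ := by
    rw [← mul_inv, ← Real.mul_rpow hx0.le hy0.le, ← Real.rpow_neg hxy.le, ← Real.rpow_neg hxy.le,
      ← Real.rpow_add hxy, ← Real.rpow_add hxy]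
    congr 1; ring
  have e3 : ∀ w : ℝ, 0 < w → ((w ^ ((1 + η) / 2))⁻¹) ^ 2 = (w ^ (1 + η))⁻¹ := fun w hw => by
    rw [inv_pow, ← Real.rpow_mul_natCast hw.le]; congr 2; push_cast; ring
  have e4 : (x ^ ((1 + η) / 2))⁻¹ * (y ^ ((1 + η) / 2))⁻¹ ≤
      (x ^ (1 + η))⁻¹ + (y ^ (1 + η))⁻¹ := by
    rw [← e3 x hx0, ← e3 y hy0]
    nlinarith [sq_nonneg ((x ^ ((1 + η) / 2))⁻¹ - (y ^ ((1 + η) / 2))⁻¹),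
      sq_nonneg ((x ^ ((1 + η) / 2))⁻¹), sq_nonneg ((y ^ ((1 + η) / 2))⁻¹)]
  calc _ = g * ((x * y) ^ (η / 4) * ((x * y) ^ (1 / 2 + η))⁻¹) * L⁻¹ := by
        rw [div_eq_mul_inv]; ring
    _ ≤ g * ((x * y) ^ (η / 4) * ((x * y) ^ (1 / 2 + η))⁻¹) *
        ((3 : ℝ) ^ (η / 4) * (x * y) ^ (η / 4) * (L ^ (1 + η / 4))⁻¹) := by gcongr
    _ = 3 ^ (η / 4) * (g * ((x * y) ^ (η / 4) * ((x * y) ^ (1 / 2 + η))⁻¹ * (x * y) ^ (η / 4)) *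
        (L ^ (1 + η / 4))⁻¹) := by ring
    _ ≤ 3 ^ (η / 4) * (g * ((x ^ (1 + η))⁻¹ + (y ^ (1 + η))⁻¹) * (L ^ (1 + η / 4))⁻¹) := by
        rw [e2]; gcongr
    _ = _ := by ring

theorem sum_congruent_le {q : ℕ} (hq : q ≠ 0) {θ : ℝ} (hθ : 0 < θ) (P : ℤ) (S : Finset ℤ) :
    ∑ P' ∈ S, (if (q : ℤ) ∣ P - P' then ((1 + |(P : ℝ) - P'| / q) ^ (1 + θ))⁻¹ else 0) ≤
      2 * zsum θ := by
  have hq0 : (0 : ℝ) < q := by exact_mod_cast Nat.pos_of_ne_zero hq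
  rw [← Finset.sum_filter]
  have hinj : Set.InjOn (fun P' : ℤ => (P - P') / q) (S.filter fun P' => (q : ℤ) ∣ P - P') := by
    intro a ha b hb hab
    have ha' := Int.ediv_mul_cancel (Finset.mem_filter.1 (Finset.mem_coe.1 ha)).2
    have hb' := Int.ediv_mul_cancel (Finset.mem_filter.1 (Finset.mem_coe.1 hb)).2
    simp only at hab
    rw [hab] at ha'
    linarith
  refine le_trans (le_of_eq ?_)
    (sum_int_rpow_le hθ ((S.filter fun P' => (q : ℤ) ∣ P - P').image fun P' => (P - P') / q))
  rw [Finset.sum_image hinj]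
  refine Finset.sum_congr rfl (fun P' hP' => ?_)
  have h := Int.ediv_mul_cancel (Finset.mem_filter.1 hP').2
  have h' : (((P - P') / q : ℤ) : ℝ) * q = P - P' := by exact_mod_cast h
  rw [← h', abs_mul, abs_of_pos hq0, mul_div_cancel_right₀ _ hq0.ne']

theorem exists_sum_kern_le {η : ℝ} (hη : 0 < η) : ∃ C : ℝ, 1 ≤ C ∧ ∀ q : ℕ, q ≠ 0 →
    ∀ S : Finset ℤ, 0 ∉ S → ∑ P ∈ S, ∑ P' ∈ S,
      (P.natAbs.divisors.card : ℝ) * P'.natAbs.divisors.card * kern q η P P' ≤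
        C * (q : ℝ) ^ η := by
  obtain ⟨C1, hC1, H1⟩ := exists_sum_gcd_le hη
  obtain ⟨C2, hC2, H2⟩ := exists_card_divisors_le (δ := η / 4) (by positivity)
  have hz := zsum_pos (η := η / 4) (by positivity)
  have h3 : (1 : ℝ) ≤ 3 ^ (η / 4) := Real.one_le_rpow (by norm_num) (by positivity)
  refine ⟨1 + C2 ^ 2 * 3 ^ (η / 4) * (2 * (2 * zsum (η / 4) * (2 * C1))), ?_,
    fun q hq S hS => ?_⟩
  · have : 0 ≤ C2 ^ 2 * 3 ^ (η / 4) * (2 * (2 * zsum (η / 4) * (2 * C1))) := by positivity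
    linarith
  set u : ℤ → ℝ := fun P => (P.natAbs.gcd q : ℝ) * (|(P : ℝ)| ^ (1 + η))⁻¹ with hu
  set v : ℤ → ℤ → ℝ := fun P P' =>
    if (q : ℤ) ∣ P - P' then ((1 + |(P : ℝ) - P'| / q) ^ (1 + η / 4))⁻¹ else 0 with hv
  have hu0 : ∀ P, 0 ≤ u P := fun P => by positivity
  have hvs : ∀ P P', v P P' = v P' P := fun P P' => by
    simp only [hv, abs_sub_comm (P : ℝ) P', dvd_sub_comm (b := P)]
  have hsum : ∑ P ∈ S, u P ≤ 2 * C1 * (q : ℝ) ^ η := by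
    have e1 : ∀ P : ℤ, u P = (fun n : ℕ => (n.gcd q : ℝ) / (n : ℝ) ^ (1 + η)) P.natAbs := fun P => by
      simp only [hu, Nat.cast_natAbs, Int.cast_abs, div_eq_mul_inv]
    rw [Finset.sum_congr rfl fun P _ => e1 P, mul_assoc]
    refine (sum_natAbs_le (f := fun n : ℕ => (n.gcd q : ℝ) / (n : ℝ) ^ (1 + η))
      (fun n => by positivity) S).trans ?_
    gcongr
    refine H1 q hq _ (fun m hm => ?_)
    obtain ⟨P, hP, rfl⟩ := Finset.mem_image.1 hm
    exact fun h => hS (by rwa [Int.natAbs_eq_zero.1 h] at hP)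
  have hterm : ∀ P ∈ S, ∀ P' ∈ S,
      (P.natAbs.divisors.card : ℝ) * P'.natAbs.divisors.card * kern q η P P' ≤
        C2 ^ 2 * 3 ^ (η / 4) * (u P * v P P' + u P' * v P' P) := by
    intro P hP P' hP'
    have hP0 : P ≠ 0 := fun h => hS (h ▸ hP)
    have hP0' : P' ≠ 0 := fun h => hS (h ▸ hP')
    have d1 := H2 P.natAbs (Int.natAbs_ne_zero.2 hP0)
    have d2 := H2 P'.natAbs (Int.natAbs_ne_zero.2 hP0')
    rw [Nat.cast_natAbs, Int.cast_abs] at d1 d2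
    have hk := kern_nonneg q η P P'
    calc _ ≤ (C2 * |(P : ℝ)| ^ (η / 4)) * (C2 * |(P' : ℝ)| ^ (η / 4)) * kern q η P P' := by gcongr
      _ = C2 ^ 2 * ((|(P : ℝ)| * |(P' : ℝ)|) ^ (η / 4) * kern q η P P') := by
          rw [Real.mul_rpow (abs_nonneg _) (abs_nonneg _)]; ring
      _ ≤ C2 ^ 2 * _ := mul_le_mul_of_nonneg_left (kern_le hq hη hP0 hP0') (by positivity)
      _ = _ := by
          rw [hvs P' P]
          simp only [hu, hv]
          split_ifs <;> ring
  have hrow : ∑ P ∈ S, ∑ P' ∈ S, u P * v P P' ≤ 2 * zsum (η / 4) * (2 * C1) * (q : ℝ) ^ η := by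
    calc _ ≤ ∑ P ∈ S, u P * (2 * zsum (η / 4)) := by
          refine Finset.sum_le_sum (fun P _ => ?_)
          rw [← Finset.mul_sum]
          exact mul_le_mul_of_nonneg_left (sum_congruent_le hq (by positivity) P S) (hu0 P)
      _ = 2 * zsum (η / 4) * ∑ P ∈ S, u P := by rw [← Finset.sum_mul, mul_comm]
      _ ≤ 2 * zsum (η / 4) * (2 * C1 * (q : ℝ) ^ η) := by gcongr
      _ = _ := by ring
  calc _ ≤ ∑ P ∈ S, ∑ P' ∈ S, C2 ^ 2 * 3 ^ (η / 4) * (u P * v P P' + u P' * v P' P) :=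
        Finset.sum_le_sum fun P hP => Finset.sum_le_sum fun P' hP' => hterm P hP P' hP'
    _ = C2 ^ 2 * 3 ^ (η / 4) * (2 * ∑ P ∈ S, ∑ P' ∈ S, u P * v P P') := by
        rw [two_mul]
        nth_rewrite 3 [Finset.sum_comm]
        simp only [← Finset.sum_add_distrib, Finset.mul_sum]
    _ ≤ C2 ^ 2 * 3 ^ (η / 4) * (2 * (2 * zsum (η / 4) * (2 * C1) * (q : ℝ) ^ η)) := by gcongr
    _ ≤ _ := by
        have : 0 ≤ (q : ℝ) ^ η := by positivity
        nlinarith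

/-- The bound for the diagonal pairing over pairs `(m, κ)`. -/
theorem exists_sum_pair_kern_le {η : ℝ} (hη : 0 < η) : ∃ C : ℝ, 1 ≤ C ∧ ∀ q : ℕ, q ≠ 0 →
    ∀ I : Finset (ℕ × ℤ), (∀ p ∈ I, p.1 ≠ 0 ∧ p.2 ≠ 0) →
      ∑ p ∈ I, ∑ p' ∈ I, kern q η (p.2 * p'.1) (p'.2 * p.1) ≤ C * (q : ℝ) ^ η := by
  obtain ⟨C, hC, H⟩ := exists_sum_kern_le hη
  refine ⟨C, hC, fun q hq I hI => ?_⟩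
  set φ : (ℕ × ℤ) × (ℕ × ℤ) → ℤ × ℤ := fun x => (x.1.2 * x.2.1, x.2.2 * x.1.1) with hφ
  set S : Finset ℤ := (I ×ˢ I).image fun x => x.1.2 * x.2.1 with hS
  have hmaps : ∀ x ∈ I ×ˢ I, φ x ∈ S ×ˢ S := by
    intro x hx
    rw [Finset.mem_product] at hx ⊢
    exact ⟨Finset.mem_image_of_mem _ (Finset.mem_product.2 hx),
      Finset.mem_image.2 ⟨(x.2, x.1), Finset.mem_product.2 ⟨hx.2, hx.1⟩, rfl⟩⟩
  have h0 : (0 : ℤ) ∉ S := by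
    intro h
    obtain ⟨x, hx, hx0⟩ := Finset.mem_image.1 h
    rw [Finset.mem_product] at hx
    have h1 := (hI _ hx.1).2
    have h2 := (hI _ hx.2).1
    rcases mul_eq_zero.1 hx0 with h | h
    · exact h1 h
    · exact h2 (by exact_mod_cast h)
  rw [← Finset.sum_product' I I (fun p p' => kern q η (p.2 * p'.1) (p'.2 * p.1)),
    ← Finset.sum_fiberwise_of_maps_to hmaps]
  refine le_trans ?_ (H q hq S h0)
  rw [← Finset.sum_product' S S (fun P P' =>
    (P.natAbs.divisors.card : ℝ) * P'.natAbs.divisors.card * kern q η P P')]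
  refine Finset.sum_le_sum (fun y hy => ?_)
  rw [Finset.sum_congr rfl (g := fun _ => kern q η y.1 y.2)
    (fun x hx => by rw [← (Finset.mem_filter.1 hx).2]), Finset.sum_const, nsmul_eq_mul]
  refine mul_le_mul_of_nonneg_right ?_ (kern_nonneg _ _ _ _)
  rw [← Nat.cast_mul, ← Finset.card_product]
  have hy' := Finset.mem_product.1 hy
  have y1 : y.1 ≠ 0 := fun h => h0 (h ▸ hy'.1)
  have y2 : y.2 ≠ 0 := fun h => h0 (h ▸ hy'.2)
  norm_cast
  refine Finset.card_le_card_of_injOn (fun x => (x.2.1, x.1.1)) ?_ ?_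
  · intro x hx
    obtain ⟨_, rfl⟩ := Finset.mem_filter.1 (Finset.mem_coe.1 hx)
    rw [Finset.mem_coe, Finset.mem_product, Nat.mem_divisors, Nat.mem_divisors]
    refine ⟨⟨?_, Int.natAbs_ne_zero.2 y1⟩, ⟨?_, Int.natAbs_ne_zero.2 y2⟩⟩
    · simp only [hφ, Int.natAbs_mul, Int.natAbs_natCast]; exact dvd_mul_left _ _
    · simp only [hφ, Int.natAbs_mul, Int.natAbs_natCast]; exact dvd_mul_left _ _
  · rintro ⟨⟨m, k⟩, ⟨m', k'⟩⟩ hx ⟨⟨n, l⟩, ⟨n', l'⟩⟩ hx' h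
    obtain ⟨hx1, hx2⟩ := Finset.mem_filter.1 (Finset.mem_coe.1 hx)
    obtain ⟨_, hx2'⟩ := Finset.mem_filter.1 (Finset.mem_coe.1 hx')
    rw [Finset.mem_product] at hx1
    have m0 : (m : ℤ) ≠ 0 := by exact_mod_cast (hI _ hx1.1).1
    have m0' : (m' : ℤ) ≠ 0 := by exact_mod_cast (hI _ hx1.2).1
    simp only [Prod.mk.injEq] at h
    obtain ⟨rfl, rfl⟩ := h
    rw [← hx2'] at hx2
    simp only [hφ, Prod.mk.injEq] at hx2
    have k1 := mul_right_cancel₀ m0' hx2.1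
    have k2 := mul_right_cancel₀ m0 hx2.2
    simp [k1, k2]

end Kernel

section LargeSieve

/-- The oscillating factor `exp (i β e ^ z)`. -/
noncomputable def osc (β z : ℝ) : ℂ := Complex.exp (Complex.I * ((β * Real.exp z : ℝ) : ℂ))

theorem norm_osc (β z : ℝ) : ‖osc β z‖ = 1 := Complex.norm_exp_I_mul_ofReal _

theorem continuous_osc (β : ℝ) : Continuous (osc β) := by unfold osc; fun_prop

theorem osc_mul_conj (β β' z : ℝ) : osc β z * (starRingEnd ℂ) (osc β' z) = osc (β - β') z := by
  unfold osc
  rw [← Complex.exp_conj, ← Complex.exp_add, map_mul, Complex.conj_I, Complex.conj_ofReal]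
  congr 1
  push_cast
  ring

theorem norm_integral_osc_le {β a b : ℝ} (hβ : β ≠ 0) :
    ‖∫ z in a..b, osc β z * (Real.exp z : ℂ)‖ ≤ 2 / |β| := by
  have hI : Complex.I * (β : ℂ) ≠ 0 :=
    mul_ne_zero Complex.I_ne_zero (Complex.ofReal_ne_zero.2 hβ)
  have hd : ∀ z ∈ Set.uIcc a b, HasDerivAt (fun z => osc β z / (Complex.I * β))
      (osc β z * (Real.exp z : ℂ)) z := by
    intro z _
    have h1 : HasDerivAt (fun z : ℝ => ((β * Real.exp z : ℝ) : ℂ)) ((β * Real.exp z : ℝ) : ℂ) z :=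
      ((Real.hasDerivAt_exp z).const_mul β).ofReal_comp
    have h2 := ((h1.const_mul Complex.I).cexp).div_const (Complex.I * β)
    refine h2.congr_deriv ?_
    rw [div_eq_iff hI, show Complex.exp (Complex.I * ((β * Real.exp z : ℝ) : ℂ)) = osc β z from rfl]
    push_cast
    ring
  rw [intervalIntegral.integral_eq_sub_of_hasDerivAt hd
    (((continuous_osc β).mul (by fun_prop)).intervalIntegrable _ _), ← sub_div, norm_div, norm_mul,
    Complex.norm_I, one_mul, Complex.norm_real, Real.norm_eq_abs]
  gcongr
  refine (norm_sub_le _ _).trans ?_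
  rw [norm_osc, norm_osc]; norm_num

theorem norm_setIntegral_osc_le (β c k : ℝ) :
    ‖∫ z in Set.Ioc k (k + 1), (if c < z then osc β z * (Real.exp z : ℂ) else 0)‖ ≤
      2 * Real.exp k ∧ (β ≠ 0 →
    ‖∫ z in Set.Ioc k (k + 1), (if c < z then osc β z * (Real.exp z : ℂ) else 0)‖ ≤ 2 / |β|) := by
  have h1 : ∫ z in Set.Ioc k (k + 1), (if c < z then osc β z * (Real.exp z : ℂ) else 0) =
      ∫ z in Set.Ioc (k ⊔ c) (k + 1), osc β z * (Real.exp z : ℂ) := by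
    have : (fun z => if c < z then osc β z * (Real.exp z : ℂ) else 0) =
        (Set.Ioi c).indicator fun z => osc β z * (Real.exp z : ℂ) := by
      ext z; simp [Set.indicator]
    rw [this, setIntegral_indicator measurableSet_Ioi, Set.Ioc_inter_Ioi]
  rw [h1]
  rcases le_total (k ⊔ c) (k + 1) with h | h
  swap
  · rw [Set.Ioc_eq_empty (not_lt.2 h)]
    simp only [Measure.restrict_empty, integral_zero_measure, norm_zero]
    exact ⟨by positivity, fun _ => by positivity⟩
  rw [← intervalIntegral.integral_of_le h]
  refine ⟨?_, norm_integral_osc_le⟩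
  refine (intervalIntegral.norm_integral_le_integral_norm h).trans ?_
  have h2 : ∀ z, ‖osc β z * (Real.exp z : ℂ)‖ = Real.exp z := fun z => by
    rw [norm_mul, norm_osc, one_mul, Complex.norm_real, Real.norm_eq_abs,
      abs_of_pos (Real.exp_pos z)]
  simp only [h2, integral_exp]
  have h3 : Real.exp (k + 1) ≤ 3 * Real.exp k := by
    rw [Real.exp_add]
    nlinarith [Real.exp_one_lt_d9, Real.exp_pos k]
  have h4 : Real.exp k ≤ Real.exp (k ⊔ c) := Real.exp_le_exp.2 le_sup_left
  linarith

variable {q : ℕ} [NeZero q]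

/-- The frequency attached to the pair `(m, κ)`. -/
noncomputable def freq (q : ℕ) (t : ℝ) (p : ℕ × ℤ) : ℝ := 2 * Real.pi * t * p.2 / (q * p.1)

/-- A dual exponential sum, cut off at `c m < z` in the variable `m`. -/
noncomputable def dualSum (t : ℝ) (c : ℕ → ℝ) (a : ℕ × ℤ → ℂ) (I : Finset (ℕ × ℤ)) (j : ZMod q)
    (z : ℝ) : ℂ :=
  ∑ p ∈ I, if (p.2 : ZMod q) = j * (p.1 : ZMod q) then
    (if c p.1 < z then a p * osc (freq q t p) z else 0) else 0

theorem measurable_dualSum (t : ℝ) (c : ℕ → ℝ) (a : ℕ × ℤ → ℂ) (I : Finset (ℕ × ℤ)) (j : ZMod q) :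
    Measurable (dualSum t c a I j) := by
  refine Finset.measurable_fun_sum _ fun p _ => ?_
  split_ifs
  · exact Measurable.ite measurableSet_Ioi ((continuous_osc _).measurable.const_mul _)
      measurable_const
  · exact measurable_const

theorem card_dual_le (p p' : ℕ × ℤ) :
    ((Finset.univ.filter fun j : ZMod q => (p.2 : ZMod q) = j * (p.1 : ZMod q) ∧
      (p'.2 : ZMod q) = j * (p'.1 : ZMod q)).card : ℝ) ≤
    if (q : ℤ) ∣ p.2 * p'.1 - p'.2 * p.1 then ((p.2 * p'.1).natAbs.gcd q : ℝ) else 0 := by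
  have hq : 0 < q := Nat.pos_of_ne_zero (NeZero.ne q)
  split_ifs with hd
  · norm_cast
    calc _ ≤ (Finset.univ.filter fun j : ZMod q =>
          (p'.1 : ZMod q) * j = (p'.2 : ZMod q)).card := by
          refine Finset.card_le_card (fun j hj => ?_)
          rw [Finset.mem_filter] at hj ⊢
          exact ⟨hj.1, by rw [hj.2.2, mul_comm]⟩
      _ ≤ p'.1.gcd q := by rw [← gcd_val_natCast]; exact card_mul_eq_le _ _
      _ ≤ _ := by
          refine Nat.le_of_dvd (Nat.gcd_pos_of_pos_right _ hq) ?_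
          rw [Int.natAbs_mul, Int.natAbs_natCast]
          exact Nat.gcd_dvd_gcd_of_dvd_left _ (dvd_mul_left _ _)
  · rw [Finset.filter_false_of_mem, Finset.card_empty, Nat.cast_zero]
    rintro j - ⟨h1, h2⟩
    refine hd ?_
    rw [← ZMod.intCast_zmod_eq_zero_iff_dvd]
    push_cast
    rw [h1, h2]; ring

theorem norm_integral_pair_le {k t : ℝ} (ht : 1 ≤ t) (c : ℝ) {p p' : ℕ × ℤ} (hp : p.1 ≠ 0)
    (hp' : p'.1 ≠ 0) (hpk : (p.1 : ℝ) ^ 2 ≤ 9 * Real.exp k) (hpk' : (p'.1 : ℝ) ^ 2 ≤ 9 * Real.exp k)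
    (hd : (q : ℤ) ∣ p.2 * p'.1 - p'.2 * p.1) :
    ‖∫ z in Set.Ioc k (k + 1),
      (if c < z then osc (freq q t p - freq q t p') z * (Real.exp z : ℂ) else 0)‖ ≤
      6 * Real.exp k / (1 + |((p.2 * p'.1 : ℤ) : ℝ) - ((p'.2 * p.1 : ℤ) : ℝ)| / q) := by
  obtain ⟨b1, b2⟩ := norm_setIntegral_osc_le (freq q t p - freq q t p') c k
  have hq : (0 : ℝ) < q := q_pos
  have hk := Real.exp_pos k
  have m0 : (0 : ℝ) < p.1 := by exact_mod_cast Nat.pos_of_ne_zero hp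
  have m0' : (0 : ℝ) < p'.1 := by exact_mod_cast Nat.pos_of_ne_zero hp'
  obtain ⟨l, hl⟩ := hd
  have hl' : ((p.2 * p'.1 : ℤ) : ℝ) - ((p'.2 * p.1 : ℤ) : ℝ) = q * l := by exact_mod_cast hl
  have hD : |((p.2 * p'.1 : ℤ) : ℝ) - ((p'.2 * p.1 : ℤ) : ℝ)| / q = |(l : ℝ)| := by
    rw [hl', abs_mul, abs_of_pos hq, mul_div_cancel_left₀ _ hq.ne']
  rw [hD]
  by_cases h0 : l = 0
  · refine b1.trans ?_
    rw [h0]; simp; linarith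
  · have hl1 : (1 : ℝ) ≤ |(l : ℝ)| := by exact_mod_cast Int.one_le_abs h0
    have hl0 : (l : ℝ) ≠ 0 := by exact_mod_cast h0
    have hβ : freq q t p - freq q t p' = 2 * Real.pi * t * l / (p.1 * p'.1) := by
      have : (p.2 : ℝ) * p'.1 - p'.2 * p.1 = q * l := by rw [← hl']; push_cast; ring
      rw [freq, freq, show (2 * Real.pi * t * p.2 / (q * p.1) - 2 * Real.pi * t * p'.2 / (q * p'.1) : ℝ)
        = 2 * Real.pi * t * ((p.2 : ℝ) * p'.1 - p'.2 * p.1) / (q * p.1 * p'.1) by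
          field_simp, this]
      field_simp
    have ht0 : 0 < t := by linarith
    have hβ0 : freq q t p - freq q t p' ≠ 0 := by
      rw [hβ]; have := Real.pi_pos; positivity
    refine (b2 hβ0).trans ?_
    rw [hβ, abs_div, abs_mul, abs_of_pos (by positivity : 0 < 2 * Real.pi * t),
      abs_of_pos (by positivity : (0 : ℝ) < p.1 * p'.1), ← div_mul, div_mul_eq_mul_div,
      div_le_div_iff₀ (by positivity) (by positivity)]
    have hmm : (p.1 : ℝ) * p'.1 ≤ 9 * Real.exp k := by nlinarith [sq_nonneg ((p.1 : ℝ) - p'.1)]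
    have hpi := Real.pi_gt_three
    have h3 : 3 ≤ Real.pi * t := by nlinarith
    calc 2 * ((p.1 : ℝ) * p'.1) * (1 + |(l : ℝ)|) ≤ 2 * (9 * Real.exp k) * (2 * |(l : ℝ)|) := by
          gcongr; linarith
      _ = 6 * Real.exp k * (2 * 3 * |(l : ℝ)|) := by ring
      _ ≤ 6 * Real.exp k * (2 * (Real.pi * t) * |(l : ℝ)|) := by gcongr
      _ = _ := by ring

theorem exists_largeSieve {η : ℝ} (hη : 0 < η) : ∃ C : ℝ, 1 ≤ C ∧ ∀ (q : ℕ) [NeZero q]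
    (k t : ℝ) (c : ℕ → ℝ) (a : ℕ × ℤ → ℂ) (I : Finset (ℕ × ℤ)) (Ω : ℝ), 1 ≤ t →
    (∀ p ∈ I, p.1 ≠ 0 ∧ p.2 ≠ 0 ∧ (p.1 : ℝ) ^ 2 ≤ 9 * Real.exp k) →
    (∀ p ∈ I, ‖a p‖ ≤ Ω * ((p.1 * |(p.2 : ℝ)|) ^ (1 / 2 + η))⁻¹) →
      ∫ z in Set.Ioc k (k + 1), (∑ j : ZMod q, ‖dualSum t c a I j z‖ ^ 2) * Real.exp z ≤
        C * (q : ℝ) ^ η * Ω ^ 2 * Real.exp k := by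
  obtain ⟨C, hC, H⟩ := exists_sum_pair_kern_le hη
  refine ⟨6 * C, by linarith, fun q _ k t c a I Ω ht hI ha => ?_⟩
  set X : ℕ × ℤ → ℕ × ℤ → ℝ → ℂ := fun p p' z => if max (c p.1) (c p'.1) < z then
    osc (freq q t p - freq q t p') z * (Real.exp z : ℂ) else 0 with hX
  set N : ℕ × ℤ → ℕ × ℤ → ℕ := fun p p' => (Finset.univ.filter fun j : ZMod q =>
    (p.2 : ZMod q) = j * (p.1 : ZMod q) ∧ (p'.2 : ZMod q) = j * (p'.1 : ZMod q)).card with hN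
  have hexp : ∀ z, (((∑ j : ZMod q, ‖dualSum t c a I j z‖ ^ 2) * Real.exp z : ℝ) : ℂ) =
      ∑ p ∈ I, ∑ p' ∈ I, (N p p' : ℂ) * (a p * (starRingEnd ℂ) (a p')) * X p p' z := by
    intro z
    have h1 : ∀ j : ZMod q, ((‖dualSum t c a I j z‖ ^ 2 : ℝ) : ℂ) * (Real.exp z : ℂ) =
        ∑ p ∈ I, ∑ p' ∈ I, (if (p.2 : ZMod q) = j * (p.1 : ZMod q) ∧
          (p'.2 : ZMod q) = j * (p'.1 : ZMod q) then
            (a p * (starRingEnd ℂ) (a p')) * X p p' z else 0) := by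
      intro j
      push_cast
      rw [← Complex.mul_conj', dualSum, map_sum, Finset.sum_mul_sum, Finset.sum_mul]
      refine Finset.sum_congr rfl (fun p _ => ?_)
      rw [Finset.sum_mul]
      refine Finset.sum_congr rfl (fun p' _ => ?_)
      simp only [hX, max_lt_iff]
      by_cases g1 : (p.2 : ZMod q) = j * (p.1 : ZMod q) <;>
        by_cases g2 : (p'.2 : ZMod q) = j * (p'.1 : ZMod q) <;>
        by_cases g3 : c p.1 < z <;> by_cases g4 : c p'.1 < z <;>
        simp only [g1, g2, g3, g4, if_true, if_false, and_true, and_false, map_zero,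
          mul_zero, zero_mul]
      rw [map_mul, ← osc_mul_conj]; push_cast; ring
    rw [Complex.ofReal_mul, Complex.ofReal_sum, Finset.sum_mul, Finset.sum_congr rfl fun j _ => h1 j,
      Finset.sum_comm]
    refine Finset.sum_congr rfl (fun p _ => ?_)
    rw [Finset.sum_comm]
    refine Finset.sum_congr rfl (fun p' _ => ?_)
    rw [← Finset.sum_filter, Finset.sum_const, nsmul_eq_mul]
    simp only [hN]
    ring
  have hXint : ∀ p p', IntegrableOn (X p p') (Set.Ioc k (k + 1)) := by
    intro p p'
    have h1 : IntegrableOn (fun z => osc (freq q t p - freq q t p') z * (Real.exp z : ℂ))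
        (Set.Ioc k (k + 1)) :=
      (((continuous_osc _).mul (by fun_prop)).integrableOn_Icc).mono_set Set.Ioc_subset_Icc_self
    have h2 : X p p' = (Set.Ioi (max (c p.1) (c p'.1))).indicator
        (fun z => osc (freq q t p - freq q t p') z * (Real.exp z : ℂ)) := by
      ext z; simp only [hX, Set.indicator, Set.mem_Ioi]
    rw [h2]
    exact h1.indicator measurableSet_Ioi
  have h_int : ((∫ z in Set.Ioc k (k + 1),
      (∑ j : ZMod q, ‖dualSum t c a I j z‖ ^ 2) * Real.exp z : ℝ) : ℂ) =
      ∑ p ∈ I, ∑ p' ∈ I, (N p p' : ℂ) * (a p * (starRingEnd ℂ) (a p')) *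
        ∫ z in Set.Ioc k (k + 1), X p p' z := by
    rw [← integral_complex_ofReal]
    simp only [hexp]
    rw [integral_finsetSum _ fun p _ =>
      integrable_finsetSum _ fun p' _ => (hXint p p').const_mul _]
    refine Finset.sum_congr rfl (fun p _ => ?_)
    rw [integral_finsetSum _ fun p' _ => (hXint p p').const_mul _]
    exact Finset.sum_congr rfl (fun p' _ => integral_const_mul _ _)
  have hle : ∫ z in Set.Ioc k (k + 1),
      (∑ j : ZMod q, ‖dualSum t c a I j z‖ ^ 2) * Real.exp z ≤
      ∑ p ∈ I, ∑ p' ∈ I, 6 * Real.exp k * Ω ^ 2 * kern q η (p.2 * p'.1) (p'.2 * p.1) := by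
    refine (le_abs_self _).trans ?_
    rw [← Real.norm_eq_abs, ← Complex.norm_real, h_int]
    refine (norm_sum_le _ _).trans (Finset.sum_le_sum fun p hp =>
      (norm_sum_le _ _).trans (Finset.sum_le_sum fun p' hp' => ?_))
    obtain ⟨i1, i2, i3⟩ := hI p hp
    obtain ⟨i1', i2', i3'⟩ := hI p' hp'
    rw [norm_mul, norm_mul, norm_mul, Complex.norm_natCast, RCLike.norm_conj]
    have hc := card_dual_le (q := q) p p'
    unfold kern
    split_ifs at hc ⊢ with hd
    · have hb := norm_integral_pair_le (q := q) ht (max (c p.1) (c p'.1)) i1 i1' i3 i3' hd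
      have a1 := ha p hp
      have a2 := ha p' hp'
      have a3 : (0 : ℝ) ≤ Ω * ((p.1 * |(p.2 : ℝ)|) ^ (1 / 2 + η))⁻¹ := (norm_nonneg _).trans a1
      calc _ ≤ ((p.2 * p'.1).natAbs.gcd q : ℝ) * ((Ω * ((p.1 * |(p.2 : ℝ)|) ^ (1 / 2 + η))⁻¹) *
            (Ω * ((p'.1 * |(p'.2 : ℝ)|) ^ (1 / 2 + η))⁻¹)) *
            (6 * Real.exp k / (1 + |((p.2 * p'.1 : ℤ) : ℝ) - ((p'.2 * p.1 : ℤ) : ℝ)| / q)) := by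
            have hc' : (N p p' : ℝ) ≤ ((p.2 * p'.1).natAbs.gcd q : ℝ) := hc
            refine mul_le_mul (mul_le_mul hc' (mul_le_mul a1 a2 (norm_nonneg _) a3) (by positivity)
              (Nat.cast_nonneg _)) hb (norm_nonneg _) ?_
            exact mul_nonneg (Nat.cast_nonneg _) (mul_nonneg a3 ((norm_nonneg _).trans a2))
        _ = _ := by
            have : ((p.1 * |(p.2 : ℝ)|) ^ (1 / 2 + η))⁻¹ * ((p'.1 * |(p'.2 : ℝ)|) ^ (1 / 2 + η))⁻¹ =
                ((|((p.2 * p'.1 : ℤ) : ℝ)| * |((p'.2 * p.1 : ℤ) : ℝ)|) ^ (1 / 2 + η))⁻¹ := by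
              rw [← mul_inv, ← Real.mul_rpow (by positivity) (by positivity)]
              congr 2
              push_cast
              rw [abs_mul, abs_mul, Nat.abs_cast, Nat.abs_cast]
              ring
            rw [← this]
            ring
    · have : (N p p' : ℝ) = 0 := le_antisymm hc (Nat.cast_nonneg _)
      rw [this]; simp
  refine hle.trans ?_
  simp only [← Finset.mul_sum]
  have := H q (NeZero.ne q) I (fun p hp => ⟨(hI p hp).1, (hI p hp).2.1⟩)
  calc _ ≤ 6 * Real.exp k * Ω ^ 2 * (C * (q : ℝ) ^ η) := by gcongr
    _ = _ := by ring

end LargeSieve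

section Sawtooth

/-- The sawtooth function. -/
noncomputable def saw (t : ℝ) : ℝ := 1 / 2 - Int.fract t

/-- The partial sums of the Fourier series of the sawtooth function. -/
noncomputable def sawPart (N : ℕ) (t : ℝ) : ℝ :=
  ∑ k ∈ Finset.Icc 1 N, Real.sin (2 * Real.pi * k * t) / (Real.pi * k)

theorem continuous_sawPart (N : ℕ) : Continuous (sawPart N) := by
  unfold sawPart; fun_prop

theorem measurable_saw : Measurable saw := measurable_const.sub measurable_fract

theorem integral_cos_two_pi_mul (k : ℤ) :
    ∫ t in (0 : ℝ)..1, Real.cos (2 * Real.pi * k * t) = if k = 0 then 1 else 0 := by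
  split_ifs with hk
  · simp [hk]
  · have hk' : (2 * Real.pi * k : ℝ) ≠ 0 := by
      have : (k : ℝ) ≠ 0 := by exact_mod_cast hk
      have := Real.pi_pos
      positivity
    rw [intervalIntegral.integral_comp_mul_left (fun x => Real.cos x) hk', integral_cos]
    have : Real.sin (2 * Real.pi * k * 1) = 0 := by
      rw [mul_one, show 2 * Real.pi * (k : ℝ) = ((2 * k : ℤ) : ℝ) * Real.pi by push_cast; ring]
      exact Real.sin_int_mul_pi _
    rw [this]; simp

theorem integral_sin_mul_sin {k l : ℕ} (hk : k ≠ 0) :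
    ∫ t in (0 : ℝ)..1, Real.sin (2 * Real.pi * k * t) * Real.sin (2 * Real.pi * l * t) =
      if k = l then 1 / 2 else 0 := by
  have h : ∀ t : ℝ, Real.sin (2 * Real.pi * k * t) * Real.sin (2 * Real.pi * l * t) =
      (1 / 2) * (Real.cos (2 * Real.pi * ((k - l : ℤ) : ℝ) * t) -
        Real.cos (2 * Real.pi * ((k + l : ℤ) : ℝ) * t)) := by
    intro t
    rw [show 2 * Real.pi * ((k - l : ℤ) : ℝ) * t = 2 * Real.pi * k * t - 2 * Real.pi * l * t by
      push_cast; ring, show 2 * Real.pi * ((k + l : ℤ) : ℝ) * t =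
      2 * Real.pi * k * t + 2 * Real.pi * l * t by push_cast; ring, Real.cos_sub, Real.cos_add]
    ring
  simp only [h]
  rw [intervalIntegral.integral_const_mul, intervalIntegral.integral_sub
    ((by fun_prop : Continuous _).intervalIntegrable _ _)
    ((by fun_prop : Continuous _).intervalIntegrable _ _), integral_cos_two_pi_mul,
    integral_cos_two_pi_mul, if_neg (by omega : ¬ (k + l : ℤ) = 0)]
  by_cases hkl : k = l
  · rw [if_pos hkl, if_pos (by omega)]; ring
  · rw [if_neg hkl, if_neg (by omega)]; ring

theorem integral_sub_mul_sin {k : ℕ} (hk : k ≠ 0) :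
    ∫ t in (0 : ℝ)..1, (1 / 2 - t) * Real.sin (2 * Real.pi * k * t) = 1 / (2 * Real.pi * k) := by
  have hk' : (2 * Real.pi * k : ℝ) ≠ 0 := by
    have := Real.pi_pos
    positivity
  have hd : ∀ t ∈ Set.uIcc (0 : ℝ) 1, HasDerivAt (fun t =>
      -((1 / 2 - t) * Real.cos (2 * Real.pi * k * t)) / (2 * Real.pi * k) -
        Real.sin (2 * Real.pi * k * t) / (2 * Real.pi * k) ^ 2)
      ((1 / 2 - t) * Real.sin (2 * Real.pi * k * t)) t := by
    intro t _
    have h0 : HasDerivAt (fun t : ℝ => 2 * Real.pi * k * t) (2 * Real.pi * k) t := by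
      simpa using (hasDerivAt_id t).const_mul (2 * Real.pi * k)
    have h1 : HasDerivAt (fun t : ℝ => 1 / 2 - t) (-1) t :=
      (hasDerivAt_id t).const_sub (1 / 2)
    refine (((h1.mul h0.cos).neg.div_const _).sub (h0.sin.div_const _)).congr_deriv ?_
    field_simp
    ring
  rw [intervalIntegral.integral_eq_sub_of_hasDerivAt hd
    ((by fun_prop : Continuous _).intervalIntegrable _ _)]
  have h1 : Real.cos (2 * Real.pi * k) = 1 := by
    rw [mul_comm]; exact Real.cos_nat_mul_two_pi k
  have h2 : Real.sin (2 * Real.pi * k) = 0 := by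
    rw [show 2 * Real.pi * (k : ℝ) = ((2 * k : ℕ) : ℝ) * Real.pi by push_cast; ring]
    exact Real.sin_nat_mul_pi _
  rw [mul_one, h1, h2]
  simp only [mul_zero, Real.cos_zero, Real.sin_zero]
  field_simp
  ring

theorem integral_sub_sawPart_sq (N : ℕ) :
    ∫ t in (0 : ℝ)..1, (1 / 2 - t - sawPart N t) ^ 2 =
      1 / 12 - ∑ k ∈ Finset.Icc 1 N, 1 / (2 * Real.pi ^ 2) * (1 / (k : ℝ) ^ 2) := by
  induction N with
  | zero =>
    simp only [sawPart, Finset.Icc_eq_empty (by norm_num : ¬ 1 ≤ 0), Finset.sum_empty, sub_zero]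
    rw [intervalIntegral.integral_comp_sub_left (fun x => x ^ 2) (1 / 2 : ℝ), integral_pow]
    norm_num
  | succ N ih =>
    have hN : N + 1 ≠ 0 := N.succ_ne_zero
    have hpi := Real.pi_pos
    have hs : ∀ t, sawPart (N + 1) t = sawPart N t +
        Real.sin (2 * Real.pi * (N + 1 : ℕ) * t) / (Real.pi * (N + 1 : ℕ)) := fun t => by
      rw [sawPart, Finset.sum_Icc_succ_top (by omega), sawPart]
    have ho : ∫ t in (0 : ℝ)..1, sawPart N t * Real.sin (2 * Real.pi * (N + 1 : ℕ) * t) = 0 := by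
      simp only [sawPart, Finset.sum_mul]
      rw [intervalIntegral.integral_finsetSum
        fun k _ => ((by fun_prop : Continuous _).intervalIntegrable _ _)]
      refine Finset.sum_eq_zero fun k hk => ?_
      rw [Finset.mem_Icc] at hk
      simp only [div_mul_eq_mul_div]
      rw [intervalIntegral.integral_div, integral_sin_mul_sin (by omega), if_neg (by omega),
        zero_div]
    have hc := continuous_sawPart N
    have hexp : ∀ t, (1 / 2 - t - sawPart (N + 1) t) ^ 2 = (1 / 2 - t - sawPart N t) ^ 2 -
        2 / (Real.pi * (N + 1 : ℕ)) * ((1 / 2 - t) * Real.sin (2 * Real.pi * (N + 1 : ℕ) * t)) +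
        2 / (Real.pi * (N + 1 : ℕ)) * (sawPart N t * Real.sin (2 * Real.pi * (N + 1 : ℕ) * t)) +
        1 / (Real.pi * (N + 1 : ℕ)) ^ 2 * (Real.sin (2 * Real.pi * (N + 1 : ℕ) * t) *
          Real.sin (2 * Real.pi * (N + 1 : ℕ) * t)) := fun t => by rw [hs]; ring
    simp only [hexp]
    have i1 : IntervalIntegrable (fun t => (1 / 2 - t - sawPart N t) ^ 2) volume 0 1 :=
      (by fun_prop : Continuous _).intervalIntegrable _ _
    have i2 : IntervalIntegrable (fun t => 2 / (Real.pi * (N + 1 : ℕ)) *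
      ((1 / 2 - t) * Real.sin (2 * Real.pi * (N + 1 : ℕ) * t))) volume 0 1 :=
      (by fun_prop : Continuous _).intervalIntegrable _ _
    have i3 : IntervalIntegrable (fun t => 2 / (Real.pi * (N + 1 : ℕ)) *
      (sawPart N t * Real.sin (2 * Real.pi * (N + 1 : ℕ) * t))) volume 0 1 :=
      (by fun_prop : Continuous _).intervalIntegrable _ _
    have i4 : IntervalIntegrable (fun t => 1 / (Real.pi * (N + 1 : ℕ)) ^ 2 *
      (Real.sin (2 * Real.pi * (N + 1 : ℕ) * t) *
          Real.sin (2 * Real.pi * (N + 1 : ℕ) * t))) volume 0 1 :=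
      (by fun_prop : Continuous _).intervalIntegrable _ _
    rw [intervalIntegral.integral_add ((i1.sub i2).add i3) i4,
      intervalIntegral.integral_add (i1.sub i2) i3, intervalIntegral.integral_sub i1 i2,
      intervalIntegral.integral_const_mul, intervalIntegral.integral_const_mul,
      intervalIntegral.integral_const_mul, ho, ih, integral_sub_mul_sin hN,
      integral_sin_mul_sin hN, if_pos rfl, Finset.sum_Icc_succ_top (by omega)]
    have : ((N + 1 : ℕ) : ℝ) ≠ 0 := by positivity
    field_simp
    ring

theorem tendsto_integral_sub_sawPart_sq :
    Filter.Tendsto (fun N => ∫ t in (0 : ℝ)..1, (1 / 2 - t - sawPart N t) ^ 2) Filter.atTop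
      (nhds 0) := by
  simp only [integral_sub_sawPart_sq, ← Finset.mul_sum]
  have h1 := hasSum_zeta_two.tendsto_sum_nat
  have h2 : ∀ N : ℕ, ∑ k ∈ Finset.Icc 1 N, 1 / (k : ℝ) ^ 2 =
      ∑ k ∈ Finset.range (N + 1), 1 / (k : ℝ) ^ 2 := fun N => by
    rw [Finset.sum_range_succ', Finset.range_eq_Ico, Finset.sum_Ico_add' (fun k : ℕ => 1 / (k : ℝ) ^ 2),
      ← Finset.Ico_succ_right_eq_Icc]
    simp
  simp only [h2]
  have h3 := ((h1.comp (Filter.tendsto_add_atTop_nat 1)).const_mul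
    (1 / (2 * Real.pi ^ 2))).const_sub (1 / 12)
  rwa [show 1 / 12 - 1 / (2 * Real.pi ^ 2) * (Real.pi ^ 2 / 6) = 0 by
    have := Real.pi_ne_zero
    field_simp
    norm_num] at h3

/-- The error of the truncated Fourier series of the sawtooth function. -/
noncomputable def sawErr (N : ℕ) (t : ℝ) : ℝ := saw t - sawPart N t

theorem measurable_sawErr (N : ℕ) : Measurable (sawErr N) :=
  measurable_saw.sub (continuous_sawPart N).measurable

theorem sawErr_add_intCast (N : ℕ) (t : ℝ) (n : ℤ) : sawErr N (t + n) = sawErr N t := by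
  rw [sawErr, sawErr, saw, saw, Int.fract_add_intCast, sawPart, sawPart]
  congr 1
  refine Finset.sum_congr rfl fun k _ => ?_
  rw [show 2 * Real.pi * k * (t + n) = 2 * Real.pi * k * t + ((k * n : ℤ) : ℝ) * (2 * Real.pi) by
    push_cast; ring, Real.sin_add_int_mul_two_pi]

theorem lintegral_sawErr_sq (N : ℕ) (n : ℤ) :
    ∫⁻ t in Set.Ioc (n : ℝ) (n + 1), ENNReal.ofReal (sawErr N t ^ 2) =
      ENNReal.ofReal (∫ t in (0 : ℝ)..1, (1 / 2 - t - sawPart N t) ^ 2) := by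
  have h0 : ∫⁻ t in Set.Ioc (n : ℝ) (n + 1), ENNReal.ofReal (sawErr N t ^ 2) =
      ∫⁻ t in Set.Ioc (0 : ℝ) 1, ENNReal.ofReal (sawErr N t ^ 2) := by
    rw [← lintegral_indicator measurableSet_Ioc, ← lintegral_indicator measurableSet_Ioc,
      ← lintegral_add_right_eq_self _ (n : ℝ)]
    refine lintegral_congr fun t => ?_
    simp only [Set.indicator, Set.mem_Ioc, sawErr_add_intCast]
    have : ((n : ℝ) < t + n ∧ t + n ≤ n + 1) ↔ (0 < t ∧ t ≤ 1) := by
      constructor <;> rintro ⟨h1, h2⟩ <;> constructor <;> linarith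
    simp only [this]
  have hc := continuous_sawPart N
  rw [h0, intervalIntegral.integral_of_le zero_le_one, ofReal_integral_eq_lintegral_ofReal
    ((by fun_prop : Continuous _).integrableOn_Icc.mono_set Set.Ioc_subset_Icc_self)
    (Filter.Eventually.of_forall fun t => sq_nonneg _), ← restrict_Ioo_eq_restrict_Ioc]
  refine setLIntegral_congr_fun measurableSet_Ioo fun t ht => ?_
  simp only [sawErr, saw]
  rw [Int.fract_eq_self.2 ⟨ht.1.le, ht.2⟩]

theorem tendsto_lintegral_sawErr_sq {α Q : ℝ} (hα : 0 < α) (hQ : 0 < Q) (v k : ℝ) :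
    Filter.Tendsto (fun N => ∫⁻ z in Set.Ioc k (k + 1),
      ENNReal.ofReal (sawErr N ((α * Real.exp z - v) / Q) ^ 2) * ENNReal.ofReal (Real.exp z))
      Filter.atTop (nhds 0) := by
  set φ : ℝ → ℝ := fun z => (α * Real.exp z - v) / Q with hφ
  set A : ℤ := ⌊φ k⌋ with hA
  set m : ℕ := ⌈φ (k + 1) - A⌉₊ with hm
  have hd : ∀ z, HasDerivAt φ (α * Real.exp z / Q) z := fun z =>
    (((Real.hasDerivAt_exp z).const_mul α).sub_const v).div_const Q
  have hmono : StrictMono φ := fun a b hab => by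
    simp only [hφ]
    gcongr
  have hle : ∀ N, ∫⁻ z in Set.Ioc k (k + 1),
      ENNReal.ofReal (sawErr N (φ z) ^ 2) * ENNReal.ofReal (Real.exp z) ≤
      ENNReal.ofReal (Q / α) * (m * ENNReal.ofReal (∫ t in (0 : ℝ)..1,
        (1 / 2 - t - sawPart N t) ^ 2)) := by
    intro N
    have h1 : ∫⁻ z in Set.Ioc k (k + 1),
        ENNReal.ofReal (sawErr N (φ z) ^ 2) * ENNReal.ofReal (Real.exp z) =
        ENNReal.ofReal (Q / α) * ∫⁻ t in φ '' Set.Ioc k (k + 1), ENNReal.ofReal (sawErr N t ^ 2) := by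
      rw [lintegral_image_eq_lintegral_abs_deriv_mul measurableSet_Ioc
        (fun z _ => (hd z).hasDerivWithinAt) hmono.injective.injOn,
        ← lintegral_const_mul' _ _ ENNReal.ofReal_ne_top]
      refine lintegral_congr fun z => ?_
      rw [← mul_assoc, abs_of_pos (by positivity), ← ENNReal.ofReal_mul (p := Q / α) (by positivity),
        mul_comm, show Q / α * (α * Real.exp z / Q) = Real.exp z by field_simp]
    rw [h1]
    gcongr
    have hsub : φ '' Set.Ioc k (k + 1) ⊆
        ⋃ i : Fin m, Set.Ioc ((A + (i : ℕ) : ℤ) : ℝ) ((A + (i : ℕ) : ℤ) + 1) := by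
      rintro _ ⟨z, hz, rfl⟩
      have g1 : (A : ℝ) < φ z := (Int.floor_le _).trans_lt (hmono hz.1)
      have g2 : φ z - A ≤ m := by
        have : φ z ≤ φ (k + 1) := hmono.monotone hz.2
        have := Nat.le_ceil (φ (k + 1) - A)
        linarith
      have g3 : (0 : ℝ) < φ z - A := by linarith
      have g4 : 0 < ⌈φ z - A⌉₊ := Nat.ceil_pos.2 g3
      simp only [Set.mem_iUnion]
      refine ⟨⟨⌈φ z - A⌉₊ - 1, ?_⟩, ?_⟩
      · have := Nat.ceil_le.2 g2
        omega
      · have h5 := Nat.le_ceil (φ z - A)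
        have h6 := Nat.ceil_lt_add_one g3.le
        have h7 : ((⌈φ z - A⌉₊ - 1 : ℕ) : ℝ) = (⌈φ z - A⌉₊ : ℝ) - 1 := by
          rw [Nat.cast_sub g4]; simp
        constructor <;> push_cast [h7] <;> linarith
    refine (lintegral_mono_set hsub).trans ((lintegral_iUnion_le _ _).trans ?_)
    simp only [lintegral_sawErr_sq, tsum_fintype, Finset.sum_const, Finset.card_univ,
      Fintype.card_fin, nsmul_eq_mul, le_refl]
  refine tendsto_of_tendsto_of_tendsto_of_le_of_le tendsto_const_nhds ?_ (fun _ => zero_le) hle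
  have h2 := ENNReal.tendsto_ofReal tendsto_integral_sub_sawPart_sq
  rw [ENNReal.ofReal_zero] at h2
  have h3 := ENNReal.Tendsto.const_mul (a := ENNReal.ofReal (Q / α))
    (ENNReal.Tendsto.const_mul (a := (m : ENNReal)) h2 (Or.inr (ENNReal.natCast_ne_top m)))
    (Or.inr ENNReal.ofReal_ne_top)
  simpa using h3

end Sawtooth

section Energy

theorem enorm_ofReal_sq (x : ℝ) : ‖(x : ℂ)‖ₑ ^ 2 = ENNReal.ofReal (x ^ 2) := by
  rw [← ofReal_norm, ← ENNReal.ofReal_pow (norm_nonneg _), Complex.norm_real,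
    Real.norm_eq_abs, sq_abs]

theorem enorm_sum_sq_le {κ : Type*} (s : Finset κ) (f : κ → ℂ) :
    ‖∑ i ∈ s, f i‖ₑ ^ 2 ≤ s.card * ∑ i ∈ s, ‖f i‖ₑ ^ 2 := by
  have h : ‖∑ i ∈ s, f i‖ ^ 2 ≤ s.card * ∑ i ∈ s, ‖f i‖ ^ 2 :=
    (pow_le_pow_left₀ (norm_nonneg _) (norm_sum_le _ _) 2).trans sq_sum_le_card_mul_sum_sq
  have h' := ENNReal.ofReal_le_ofReal h
  rw [ENNReal.ofReal_mul (by positivity), ENNReal.ofReal_sum_of_nonneg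
    (fun _ _ => by positivity), ENNReal.ofReal_natCast] at h'
  simpa only [ENNReal.ofReal_pow (norm_nonneg _), ofReal_norm] using h'

theorem enorm_add_sq_le (a b : ℂ) : ‖a + b‖ₑ ^ 2 ≤ 2 * (‖a‖ₑ ^ 2 + ‖b‖ₑ ^ 2) := by
  simpa [Fin.sum_univ_two] using enorm_sum_sq_le Finset.univ ![a, b]

theorem enorm_sub_sq_le (a b : ℂ) : ‖a - b‖ₑ ^ 2 ≤ 2 * (‖a‖ₑ ^ 2 + ‖b‖ₑ ^ 2) := by
  simpa [sub_eq_add_neg] using enorm_add_sq_le a (-b)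

theorem sq_lintegral_le {α : Type*} [MeasurableSpace α] (μ : Measure α) {f : α → ENNReal}
    (hf : AEMeasurable f μ) : (∫⁻ x, f x ∂μ) ^ 2 ≤ μ Set.univ * ∫⁻ x, f x ^ 2 ∂μ := by
  have h := ENNReal.lintegral_mul_le_Lp_mul_Lq μ Real.HolderConjugate.two_two hf
    (aemeasurable_const (b := (1 : ENNReal)))
  simp only [Pi.mul_apply, mul_one, ENNReal.one_rpow, lintegral_one] at h
  have h2 := pow_le_pow_left₀ zero_le h 2
  rw [mul_pow, ← ENNReal.rpow_natCast (_ ^ _), ← ENNReal.rpow_natCast (_ ^ _), ← ENNReal.rpow_mul,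
    ← ENNReal.rpow_mul] at h2
  norm_num at h2
  rwa [mul_comm]

theorem enorm_integral_sq_le {α : Type*} [MeasurableSpace α] (μ : Measure α) {f : α → ℂ}
    (hf : AEMeasurable f μ) : ‖∫ x, f x ∂μ‖ₑ ^ 2 ≤ μ Set.univ * ∫⁻ x, ‖f x‖ₑ ^ 2 ∂μ :=
  (pow_le_pow_left₀ zero_le (enorm_integral_le_lintegral_enorm _) 2).trans
    (sq_lintegral_le μ hf.enorm)

variable {ι : Type*} [Fintype ι]

/-- The total squared `L²` norm of a finite family of functions. -/
noncomputable def energy (μ : Measure ℝ) (Φ : ι → ℝ → ℂ) : ENNReal :=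
  ∫⁻ z, ∑ j, ‖Φ j z‖ₑ ^ 2 ∂μ

theorem energy_congr {μ : Measure ℝ} {Φ Ψ : ι → ℝ → ℂ} (h : ∀ᵐ z ∂μ, ∀ j, Φ j z = Ψ j z) :
    energy μ Φ = energy μ Ψ :=
  lintegral_congr_ae (h.mono fun z hz => by simp only [hz])

theorem energy_add_le (μ : Measure ℝ) {Φ : ι → ℝ → ℂ} (hΦ : ∀ j, Measurable (Φ j))
    (Ψ : ι → ℝ → ℂ) : energy μ (fun j z => Φ j z + Ψ j z) ≤ 2 * (energy μ Φ + energy μ Ψ) := by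
  unfold energy
  rw [← lintegral_add_left (Finset.measurable_fun_sum _ fun j _ => (hΦ j).enorm.pow_const 2),
    ← lintegral_const_mul' _ _ (by norm_num)]
  refine lintegral_mono fun z => ?_
  simp only
  rw [← Finset.sum_add_distrib, Finset.mul_sum]
  exact Finset.sum_le_sum fun j _ => enorm_add_sq_le _ _

theorem energy_sub_le (μ : Measure ℝ) {Φ : ι → ℝ → ℂ} (hΦ : ∀ j, Measurable (Φ j))
    (Ψ : ι → ℝ → ℂ) : energy μ (fun j z => Φ j z - Ψ j z) ≤ 2 * (energy μ Φ + energy μ Ψ) := by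
  simpa [sub_eq_add_neg, energy] using energy_add_le μ hΦ (fun j z => - Ψ j z)

theorem energy_mul_le (μ : Measure ℝ) (Φ : ι → ℝ → ℂ) {g : ℝ → ℂ} {B : ℝ}
    (hg : ∀ᵐ z ∂μ, ‖g z‖ ≤ B) :
    energy μ (fun j z => g z * Φ j z) ≤ ENNReal.ofReal (B ^ 2) * energy μ Φ := by
  unfold energy
  rw [← lintegral_const_mul' _ _ ENNReal.ofReal_ne_top]
  refine lintegral_mono_ae (hg.mono fun z hz => ?_)
  rw [Finset.mul_sum]
  refine Finset.sum_le_sum fun j _ => ?_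
  rw [enorm_mul, mul_pow]
  gcongr
  rw [← ofReal_norm, ← ENNReal.ofReal_pow (norm_nonneg _)]
  exact ENNReal.ofReal_le_ofReal (by gcongr)

theorem energy_integral_le (μ : Measure ℝ) [SFinite μ] (S : Set ℝ) {F : ℝ → ι → ℝ → ℂ}
    (hF : ∀ j, Measurable fun p : ℝ × ℝ => F p.1 j p.2) :
    energy μ (fun j z => ∫ τ in S, F τ j z) ≤
      volume S * ∫⁻ τ in S, energy μ (F τ) := by
  unfold energy
  have hm : Measurable fun p : ℝ × ℝ => ∑ j, ‖F p.1 j p.2‖ₑ ^ 2 :=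
    Finset.measurable_fun_sum _ fun j _ => (hF j).enorm.pow_const 2
  have hm' : Measurable fun z => ∫⁻ τ in S, ∑ j, ‖F τ j z‖ₑ ^ 2 := hm.lintegral_prod_left'
  rw [lintegral_lintegral_swap hm.aemeasurable, ← lintegral_const_mul _ hm']
  refine lintegral_mono fun z => ?_
  simp only
  have hz : ∀ j, Measurable fun τ => F τ j z := fun j =>
    (hF j).comp (measurable_id.prodMk measurable_const)
  rw [lintegral_finsetSum _ fun j _ => (hz j).enorm.pow_const 2, Finset.mul_sum]
  refine Finset.sum_le_sum fun j _ => ?_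
  have := enorm_integral_sq_le (volume.restrict S) (hz j).aemeasurable
  rwa [Measure.restrict_apply_univ] at this

/-- The measure `exp z dz` on the window `(k, k + 1]`. -/
noncomputable def window (k : ℝ) : Measure ℝ :=
  (volume.restrict (Set.Ioc k (k + 1))).withDensity fun z => ENNReal.ofReal (Real.exp z)

instance (k : ℝ) : SFinite (window k) := by unfold window; infer_instance

theorem lintegral_window (k : ℝ) {f : ℝ → ENNReal} (hf : Measurable f) :
    ∫⁻ z, f z ∂(window k) =
      ∫⁻ z in Set.Ioc k (k + 1), f z * ENNReal.ofReal (Real.exp z) := by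
  rw [window, lintegral_withDensity_eq_lintegral_mul _ (by fun_prop) hf]
  simp only [Pi.mul_apply, mul_comm]

theorem ae_window {k : ℝ} {P : ℝ → Prop} (h : ∀ z, k < z → z ≤ k + 1 → P z) :
    ∀ᵐ z ∂(window k), P z :=
  (withDensity_absolutelyContinuous _ _).ae_le
    ((ae_restrict_mem measurableSet_Ioc).mono fun z hz => h z hz.1 hz.2)

theorem energy_window_eq (k : ℝ) {Φ : ι → ℝ → ℂ} (hΦ : ∀ j, Measurable (Φ j)) :
    energy (window k) Φ = ∫⁻ z in Set.Ioc k (k + 1),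
      ENNReal.ofReal ((∑ j, ‖Φ j z‖ ^ 2) * Real.exp z) := by
  rw [energy, lintegral_window k (Finset.measurable_fun_sum _ fun j _ => (hΦ j).enorm.pow_const 2)]
  refine lintegral_congr fun z => ?_
  rw [ENNReal.ofReal_mul (by positivity), ENNReal.ofReal_sum_of_nonneg fun _ _ => by positivity]
  simp only [ENNReal.ofReal_pow (norm_nonneg _), ofReal_norm]

end Energy

section DualEnergy

theorem norm_dualSum_le {q : ℕ} (t : ℝ) (c : ℕ → ℝ) (a : ℕ × ℤ → ℂ) (I : Finset (ℕ × ℤ))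
    (j : ZMod q) (z : ℝ) : ‖dualSum t c a I j z‖ ≤ ∑ p ∈ I, ‖a p‖ := by
  refine (norm_sum_le _ _).trans (Finset.sum_le_sum fun p _ => ?_)
  split_ifs
  · rw [norm_mul, norm_osc, mul_one]
  · simp
  · simp

theorem exists_energy_dualSum_le {η : ℝ} (hη : 0 < η) : ∃ C : ℝ, 1 ≤ C ∧ ∀ (q : ℕ) [NeZero q]
    (k t : ℝ) (c : ℕ → ℝ) (a : ℕ × ℤ → ℂ) (I : Finset (ℕ × ℤ)) (Ω : ℝ), 1 ≤ t →
    (∀ p ∈ I, p.1 ≠ 0 ∧ p.2 ≠ 0 ∧ (p.1 : ℝ) ^ 2 ≤ 9 * Real.exp k) →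
    (∀ p ∈ I, ‖a p‖ ≤ Ω * ((p.1 * |(p.2 : ℝ)|) ^ (1 / 2 + η))⁻¹) →
      energy (window k) (dualSum (q := q) t c a I) ≤
        ENNReal.ofReal (C * (q : ℝ) ^ η * Ω ^ 2 * Real.exp k) := by
  obtain ⟨C, hC, H⟩ := exists_largeSieve hη
  refine ⟨C, hC, fun q _ k t c a I Ω ht hI ha => ?_⟩
  rw [energy_window_eq k fun j => measurable_dualSum t c a I j, ← ofReal_integral_eq_lintegral_ofReal]
  · exact ENNReal.ofReal_le_ofReal (H q k t c a I Ω ht hI ha)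
  · refine Measure.integrableOn_of_bounded (M := (∑ _j : ZMod q, (∑ p ∈ I, ‖a p‖) ^ 2) *
      Real.exp (k + 1)) (by simp) ?_ ?_
    · exact ((Finset.measurable_fun_sum _ fun j _ =>
        (measurable_dualSum t c a I j).norm.pow_const 2).mul
          Real.measurable_exp).aestronglyMeasurable
    · refine (ae_restrict_mem measurableSet_Ioc).mono fun z hz => ?_
      rw [Real.norm_eq_abs, abs_of_nonneg (by positivity)]
      gcongr
      · exact norm_dualSum_le _ _ _ _ _ _
      · exact hz.2
  · exact Filter.Eventually.of_forall fun z => by positivity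

end DualEnergy

section SawExpansion

/-- The nonzero integers of absolute value at most `N`. -/
noncomputable def punctured (N : ℕ) : Finset ℤ := (Finset.Icc (-(N : ℤ)) N).erase 0

theorem sum_punctured (N : ℕ) (g : ℤ → ℂ) :
    ∑ κ ∈ punctured N, g κ = ∑ k ∈ Finset.Icc 1 N, (g k + g (-k)) := by
  induction N with
  | zero => simp [punctured]
  | succ N ih =>
    have h : punctured (N + 1) = insert ((N : ℤ) + 1) (insert (-((N : ℤ) + 1)) (punctured N)) := by
      ext κ
      simp only [punctured, Finset.mem_erase, Finset.mem_Icc, Finset.mem_insert]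
      push_cast
      omega
    have h1 : -((N : ℤ) + 1) ∉ punctured N := by
      simp only [punctured, Finset.mem_erase, Finset.mem_Icc]; omega
    have h2 : ((N : ℤ) + 1) ∉ insert (-((N : ℤ) + 1)) (punctured N) := by
      simp only [punctured, Finset.mem_insert, Finset.mem_erase, Finset.mem_Icc]; omega
    rw [h, Finset.sum_insert h2, Finset.sum_insert h1, ih, Finset.sum_Icc_succ_top (by omega)]
    push_cast
    ring

theorem sawPart_eq (N : ℕ) (t : ℝ) : (sawPart N t : ℂ) = ∑ κ ∈ punctured N,
    Complex.exp (Complex.I * ((2 * Real.pi * κ * t : ℝ) : ℂ)) / (2 * Real.pi * Complex.I * κ) := by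
  rw [sum_punctured, sawPart, Complex.ofReal_sum]
  refine Finset.sum_congr rfl fun k hk => ?_
  have hk0 : (k : ℂ) ≠ 0 := by
    rw [Finset.mem_Icc] at hk
    exact Nat.cast_ne_zero.2 (by omega)
  have hpi : (Real.pi : ℂ) ≠ 0 := Complex.ofReal_ne_zero.2 Real.pi_ne_zero
  rw [Complex.ofReal_div, Complex.ofReal_sin, Complex.sin]
  push_cast
  rw [show Complex.I * (2 * Real.pi * k * t) = 2 * Real.pi * k * t * Complex.I by ring,
    show Complex.I * (2 * Real.pi * -k * t) = -(2 * Real.pi * k * t) * Complex.I by ring]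
  field_simp
  rw [Complex.I_sq]
  ring

variable {q : ℕ} [NeZero q]

theorem χ_intCast (k : ℤ) :
    χ (k : ZMod q) = Complex.exp (Complex.I * ((2 * Real.pi * k / q : ℝ) : ℂ)) := by
  rw [χ, ZMod.stdAddChar_coe]
  congr 1
  push_cast
  ring

theorem sum_χ_sawPart (N : ℕ) (c : ZMod q) (y : ℝ) :
    ∑ r : ZMod q, χ (c * r) * (sawPart N ((Real.exp y - r.val) / q) : ℂ) = ∑ κ ∈ punctured N,
      if (κ : ZMod q) = c then q / (2 * Real.pi * Complex.I * κ) * osc (2 * Real.pi * κ / q) y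
      else 0 := by
  simp only [sawPart_eq, Finset.mul_sum]
  rw [Finset.sum_comm]
  refine Finset.sum_congr rfl fun κ _ => ?_
  have h : ∀ r : ZMod q, χ (c * r) *
      (Complex.exp (Complex.I * ((2 * Real.pi * κ * ((Real.exp y - r.val) / q) : ℝ) : ℂ)) /
        (2 * Real.pi * Complex.I * κ)) =
      χ (r * (c - (κ : ZMod q))) *
        (osc (2 * Real.pi * κ / q) y / (2 * Real.pi * Complex.I * κ)) := by
    intro r
    have h1 : χ (r * (c - (κ : ZMod q))) = χ (c * r) * χ (((-κ * r.val : ℤ) : ZMod q)) := by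
      rw [← χ_add]
      congr 1
      push_cast
      rw [ZMod.natCast_zmod_val]
      ring
    rw [h1, χ_intCast, mul_assoc (χ (c * r)), osc, ← mul_div_assoc (Complex.exp _),
      ← Complex.exp_add]
    congr 3
    push_cast
    ring
  simp only [h]
  rw [← Finset.sum_mul, sum_χ_mul]
  by_cases hc : (κ : ZMod q) = c
  · rw [if_pos hc, if_pos (by rw [hc, sub_self])]; ring
  · rw [if_neg hc, if_neg (fun h0 => hc (sub_eq_zero.1 h0).symm), zero_mul]

/-- The additive Fourier transform of the step discrepancies. -/
noncomputable def chiStep (h : ℝ) (c : ZMod q) (y : ℝ) : ℂ := ∑ r : ZMod q, χ (c * r) * (step h r y : ℂ)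

theorem measurable_chiStep (h : ℝ) (c : ZMod q) : Measurable (chiStep h c) :=
  Finset.measurable_fun_sum _ fun r _ =>
    measurable_const.mul (Complex.measurable_ofReal.comp (measurable_step h r))

theorem chiStep_eq (N : ℕ) (h : ℝ) (c : ZMod q) (y : ℝ) : chiStep h c y =
    (∑ κ ∈ punctured N, if (κ : ZMod q) = c then q / (2 * Real.pi * Complex.I * κ) *
      (osc (2 * Real.pi * κ / q) (y + h) - osc (2 * Real.pi * κ / q) y) else 0) +
    ∑ r : ZMod q, χ (c * r) * ((sawErr N ((Real.exp (y + h) - r.val) / q) -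
      sawErr N ((Real.exp y - r.val) / q) : ℝ) : ℂ) := by
  have h1 : ∀ r : ZMod q, χ (c * r) * (step h r y : ℂ) =
      χ (c * r) * (sawPart N ((Real.exp (y + h) - r.val) / q) : ℂ) -
      χ (c * r) * (sawPart N ((Real.exp y - r.val) / q) : ℂ) +
      χ (c * r) * ((sawErr N ((Real.exp (y + h) - r.val) / q) -
        sawErr N ((Real.exp y - r.val) / q) : ℝ) : ℂ) := by
    intro r
    rw [step_eq_fract, sawErr, sawErr, saw, saw]
    push_cast
    ring
  rw [chiStep, Finset.sum_congr rfl fun r _ => h1 r, Finset.sum_add_distrib,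
    Finset.sum_sub_distrib, sum_χ_sawPart, sum_χ_sawPart, ← Finset.sum_sub_distrib]
  congr 1
  refine Finset.sum_congr rfl fun κ _ => ?_
  split_ifs
  · ring
  · ring

theorem osc_sub_log {n : ℕ} (hn : n ≠ 0) (κ : ℤ) (t z : ℝ) (ht : 0 < t) :
    osc (2 * Real.pi * κ / q) (z - Real.log n + Real.log t) = osc (freq q t (n, κ)) z := by
  have hn' : (0 : ℝ) < n := by exact_mod_cast Nat.pos_of_ne_zero hn
  have hq : (0 : ℝ) < q := q_pos
  rw [osc, osc, freq, Real.exp_add, Real.exp_sub, Real.exp_log hn', Real.exp_log ht]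
  congr 3
  field_simp

end SawExpansion

section Hyper

variable {q : ℕ} [NeZero q]

theorem dualSum_sub {Λ : ℝ} (hΛ : 1 ≤ Λ) (c : ℕ → ℝ) {I : Finset (ℕ × ℤ)}
    (hI : ∀ p ∈ I, p.1 ≠ 0 ∧ p.2 ≠ 0) (j : ZMod q) (z : ℝ) :
    dualSum Λ c (fun p => q / (2 * Real.pi * Complex.I * p.2)) I j z -
      dualSum 1 c (fun p => q / (2 * Real.pi * Complex.I * p.2)) I j z =
    Real.exp z * ∫ t in Set.Ioc 1 Λ, dualSum t c (fun p => 1 / p.1) I j z := by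
  have hc : ∀ p : ℕ × ℤ, Continuous fun t => osc (freq q t p) z := fun p => by
    unfold osc freq; fun_prop
  have h_int : ∀ p : ℕ × ℤ, IntegrableOn (fun t => if (p.2 : ZMod q) = j * (p.1 : ZMod q) then
      (if c p.1 < z then 1 / (p.1 : ℂ) * osc (freq q t p) z else 0) else 0) (Set.Ioc 1 Λ) := by
    intro p
    have := hc p
    refine Continuous.integrableOn_Ioc ?_
    split_ifs <;> fun_prop
  unfold dualSum
  rw [← Finset.sum_sub_distrib, integral_finsetSum _ fun p _ => h_int p, Finset.mul_sum]
  refine Finset.sum_congr rfl fun p hp => ?_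
  split_ifs with h1 h2
  · rw [← intervalIntegral.integral_of_le hΛ, intervalIntegral.integral_const_mul]
    have m0 : (p.1 : ℂ) ≠ 0 := Nat.cast_ne_zero.2 (hI p hp).1
    have k0 : (p.2 : ℂ) ≠ 0 := Int.cast_ne_zero.2 (hI p hp).2
    have q0 : (q : ℂ) ≠ 0 := Nat.cast_ne_zero.2 (NeZero.ne q)
    have e0 : (Real.exp z : ℂ) ≠ 0 := Complex.ofReal_ne_zero.2 (Real.exp_ne_zero z)
    have hpi : (Real.pi : ℂ) ≠ 0 := Complex.ofReal_ne_zero.2 Real.pi_ne_zero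
    set b : ℂ := Complex.I * (2 * Real.pi * p.2 / (q * p.1) * Real.exp z) with hb
    have hb0 : b ≠ 0 := by
      simp only [hb, ne_eq, mul_eq_zero, div_eq_zero_iff, Complex.I_ne_zero, OfNat.ofNat_ne_zero,
        hpi, k0, q0, m0, e0, or_self, not_false_eq_true]
    have ho : ∀ t : ℝ, osc (freq q t p) z = Complex.exp (b * t) := fun t => by
      rw [osc, freq, hb]; congr 1; push_cast; ring
    simp only [ho]
    rw [integral_exp_mul_complex hb0, hb]
    field_simp
  · simp
  · simp

/-- The hyperbola sum attached to the cutoff `2 log n - τ < z`. -/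
noncomputable def hyperSum (M : ℕ) (h τ : ℝ) (j : ZMod q) (z : ℝ) : ℂ :=
  ∑ n ∈ Finset.Icc 1 M, if 2 * Real.log n - τ < z then chiStep h (j * (n : ZMod q))
    (z - Real.log n) else 0

/-- The error made by truncating the Fourier expansion in `hyperSum`. -/
noncomputable def hyperErr (N M : ℕ) (h τ : ℝ) (j : ZMod q) (z : ℝ) : ℂ :=
  ∑ p ∈ Finset.Icc 1 M ×ˢ (Finset.univ : Finset (ZMod q)), if 2 * Real.log p.1 - τ < z then
    χ (j * (p.1 : ZMod q) * p.2) * ((sawErr N ((Real.exp h / p.1 * Real.exp z - p.2.val) / q) -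
      sawErr N ((1 / p.1 * Real.exp z - p.2.val) / q) : ℝ) : ℂ) else 0

theorem hyperSum_eq (N M : ℕ) (h τ : ℝ) (j : ZMod q) (z : ℝ) : hyperSum M h τ j z =
    (dualSum (Real.exp h) (fun n => 2 * Real.log n - τ)
      (fun p => q / (2 * Real.pi * Complex.I * p.2)) (Finset.Icc 1 M ×ˢ punctured N) j z -
    dualSum 1 (fun n => 2 * Real.log n - τ)
      (fun p => q / (2 * Real.pi * Complex.I * p.2)) (Finset.Icc 1 M ×ˢ punctured N) j z) +
    hyperErr N M h τ j z := by
  rw [hyperSum, dualSum, dualSum, hyperErr, Finset.sum_product, Finset.sum_product,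
    Finset.sum_product, ← Finset.sum_sub_distrib, ← Finset.sum_add_distrib]
  refine Finset.sum_congr rfl fun n hn => ?_
  have hn0 : n ≠ 0 := by rw [Finset.mem_Icc] at hn; omega
  have hn' : (0 : ℝ) < n := by exact_mod_cast Nat.pos_of_ne_zero hn0
  by_cases hc : 2 * Real.log n - τ < z
  · simp only [hc, if_true]
    rw [chiStep_eq N, ← Finset.sum_sub_distrib]
    congr 1
    · refine Finset.sum_congr rfl fun κ _ => ?_
      have h1 := osc_sub_log (q := q) hn0 κ (Real.exp h) z (Real.exp_pos h)
      have h2 := osc_sub_log (q := q) hn0 κ 1 z one_pos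
      rw [Real.log_exp] at h1
      rw [Real.log_one, add_zero] at h2
      rw [h1, h2]
      split_ifs
      · ring
      · ring
    · refine Finset.sum_congr rfl fun r _ => ?_
      rw [Real.exp_add, Real.exp_sub, Real.exp_log hn']
      congr 5
      · ring
      · ring
  · simp only [hc, if_false, ite_self, Finset.sum_const_zero, sub_zero, add_zero]

theorem measurable_hyperErr (N M : ℕ) (h τ : ℝ) (j : ZMod q) : Measurable (hyperErr N M h τ j) := by
  have := measurable_sawErr N
  refine Finset.measurable_fun_sum _ fun p _ => Measurable.ite measurableSet_Ioi ?_ measurable_const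
  exact measurable_const.mul (Complex.measurable_ofReal.comp (by fun_prop))

theorem tendsto_energy_hyperErr (M : ℕ) (h τ k : ℝ) :
    Filter.Tendsto (fun N => energy (window k) (hyperErr (q := q) N M h τ)) Filter.atTop
      (nhds 0) := by
  set J : Finset (ℕ × ZMod q) := Finset.Icc 1 M ×ˢ Finset.univ with hJ
  set D : ℕ → ℝ → ℕ × ZMod q → ENNReal := fun N α p => ∫⁻ z in Set.Ioc k (k + 1),
    ENNReal.ofReal (sawErr N ((α / p.1 * Real.exp z - p.2.val) / q) ^ 2) *
      ENNReal.ofReal (Real.exp z) with hD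
  have hmeas : ∀ N (α : ℝ) (p : ℕ × ZMod q), Measurable fun z =>
      ENNReal.ofReal (sawErr N ((α / p.1 * Real.exp z - p.2.val) / q) ^ 2) := fun N α p => by
    have := measurable_sawErr N
    fun_prop
  have hle : ∀ N, energy (window k) (hyperErr (q := q) N M h τ) ≤
      q * (J.card * (2 * ∑ p ∈ J, (D N (Real.exp h) p + D N 1 p))) := by
    intro N
    have hp : ∀ z, ∑ j : ZMod q, ‖hyperErr N M h τ j z‖ₑ ^ 2 ≤ q * (J.card * (2 * ∑ p ∈ J,
        (ENNReal.ofReal (sawErr N ((Real.exp h / p.1 * Real.exp z - p.2.val) / q) ^ 2) +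
          ENNReal.ofReal (sawErr N ((1 / p.1 * Real.exp z - p.2.val) / q) ^ 2)))) := by
      intro z
      refine (Finset.sum_le_card_nsmul _ _ _ fun j _ => ?_).trans_eq
        (by rw [Finset.card_univ, ZMod.card, nsmul_eq_mul])
      refine (enorm_sum_sq_le _ _).trans ?_
      gcongr
      rw [Finset.mul_sum]
      refine Finset.sum_le_sum fun p _ => ?_
      split_ifs
      · rw [enorm_mul, ← ofReal_norm, norm_χ, ENNReal.ofReal_one, one_mul, Complex.ofReal_sub,
          ← enorm_ofReal_sq, ← enorm_ofReal_sq]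
        exact enorm_sub_sq_le _ _
      · simp
    refine (lintegral_mono hp).trans_eq ?_
    have hm2 : ∀ p : ℕ × ZMod q, Measurable fun z =>
        ENNReal.ofReal (sawErr N ((Real.exp h / p.1 * Real.exp z - p.2.val) / q) ^ 2) +
          ENNReal.ofReal (sawErr N ((1 / p.1 * Real.exp z - p.2.val) / q) ^ 2) :=
      fun p => (hmeas N (Real.exp h) p).add (hmeas N 1 p)
    have hm3 := Finset.measurable_fun_sum J fun p _ => hm2 p
    rw [lintegral_const_mul _ ((hm3.const_mul _).const_mul _), lintegral_const_mul _ (hm3.const_mul _),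
      lintegral_const_mul _ hm3, lintegral_finsetSum _ fun p _ => hm2 p]
    refine congrArg _ (congrArg _ (congrArg _ (Finset.sum_congr rfl fun p _ => ?_)))
    rw [lintegral_add_left (hmeas N (Real.exp h) p), lintegral_window k (hmeas N _ p),
      lintegral_window k (hmeas N 1 p)]
  have ht : ∀ α : ℝ, 0 < α → ∀ p ∈ J, Filter.Tendsto (fun N => D N α p) Filter.atTop (nhds 0) := by
    intro α hα p hp
    have : (0 : ℝ) < p.1 := by
      simp only [hJ, Finset.mem_product, Finset.mem_Icc] at hp
      exact_mod_cast hp.1.1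
    exact tendsto_lintegral_sawErr_sq (by positivity) q_pos _ k
  have h1 : Filter.Tendsto (fun N => ∑ p ∈ J, (D N (Real.exp h) p + D N 1 p)) Filter.atTop
      (nhds 0) := by
    have := tendsto_finsetSum J fun p hp => (ht _ (Real.exp_pos h) p hp).add (ht 1 one_pos p hp)
    simpa using this
  have h2 := ENNReal.Tendsto.const_mul (a := (q : ENNReal)) (ENNReal.Tendsto.const_mul
    (a := (J.card : ENNReal)) (ENNReal.Tendsto.const_mul (a := 2) h1 (Or.inr (by norm_num)))
      (Or.inr (ENNReal.natCast_ne_top _))) (Or.inr (ENNReal.natCast_ne_top _))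
  simp only [mul_zero] at h2
  exact tendsto_of_tendsto_of_tendsto_of_le_of_le tendsto_const_nhds h2 (fun _ => zero_le) hle

end Hyper

section HyperBound

theorem low_coeff_le {η Θ E n κ : ℝ} (hη : 0 < η) (hΘ : 0 < Θ) (hn : 0 < n) (hκ : 0 < κ)
    (hE : n ^ 2 ≤ 9 * E) (h : κ ≤ Θ * n) :
    1 / n ≤ Θ ^ (1 / 2 + η) * (9 * E) ^ η * ((n * κ) ^ (1 / 2 + η))⁻¹ := by
  rw [← div_eq_mul_inv, div_le_div_iff₀ hn (by positivity), one_mul]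
  calc (n * κ) ^ (1 / 2 + η) ≤ (Θ * n ^ 2) ^ (1 / 2 + η) := by
        refine Real.rpow_le_rpow (by positivity) ?_ (by positivity)
        nlinarith
    _ = Θ ^ (1 / 2 + η) * (n ^ 2) ^ η * n := by
        rw [Real.mul_rpow hΘ.le (by positivity), Real.rpow_add (x := n ^ 2) (by positivity),
          ← Real.sqrt_eq_rpow, Real.sqrt_sq hn.le]
        ring
    _ ≤ _ := by gcongr

theorem high_coeff_le {η Θ E n κ : ℝ} (hη : 0 < η) (hη1 : η ≤ 1 / 2) (hΘ : 0 < Θ) (hn : 0 < n)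
    (hE : n ^ 2 ≤ 9 * E) (h : Θ * n < κ) :
    1 / κ ≤ Θ ^ (η - 1 / 2) * (9 * E) ^ η * ((n * κ) ^ (1 / 2 + η))⁻¹ := by
  have hκ : 0 < κ := lt_trans (by positivity) h
  rw [← div_eq_mul_inv, div_le_div_iff₀ hκ (by positivity), one_mul]
  calc (n * κ) ^ (1 / 2 + η) = n ^ (1 / 2 + η) * κ ^ (η - 1 / 2) * κ := by
        rw [Real.mul_rpow hn.le hκ.le, mul_assoc, ← Real.rpow_add_one hκ.ne']
        congr 2; ring
    _ ≤ n ^ (1 / 2 + η) * (Θ * n) ^ (η - 1 / 2) * κ := by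
        refine mul_le_mul_of_nonneg_right (mul_le_mul_of_nonneg_left ?_ (by positivity)) hκ.le
        exact Real.rpow_le_rpow_of_nonpos (by positivity : 0 < Θ * n) h.le (by linarith)
    _ = Θ ^ (η - 1 / 2) * (n ^ 2) ^ η * κ := by
        rw [Real.mul_rpow hΘ.le hn.le, ← Real.rpow_natCast n 2, ← Real.rpow_mul hn.le,
          show ((2 : ℕ) : ℝ) * η = (1 / 2 + η) + (η - 1 / 2) by push_cast; ring,
          Real.rpow_add hn (1 / 2 + η) (η - 1 / 2)]
        ring
    _ ≤ _ := by gcongr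

theorem nine_rpow_le {η : ℝ} (hη1 : η ≤ 1 / 2) : ((9 : ℝ) ^ η) ^ 2 ≤ 9 := by
  rw [← Real.rpow_natCast, ← Real.rpow_mul (by norm_num)]
  calc (9 : ℝ) ^ (η * (2 : ℕ)) ≤ 9 ^ (1 : ℝ) :=
        Real.rpow_le_rpow_of_exponent_le (by norm_num) (by push_cast; linarith)
    _ = 9 := Real.rpow_one _

theorem high_total_le {η Q h E : ℝ} (hη1 : η ≤ 1 / 2) (hQ : 0 < Q) (hh : 0 < h) (hE : 0 < E) :
    Q ^ η * (Q * ((Q / (h * E)) ^ (η - 1 / 2) * (9 * E) ^ η)) ^ 2 * E ≤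
      9 * (Q ^ (1 + 3 * η) * h ^ (1 - 2 * η) * E ^ 2) := by
  have e1 : (Q / (h * E)) ^ (η - 1 / 2) = Q ^ (η - 1 / 2) * h ^ (1 / 2 - η) * E ^ (1 / 2 - η) := by
    rw [Real.div_rpow hQ.le (by positivity), Real.mul_rpow hh.le hE.le, div_eq_mul_inv, mul_inv,
      ← Real.rpow_neg hh.le, ← Real.rpow_neg hE.le, neg_sub, mul_assoc]
  have e2 : (9 * E) ^ η = 9 ^ η * E ^ η := Real.mul_rpow (by norm_num) hE.le
  have e3 : Q ^ η * Q ^ 2 * (Q ^ (η - 1 / 2)) ^ 2 = Q ^ (1 + 3 * η) := by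
    rw [← Real.rpow_natCast Q, ← Real.rpow_natCast (Q ^ _), ← Real.rpow_mul hQ.le,
      ← Real.rpow_add hQ, ← Real.rpow_add hQ]
    congr 1; push_cast; ring
  have e4 : (h ^ (1 / 2 - η)) ^ 2 = h ^ (1 - 2 * η) := by
    rw [← Real.rpow_natCast, ← Real.rpow_mul hh.le]; congr 1; push_cast; ring
  have e5 : E ^ (1 / 2 - η) * E ^ η = E ^ (1 / 2 : ℝ) := by
    rw [← Real.rpow_add hE]; congr 1; ring
  have e6 : (E ^ (1 / 2 : ℝ)) ^ 2 = E := by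
    rw [← Real.sqrt_eq_rpow, Real.sq_sqrt hE.le]
  calc _ = (9 ^ η) ^ 2 * ((Q ^ η * Q ^ 2 * (Q ^ (η - 1 / 2)) ^ 2) * (h ^ (1 / 2 - η)) ^ 2 *
        ((E ^ (1 / 2 - η) * E ^ η) ^ 2 * E)) := by rw [e1, e2]; ring
    _ = (9 ^ η) ^ 2 * (Q ^ (1 + 3 * η) * h ^ (1 - 2 * η) * E ^ 2) := by
        rw [e3, e4, e5, e6]; ring
    _ ≤ _ := by
        gcongr
        exact nine_rpow_le hη1

theorem low_total_le {η Q h E : ℝ} (hη1 : η ≤ 1 / 2) (hQ : 0 < Q) (hh : 0 < h) (hE : 0 < E) :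
    E ^ 2 * h ^ 2 * (Q ^ η * ((Q / (h * E)) ^ (1 / 2 + η) * (9 * E) ^ η) ^ 2 * E) ≤
      9 * (Q ^ (1 + 3 * η) * h ^ (1 - 2 * η) * E ^ 2) := by
  have h1 : (Q / (h * E)) ^ (1 / 2 + η) = (Q / (h * E)) * (Q / (h * E)) ^ (η - 1 / 2) := by
    rw [show 1 / 2 + η = 1 + (η - 1 / 2) by ring, Real.rpow_add (by positivity), Real.rpow_one]
  have := high_total_le hη1 hQ hh hE
  rw [h1]
  refine le_trans (le_of_eq ?_) this
  field_simp

theorem exists_energy_hyperSum_le {η : ℝ} (hη : 0 < η) (hη1 : η ≤ 1 / 2) : ∃ C : ℝ, 1 ≤ C ∧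
    ∀ (q : ℕ) [NeZero q] (h τ k : ℝ) (M : ℕ), 0 < h → h ≤ 1 → (M : ℝ) ^ 2 ≤ 9 * Real.exp k →
      energy (window k) (hyperSum (q := q) M h τ) ≤
        ENNReal.ofReal (C * ((q : ℝ) ^ (1 + 3 * η) * h ^ (1 - 2 * η) * Real.exp k ^ 2)) := by
  obtain ⟨C, hC, H⟩ := exists_energy_dualSum_le hη
  refine ⟨1000 * C + 1000 * C + 2, by linarith, fun q _ h τ k M h0 h1 hM => ?_⟩
  set E := Real.exp k with hE
  have E0 : 0 < E := Real.exp_pos k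
  have hq : (0 : ℝ) < q := q_pos
  set T : ℝ := (q : ℝ) ^ (1 + 3 * η) * h ^ (1 - 2 * η) * E ^ 2 with hT
  have T0 : 0 < T := by positivity
  obtain ⟨N, hN⟩ := ((tendsto_energy_hyperErr (q := q) M h τ k).eventually_le_const
    (ENNReal.ofReal_pos.2 T0)).exists
  set Θ : ℝ := q / (h * E) with hΘ
  have Θ0 : 0 < Θ := by positivity
  set I := Finset.Icc 1 M ×ˢ punctured N with hI
  set IL := I.filter fun p => |(p.2 : ℝ)| ≤ Θ * p.1 with hIL
  set IH := I.filter fun p => ¬ |(p.2 : ℝ)| ≤ Θ * p.1 with hIH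
  set c : ℕ → ℝ := fun n => 2 * Real.log n - τ with hc
  set aH : ℕ × ℤ → ℂ := fun p => q / (2 * Real.pi * Complex.I * p.2) with haH
  set aL : ℕ × ℤ → ℂ := fun p => 1 / p.1 with haL
  have hIp : ∀ p ∈ I, p.1 ≠ 0 ∧ p.2 ≠ 0 ∧ (p.1 : ℝ) ^ 2 ≤ 9 * E := by
    intro p hp
    simp only [hI, punctured, Finset.mem_product, Finset.mem_Icc, Finset.mem_erase] at hp
    refine ⟨by omega, hp.2.1, le_trans ?_ hM⟩
    gcongr
    exact hp.1.2
  have hΛ : 1 ≤ Real.exp h := Real.one_le_exp h0.le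
  have hbH : ∀ t, 1 ≤ t → energy (window k) (dualSum (q := q) t c aH IH) ≤
      ENNReal.ofReal (C * (9 * T)) := by
    intro t ht
    refine (H q k t c aH IH (q * (Θ ^ (η - 1 / 2) * (9 * E) ^ η)) ht
      (fun p hp => hIp p (Finset.mem_filter.1 hp).1) fun p hp => ?_).trans
        (ENNReal.ofReal_le_ofReal ?_)
    · obtain ⟨p1, p2⟩ := Finset.mem_filter.1 hp
      obtain ⟨i1, i2, i3⟩ := hIp p p1
      have n0 : (0 : ℝ) < p.1 := by exact_mod_cast Nat.pos_of_ne_zero i1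
      have b := high_coeff_le hη hη1 Θ0 n0 i3 (not_le.1 p2)
      have k0 : 0 < |(p.2 : ℝ)| := abs_pos.2 (by exact_mod_cast i2)
      have hnorm : ‖aH p‖ = q / (2 * Real.pi * |(p.2 : ℝ)|) := by
        simp only [haH, norm_div, norm_mul, Complex.norm_natCast, Complex.norm_I, mul_one,
          Complex.norm_ofNat, Complex.norm_real, Real.norm_eq_abs, abs_of_pos Real.pi_pos,
          Complex.norm_intCast]
      calc ‖aH p‖ = q * (1 / (2 * Real.pi * |(p.2 : ℝ)|)) := by rw [hnorm]; ring
        _ ≤ q * (1 / |(p.2 : ℝ)|) := by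
            gcongr
            nlinarith [Real.pi_gt_three]
        _ ≤ q * (Θ ^ (η - 1 / 2) * (9 * E) ^ η * ((p.1 * |(p.2 : ℝ)|) ^ (1 / 2 + η))⁻¹) := by gcongr
        _ = _ := by ring
    · have := high_total_le hη1 hq h0 E0
      calc _ = C * ((q : ℝ) ^ η * (q * (Θ ^ (η - 1 / 2) * (9 * E) ^ η)) ^ 2 * E) := by ring
        _ ≤ _ := by gcongr
  have hbL : energy (window k) (fun (j : ZMod q) z => (Real.exp z : ℂ) *
      ∫ t in Set.Ioc 1 (Real.exp h), dualSum t c aL IL j z) ≤ ENNReal.ofReal (C * (324 * T)) := by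
    refine (energy_mul_le (B := Real.exp (k + 1)) (window k) _ (g := fun z => (Real.exp z : ℂ))
      (ae_window fun z _ hz => ?_)).trans ?_
    · rw [Complex.norm_real, Real.norm_eq_abs, abs_of_pos (Real.exp_pos z)]
      exact Real.exp_le_exp.2 hz
    have hmeas : ∀ j : ZMod q, Measurable fun p : ℝ × ℝ => dualSum p.1 c aL IL j p.2 := by
      intro j
      refine Finset.measurable_fun_sum _ fun p _ => ?_
      split_ifs
      · refine Measurable.ite (measurableSet_lt measurable_const measurable_snd) ?_ measurable_const
        have : Continuous fun x : ℝ × ℝ => aL p * osc (freq q x.1 p) x.2 := by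
          unfold osc freq; fun_prop
        exact this.measurable
      · exact measurable_const
    have hB : ∀ t ∈ Set.Ioc 1 (Real.exp h), energy (window k) (dualSum (q := q) t c aL IL) ≤
        ENNReal.ofReal (C * (q : ℝ) ^ η * (Θ ^ (1 / 2 + η) * (9 * E) ^ η) ^ 2 * E) := by
      intro t ht
      refine H q k t c aL IL _ ht.1.le (fun p hp => hIp p (Finset.mem_filter.1 hp).1) fun p hp => ?_
      obtain ⟨p1, p2⟩ := Finset.mem_filter.1 hp
      obtain ⟨i1, i2, i3⟩ := hIp p p1
      have n0 : (0 : ℝ) < p.1 := by exact_mod_cast Nat.pos_of_ne_zero i1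
      have k0 : 0 < |(p.2 : ℝ)| := abs_pos.2 (by exact_mod_cast i2)
      simp only [haL, norm_div, norm_one, Complex.norm_natCast]
      exact low_coeff_le hη Θ0 n0 k0 i3 p2
    have h_int := energy_integral_le (window k) (Set.Ioc 1 (Real.exp h))
      (F := fun t => dualSum (q := q) t c aL IL) hmeas
    refine (mul_le_mul' le_rfl h_int).trans ?_
    refine (mul_le_mul' le_rfl (mul_le_mul' le_rfl
      (setLIntegral_mono measurable_const hB))).trans ?_
    rw [setLIntegral_const, Real.volume_Ioc, ← ENNReal.ofReal_mul (by positivity),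
      ← ENNReal.ofReal_mul (by linarith), ← ENNReal.ofReal_mul (by positivity)]
    refine ENNReal.ofReal_le_ofReal ?_
    have b1 := exp_sub_one_le_two_mul h0.le h1
    have b2 := low_total_le hη1 hq h0 E0
    have b3 : Real.exp (k + 1) ≤ 3 * E := by
      rw [Real.exp_add, ← hE]; nlinarith [Real.exp_one_lt_d9]
    have b4 : 0 ≤ Real.exp h - 1 := by linarith
    calc _ ≤ (3 * E) ^ 2 * (2 * h * (C * (q : ℝ) ^ η * (Θ ^ (1 / 2 + η) * (9 * E) ^ η) ^ 2 * E *
          (2 * h))) := by gcongr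
      _ = C * (36 * (E ^ 2 * h ^ 2 *
          ((q : ℝ) ^ η * (Θ ^ (1 / 2 + η) * (9 * E) ^ η) ^ 2 * E))) := by ring
      _ ≤ C * (36 * (9 * T)) := by gcongr
      _ = _ := by ring
  have hdec : ∀ (j : ZMod q) z, hyperSum M h τ j z =
      (dualSum (Real.exp h) c aH IH j z - dualSum 1 c aH IH j z) +
        ((Real.exp z : ℂ) * (∫ t in Set.Ioc 1 (Real.exp h), dualSum t c aL IL j z) +
          hyperErr N M h τ j z) := by
    intro j z
    have hs : ∀ t, dualSum t c aH I j z = dualSum t c aH IL j z + dualSum t c aH IH j z :=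
      fun t => (Finset.sum_filter_add_sum_filter_not I _ _).symm
    rw [hyperSum_eq N, ← hc, ← hI, ← haH, hs, hs, ← dualSum_sub hΛ c (fun p hp =>
      ⟨(hIp p (Finset.mem_filter.1 hp).1).1, (hIp p (Finset.mem_filter.1 hp).1).2.1⟩)]
    ring
  rw [energy_congr (Filter.Eventually.of_forall fun z j => hdec j z)]
  have m1 := fun t (j : ZMod q) => measurable_dualSum t c aH IH j
  have hA := (energy_sub_le (window k) (m1 (Real.exp h)) (dualSum 1 c aH IH)).trans
    (mul_le_mul' le_rfl (add_le_add (hbH _ hΛ) (hbH 1 le_rfl)))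
  have hBB := (energy_add_le (window k) (measurable_hyperErr (q := q) N M h τ) (fun (j : ZMod q) z =>
    (Real.exp z : ℂ) * ∫ t in Set.Ioc 1 (Real.exp h), dualSum t c aL IL j z)).trans
    (mul_le_mul' le_rfl (add_le_add hN hbL))
  simp only [add_comm (hyperErr N M h τ _ _)] at hBB
  refine (energy_add_le (window k) (fun j => (m1 (Real.exp h) j).sub (m1 1 j)) _).trans
    ((mul_le_mul' le_rfl (add_le_add hA hBB)).trans ?_)
  rw [show (2 : ENNReal) = ENNReal.ofReal 2 by simp]
  have C0 : 0 ≤ C := by linarith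
  rw [← ENNReal.ofReal_add (by positivity) (by positivity),
    ← ENNReal.ofReal_add (by positivity) (by positivity),
    ← ENNReal.ofReal_mul (by positivity), ← ENNReal.ofReal_mul (by positivity),
    ← ENNReal.ofReal_add (by positivity) (by positivity), ← ENNReal.ofReal_mul (by positivity)]
  refine ENNReal.ofReal_le_ofReal ?_
  nlinarith [mul_nonneg C0 T0.le]

end HyperBound

section Reflection

theorem integral_eq_two_mul_of_reflection {E : Type*} [NormedAddCommGroup E] [NormedSpace ℝ E]
    {f : ℝ → E} {s : ℝ} (hf : Integrable f) (hs : ∀ v, f (s - v) = f v) :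
    ∫ v, f v = (2 : ℝ) • ∫ v in Set.Iio (s / 2), f v := by
  rw [← integral_add_compl (measurableSet_Iio (a := s / 2)) hf, two_smul]
  congr 1
  rw [Set.compl_Iio, ← integral_Iic_eq_integral_Iio, ← integral_indicator measurableSet_Ici,
    ← integral_indicator measurableSet_Iic, ← integral_sub_left_eq_self _ _ s]
  refine integral_congr_ae (Filter.Eventually.of_forall fun v => ?_)
  by_cases h : v ≤ s / 2
  · simp only [Set.indicator_of_mem (show v ∈ Set.Iic (s / 2) from h),
      Set.indicator_of_mem (show s - v ∈ Set.Ici (s / 2) from by simp only [Set.mem_Ici]; linarith),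
      hs]
  · simp only [Set.indicator_of_notMem (show v ∉ Set.Iic (s / 2) from h),
      Set.indicator_of_notMem (show s - v ∉ Set.Ici (s / 2) from by
        simp only [Set.mem_Ici]; push Not at h ⊢; linarith)]

theorem norm_setIntegral_Iio_exp_mul_le {β : ℝ → ℝ} {θ : ℝ} (hθ : θ ≤ 1 / 2)
    (hb : ∀ y, |β y| ≤ Real.exp (θ * y)) (s c : ℝ) :
    |∫ v in Set.Iio c, Real.exp v * β (s - v)| ≤ 2 * Real.exp (θ * s + (1 - θ) * c) := by
  have hi : IntegrableOn (fun v => Real.exp (θ * s) * Real.exp ((1 - θ) * v)) (Set.Iio c) :=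
    ((integrableOn_exp_mul_Iic (by linarith : 0 < 1 - θ) c).mono_set
      Set.Iio_subset_Iic_self).const_mul _
  have h := norm_integral_le_of_norm_le hi (f := fun v => Real.exp v * β (s - v))
    (Filter.Eventually.of_forall fun v => by
      rw [norm_mul, Real.norm_eq_abs, Real.norm_eq_abs, Real.abs_exp]
      refine (mul_le_mul_of_nonneg_left (hb _) (Real.exp_pos _).le).trans (le_of_eq ?_)
      rw [← Real.exp_add, ← Real.exp_add]
      congr 1
      ring)
  rw [Real.norm_eq_abs] at h
  refine h.trans ?_
  rw [integral_const_mul, ← integral_Iic_eq_integral_Iio, integral_exp_mul_Iic (by linarith),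
    Real.exp_add, mul_div_assoc', div_le_iff₀ (by linarith)]
  have := mul_pos (Real.exp_pos (θ * s)) (Real.exp_pos ((1 - θ) * c))
  nlinarith

theorem integrableOn_Iio_exp_mul {β : ℝ → ℝ} (hm : Measurable β)
    (hb : ∀ y, |β y| ≤ 1) (s c : ℝ) :
    IntegrableOn (fun v => Real.exp v * β (s - v)) (Set.Iio c) := by
  have hi : IntegrableOn (fun v => Real.exp v) (Set.Iio c) := by
    have := (integrableOn_exp_mul_Iic one_pos c).mono_set Set.Iio_subset_Iic_self
    simpa using this
  refine Integrable.mono' hi ?_ (Filter.Eventually.of_forall fun v => ?_)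
  · exact (Real.measurable_exp.mul (hm.comp (measurable_const.sub measurable_id))).aestronglyMeasurable
  · rw [norm_mul, Real.norm_eq_abs, Real.norm_eq_abs, Real.abs_exp]
    exact mul_le_of_le_one_right (Real.exp_pos _).le (hb _)

/-- A difference of a bounded function, averaged against `e^v`, gains a factor `h`. -/
theorem abs_setIntegral_exp_mul_diff_le {β : ℝ → ℝ} (hm : Measurable β) (hb1 : ∀ y, |β y| ≤ 1)
    {θ : ℝ} (hθ : θ ≤ 1 / 2) (hb : ∀ y, |β y| ≤ Real.exp (θ * y)) {h : ℝ} (hh : 0 < h)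
    (hh1 : h ≤ 1) (s : ℝ) :
    |∫ v in Set.Iio (s / 2), Real.exp v * (β (s - v + h) - β (s - v))| ≤
      5 * h * Real.exp ((1 + θ) * s / 2) := by
  have hI := fun s c => integrableOn_Iio_exp_mul hm hb1 s c
  have h1 : ∫ v in Set.Iio (s / 2), Real.exp v * β (s + h - v) =
      Real.exp h * ∫ v in Set.Iio (s / 2 - h), Real.exp v * β (s - v) := by
    rw [← integral_const_mul, ← integral_indicator measurableSet_Iio,
      ← integral_indicator measurableSet_Iio, ← integral_add_right_eq_self _ h]
    congr 1
    ext v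
    by_cases hv : v < s / 2 - h
    · rw [Set.indicator_of_mem (show v + h ∈ Set.Iio (s / 2) by
        simp only [Set.mem_Iio]; linarith), Set.indicator_of_mem (show v ∈ Set.Iio _ from hv),
        show s + h - (v + h) = s - v by ring, Real.exp_add]
      ring
    · rw [Set.indicator_of_notMem (show v + h ∉ Set.Iio (s / 2) by
        simp only [Set.mem_Iio]; intro h'; exact hv (by linarith)),
        Set.indicator_of_notMem (show v ∉ Set.Iio _ from hv)]
  have h2 : ∫ v in Set.Iio (s / 2), Real.exp v * β (s - v) =
      (∫ v in Set.Iio (s / 2 - h), Real.exp v * β (s - v)) +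
        ∫ v in Set.Ico (s / 2 - h) (s / 2), Real.exp v * β (s - v) := by
    rw [← setIntegral_union _ measurableSet_Ico (hI _ _)
      ((hI s (s / 2)).mono_set Set.Ico_subset_Iio_self), Set.Iio_union_Ico_eq_Iio (by linarith)]
    exact Set.disjoint_left.2 fun v hv hv' => absurd hv'.1 (not_le.2 hv)
  have h3 : ∫ v in Set.Iio (s / 2), Real.exp v * (β (s - v + h) - β (s - v)) =
      (Real.exp h - 1) * (∫ v in Set.Iio (s / 2 - h), Real.exp v * β (s - v)) -
        ∫ v in Set.Ico (s / 2 - h) (s / 2), Real.exp v * β (s - v) := by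
    have : ∀ v, Real.exp v * (β (s - v + h) - β (s - v)) =
        Real.exp v * β (s + h - v) - Real.exp v * β (s - v) := fun v => by
      rw [mul_sub, show s - v + h = s + h - v by ring]
    simp only [this]
    rw [integral_sub (hI _ _) (hI _ _), h1, h2]
    ring
  have h4 := norm_setIntegral_Iio_exp_mul_le hθ hb s (s / 2 - h)
  have h5 : Real.exp (θ * s + (1 - θ) * (s / 2 - h)) ≤ Real.exp ((1 + θ) * s / 2) :=
    Real.exp_le_exp.2 (by nlinarith)
  have h6 : |∫ v in Set.Ico (s / 2 - h) (s / 2), Real.exp v * β (s - v)| ≤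
      Real.exp ((1 + θ) * s / 2) * h := by
    have := norm_setIntegral_le_of_norm_le_const (μ := volume) (s := Set.Ico (s / 2 - h) (s / 2))
      (f := fun v => Real.exp v * β (s - v)) (C := Real.exp ((1 + θ) * s / 2)) (by simp)
      (fun v hv => by
        rw [norm_mul, Real.norm_eq_abs, Real.norm_eq_abs, Real.abs_exp]
        refine (mul_le_mul_of_nonneg_left (hb _) (Real.exp_pos _).le).trans ?_
        rw [← Real.exp_add]
        refine Real.exp_le_exp.2 ?_
        nlinarith [hv.2])
    rw [Real.norm_eq_abs] at this
    refine this.trans (le_of_eq ?_)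
    rw [Real.volume_real_Ico_of_le (by linarith)]
    ring
  have h7 := exp_sub_one_le_two_mul hh.le hh1
  have h8 : 0 ≤ Real.exp h - 1 := by linarith [Real.add_one_le_exp h]
  rw [h3]
  refine (abs_sub _ _).trans ?_
  rw [abs_mul, abs_of_nonneg h8]
  have h9 : (Real.exp h - 1) * |∫ v in Set.Iio (s / 2 - h), Real.exp v * β (s - v)| ≤
      (2 * h) * (2 * Real.exp ((1 + θ) * s / 2)) :=
    mul_le_mul h7 (h4.trans (by linarith)) (abs_nonneg _) (by linarith)
  linarith

end Reflection

section Corr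

variable {q : ℕ} [NeZero q]

/-- The additively twisted two-fold correlation of the step discrepancies. -/
noncomputable def twistCorr (h : ℝ) (j : ZMod q) (s : ℝ) : ℂ :=
  ∑ r₁, ∑ r₂, χ (j * r₁ * r₂) * (conv (step h r₁) (step h r₂) s : ℂ)

/-- The integrand of `twistCorr`. -/
noncomputable def corrKer (h : ℝ) (j : ZMod q) (s v : ℝ) : ℂ :=
  stepOp h v (fun c => chiStep h c (s - v)) j

theorem corrKer_eq (h : ℝ) (j : ZMod q) (s v : ℝ) : corrKer h j s v =
    ∑ r, ∑ r', χ (j * r * r') * ((step h r (s - v) * step h r' v : ℝ) : ℂ) := by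
  rw [corrKer, stepOp, Finset.sum_comm]
  refine Finset.sum_congr rfl fun r _ => ?_
  rw [chiStep, Finset.mul_sum]
  refine Finset.sum_congr rfl fun r' _ => ?_
  rw [mul_right_comm j r' r]
  push_cast
  ring

theorem corrKer_reflect (h : ℝ) (j : ZMod q) (s v : ℝ) :
    corrKer h j s (s - v) = corrKer h j s v := by
  rw [corrKer_eq, corrKer_eq, Finset.sum_comm]
  refine Finset.sum_congr rfl fun r _ => Finset.sum_congr rfl fun r' _ => ?_
  rw [sub_sub_cancel, mul_right_comm j r' r, mul_comm (step h r' v)]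

theorem integrable_corrKer_term (h : ℝ) (j r r' : ZMod q) (s : ℝ) : Integrable fun v =>
    χ (j * r * r') * ((step h r (s - v) * step h r' v : ℝ) : ℂ) :=
  (((adm_step h r).integrable_conv (adm_step h r') (by norm_num) s).ofReal).const_mul _

theorem integrable_corrKer (h : ℝ) (j : ZMod q) (s : ℝ) : Integrable (corrKer h j s) := by
  simp only [funext (corrKer_eq h j s)]
  exact integrable_finsetSum _ fun r _ => integrable_finsetSum _ fun r' _ =>
    integrable_corrKer_term h j r r' s

theorem twistCorr_eq_integral (h : ℝ) (j : ZMod q) (s : ℝ) : twistCorr h j s = ∫ v, corrKer h j s v := by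
  simp only [corrKer_eq]
  rw [integral_finsetSum _ fun r _ => integrable_finsetSum _ fun r' _ =>
    integrable_corrKer_term h j r r' s, twistCorr]
  refine Finset.sum_congr rfl fun r _ => ?_
  rw [integral_finsetSum _ fun r' _ => integrable_corrKer_term h j r r' s]
  refine Finset.sum_congr rfl fun r' _ => ?_
  rw [integral_const_mul, integral_complex_ofReal, conv]

theorem measurable_twistCorr (h : ℝ) (j : ZMod q) : Measurable (twistCorr h j) :=
  Finset.measurable_fun_sum _ fun r₁ _ => Finset.measurable_fun_sum _ fun r₂ _ =>
    measurable_const.mul (Complex.measurable_ofReal.comp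
      (measurable_conv (measurable_step h r₁) (measurable_step h r₂)))

/-- The discrepancy summed over the annihilator of `j`. -/
noncomputable def annDisc (j : ZMod q) (y : ℝ) : ℝ := ∑ r with j * r = 0, disc r y

theorem measurable_annDisc (j : ZMod q) : Measurable (annDisc j) :=
  Finset.measurable_fun_sum _ fun r _ => measurable_disc r

theorem sum_chiStep (h : ℝ) (j : ZMod q) (y : ℝ) :
    ∑ r, chiStep h (j * r) y = ((q * (annDisc j (y + h) - annDisc j y) : ℝ) : ℂ) := by
  simp only [chiStep]
  rw [Finset.sum_comm]
  have h1 : ∀ r : ZMod q, ∑ c, χ (j * c * r) * (step h r y : ℂ) =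
      if j * r = 0 then (q : ℂ) * (step h r y : ℂ) else 0 := fun r => by
    rw [← Finset.sum_mul, Finset.sum_congr rfl fun c _ => by
      rw [show j * c * r = c * (j * r) by ring], sum_χ_mul]
    split_ifs <;> simp
  rw [Finset.sum_congr rfl fun r _ => h1 r, ← Finset.sum_filter, annDisc, annDisc,
    ← Finset.sum_sub_distrib, Finset.mul_sum]
  simp only [step]
  push_cast
  rfl

theorem exists_exponent_annDisc (j : ZMod q) {θ : ℝ} (hθ : 0 ≤ θ) (hθ1 : θ ≤ 1) (y : ℝ) :
    |annDisc j y| ≤ Real.exp (θ * y) := by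
  rcases le_total 0 y with hy | hy
  · exact (abs_sum_disc_annihilator_le_one j y).trans (Real.one_le_exp (by positivity))
  · exact (abs_sum_disc_annihilator_le_exp j y).trans (Real.exp_le_exp.2 (by nlinarith))

/-- The contribution to `twistCorr` of the main term of the counting function. -/
noncomputable def corrMain (h : ℝ) (j : ZMod q) (s : ℝ) : ℝ :=
  2 * ((Real.exp h - 1) * ∫ v in Set.Iio (s / 2), Real.exp v *
    (annDisc j (s - v + h) - annDisc j (s - v)))

theorem abs_corrMain_le {h : ℝ} (hh : 0 < h) (hh1 : h ≤ 1) (j : ZMod q) {θ : ℝ} (hθ : 0 ≤ θ)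
    (hθ1 : θ ≤ 1 / 2) (s : ℝ) : |corrMain h j s| ≤ 20 * h ^ 2 * Real.exp ((1 + θ) * s / 2) := by
  have h1 := abs_setIntegral_exp_mul_diff_le (measurable_annDisc j)
    (abs_sum_disc_annihilator_le_one j) hθ1
    (exists_exponent_annDisc j hθ (by linarith)) hh hh1 s
  have h8 : 0 ≤ Real.exp h - 1 := by linarith [Real.add_one_le_exp h]
  rw [corrMain, abs_mul, abs_mul, abs_of_nonneg h8, abs_two]
  calc _ ≤ 2 * ((2 * h) * (5 * h * Real.exp ((1 + θ) * s / 2))) := by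
        gcongr
        exact exp_sub_one_le_two_mul hh.le hh1
    _ = _ := by ring

theorem corrKer_eq_sub {h : ℝ} (hh : 0 ≤ h) (j : ZMod q) (s v : ℝ) : corrKer h j s v =
    ∑ n ∈ Finset.Ioc ⌊Real.exp v⌋₊ ⌊Real.exp (v + h)⌋₊, chiStep h (j * (n : ZMod q)) (s - v) -
      (((Real.exp h - 1) * (Real.exp v *
        (annDisc j (s - v + h) - annDisc j (s - v))) : ℝ) : ℂ) := by
  have hq : (q : ℂ) ≠ 0 := Nat.cast_ne_zero.2 (NeZero.ne q)
  rw [corrKer, stepOp, sum_step_mul hh (fun r => chiStep h (j * r) (s - v)), sum_chiStep,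
    Real.exp_add]
  congr 1
  push_cast
  field_simp

theorem integrable_chiStep_Ioc {h : ℝ} (c : ZMod q) (y a b : ℝ) :
    IntegrableOn (fun τ => chiStep h c (y + τ)) (Set.Ioc a b) := by
  have hm : Measurable fun τ => chiStep h c (y + τ) :=
    (measurable_chiStep h c).comp (measurable_const.add measurable_id)
  refine Measure.integrableOn_of_bounded (M := ∑ _r : ZMod q, 1) (by simp)
    hm.aestronglyMeasurable (Filter.Eventually.of_forall fun τ => ?_)
  refine (norm_sum_le _ _).trans (Finset.sum_le_sum fun r _ => ?_)
  rw [norm_mul, norm_χ, one_mul, Complex.norm_real]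
  exact abs_step_le_one h r _

theorem integral_sum_Ioc_eq {h : ℝ} (j : ZMod q) {s : ℝ} {M : ℕ}
    (hM : Real.exp (s / 2 + h) < M + 1) :
    ∫ v in Set.Iio (s / 2), ∑ n ∈ Finset.Ioc ⌊Real.exp v⌋₊ ⌊Real.exp (v + h)⌋₊,
      chiStep h (j * (n : ZMod q)) (s - v) = ∫ τ in Set.Ioc 0 h, hyperSum M h τ j (s + τ) := by
  let g : ℕ → ℝ → ℂ := fun n τ => (Set.Ioc 0 h ∩ Set.Ioi (Real.log n - s / 2)).indicator
    (fun τ => chiStep h (j * (n : ZMod q)) (s - Real.log n + τ)) τ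
  have hmS : ∀ n : ℕ, MeasurableSet (Set.Ioc 0 h ∩ Set.Ioi (Real.log n - s / 2)) :=
    fun n => measurableSet_Ioc.inter measurableSet_Ioi
  have hg : ∀ n, Integrable (g n) := fun n => by
    rw [integrable_indicator_iff (hmS n)]
    exact (integrable_chiStep_Ioc _ _ _ _).mono_set Set.inter_subset_left
  have h1 : ∀ τ, (Set.Ioc 0 h).indicator (fun τ => hyperSum M h τ j (s + τ)) τ =
      ∑ n ∈ Finset.Icc 1 M, g n τ := by
    intro τ
    by_cases hτ : τ ∈ Set.Ioc 0 h
    · rw [Set.indicator_of_mem hτ, hyperSum]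
      refine Finset.sum_congr rfl fun n _ => ?_
      by_cases hn : Real.log n - s / 2 < τ
      · rw [if_pos (by linarith)]
        simp only [g]
        rw [Set.indicator_of_mem (show τ ∈ Set.Ioc 0 h ∩ Set.Ioi (Real.log n - s / 2) from ⟨hτ, hn⟩)]
        congr 1
        ring
      · rw [if_neg (by intro h'; exact hn (by linarith))]
        simp only [g]
        rw [Set.indicator_of_notMem (fun h' => hn h'.2)]
    · rw [Set.indicator_of_notMem hτ]
      exact (Finset.sum_eq_zero fun n _ => Set.indicator_of_notMem (fun h' => hτ h'.1) _).symm
  have h2 : ∀ v, (Set.Iio (s / 2)).indicator (fun v =>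
      ∑ n ∈ Finset.Ioc ⌊Real.exp v⌋₊ ⌊Real.exp (v + h)⌋₊,
        chiStep h (j * (n : ZMod q)) (s - v)) v =
      ∑ n ∈ Finset.Icc 1 M, g n (Real.log n - v) := by
    intro v
    by_cases hv : v < s / 2
    · rw [Set.indicator_of_mem (show v ∈ Set.Iio _ from hv)]
      have hsub : Finset.Ioc ⌊Real.exp v⌋₊ ⌊Real.exp (v + h)⌋₊ =
          (Finset.Icc 1 M).filter fun n : ℕ => v ∈ Set.Ico (Real.log n - h) (Real.log n) := by
        ext n
        rw [Finset.mem_filter, Finset.mem_Icc]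
        rcases eq_or_ne n 0 with rfl | hn
        · simp
        rw [mem_Ioc_floor_exp_iff hn]
        refine ⟨fun hn' => ⟨⟨Nat.one_le_iff_ne_zero.2 hn, ?_⟩, hn'⟩, fun hn' => hn'.2⟩
        have hnpos : (0 : ℝ) < n := by exact_mod_cast Nat.pos_of_ne_zero hn
        have h3 : (n : ℝ) < M + 1 := by
          refine lt_of_le_of_lt ?_ hM
          rw [← Real.log_le_iff_le_exp hnpos]
          linarith [hn'.1]
        exact Nat.lt_succ_iff.1 (by exact_mod_cast h3)
      rw [hsub, Finset.sum_filter]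
      refine Finset.sum_congr rfl fun n _ => ?_
      by_cases hn : v ∈ Set.Ico (Real.log n - h) (Real.log n)
      · rw [if_pos hn]
        simp only [g]
        rw [Set.indicator_of_mem (show Real.log n - v ∈ Set.Ioc 0 h ∩ Set.Ioi (Real.log n - s / 2) from
          ⟨⟨by linarith [hn.2], by linarith [hn.1]⟩, by simp only [Set.mem_Ioi]; linarith⟩)]
        congr 1
        ring
      · rw [if_neg hn]
        simp only [g]
        rw [Set.indicator_of_notMem]
        exact fun h' => hn ⟨by linarith [h'.1.2], by linarith [h'.1.1]⟩
    · rw [Set.indicator_of_notMem (show v ∉ Set.Iio _ from hv)]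
      refine (Finset.sum_eq_zero fun n _ => Set.indicator_of_notMem (fun h' => hv ?_) _).symm
      have := h'.2
      simp only [Set.mem_Ioi] at this
      linarith
  rw [← integral_indicator measurableSet_Iio, ← integral_indicator measurableSet_Ioc,
    integral_congr_ae (Filter.Eventually.of_forall h1),
    integral_congr_ae (Filter.Eventually.of_forall h2), integral_finsetSum _ fun n _ => hg n,
    integral_finsetSum _ fun n _ => (hg n).comp_sub_left (Real.log n)]
  exact Finset.sum_congr rfl fun n _ => integral_sub_left_eq_self (g n) _ _

theorem twistCorr_eq {h : ℝ} (hh : 0 < h) (j : ZMod q) {s : ℝ} {M : ℕ}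
    (hM : Real.exp (s / 2 + h) < M + 1) : twistCorr h j s =
    2 * (∫ τ in Set.Ioc 0 h, hyperSum M h τ j (s + τ)) - (corrMain h j s : ℂ) := by
  have hb : IntegrableOn (fun v => (((Real.exp h - 1) * (Real.exp v *
      (annDisc j (s - v + h) - annDisc j (s - v))) : ℝ) : ℂ)) (Set.Iio (s / 2)) := by
    refine Integrable.ofReal (Integrable.const_mul ?_ _)
    have hI := fun s c => integrableOn_Iio_exp_mul (measurable_annDisc j)
      (abs_sum_disc_annihilator_le_one j) s c
    refine ((hI (s + h) (s / 2)).sub (hI s (s / 2))).congr (Filter.Eventually.of_forall fun v => ?_)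
    simp only [Pi.sub_apply]
    rw [mul_sub, show s - v + h = s + h - v by ring]
  have ha : IntegrableOn (fun v => ∑ n ∈ Finset.Ioc ⌊Real.exp v⌋₊ ⌊Real.exp (v + h)⌋₊,
      chiStep h (j * (n : ZMod q)) (s - v)) (Set.Iio (s / 2)) := by
    refine ((integrable_corrKer h j s).integrableOn.add hb).congr
      (Filter.Eventually.of_forall fun v => ?_)
    simp only [Pi.add_apply]
    rw [corrKer_eq_sub hh.le, sub_add_cancel]
  rw [twistCorr_eq_integral, integral_eq_two_mul_of_reflection (integrable_corrKer h j s)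
    (corrKer_reflect h j s)]
  simp only [corrKer_eq_sub hh.le]
  rw [integral_sub ha hb, integral_sum_Ioc_eq j hM, integral_complex_ofReal,
    integral_const_mul, Complex.real_smul, corrMain]
  push_cast
  ring

end Corr

section WeightedEnergy

/-- The measure `e^{-(1+η)s} ds`. -/
noncomputable def expWeight (η : ℝ) : Measure ℝ :=
  volume.withDensity fun s => ENNReal.ofReal (Real.exp (-(1 + η) * s))

instance (η : ℝ) : SFinite (expWeight η) := by unfold expWeight; infer_instance

theorem lintegral_expWeight (η : ℝ) {f : ℝ → ENNReal} (hf : Measurable f) :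
    ∫⁻ s, f s ∂(expWeight η) = ∫⁻ s, f s * ENNReal.ofReal (Real.exp (-(1 + η) * s)) := by
  rw [expWeight, lintegral_withDensity_eq_lintegral_mul _ (by fun_prop) hf]
  simp only [Pi.mul_apply, mul_comm]

variable {ι : Type*} [Fintype ι]

theorem measurable_energy_density {Φ : ι → ℝ → ℂ} (hΦ : ∀ j, Measurable (Φ j)) :
    Measurable fun z => ∑ j, ‖Φ j z‖ₑ ^ 2 :=
  Finset.measurable_fun_sum _ fun j _ => (hΦ j).enorm.pow_const 2

theorem energy_expWeight_translate_le {η τ : ℝ} (hη : η ≤ 1) (hτ0 : 0 ≤ τ) (hτ : τ ≤ 1)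
    {Φ : ι → ℝ → ℂ} (hΦ : ∀ j, Measurable (Φ j)) :
    energy (expWeight η) (fun j s => Φ j (s + τ)) ≤
      ENNReal.ofReal (Real.exp 2) * energy (expWeight η) Φ := by
  have hΦ' : ∀ j, Measurable fun s => Φ j (s + τ) := fun j =>
    (hΦ j).comp (measurable_id.add_const τ)
  rw [energy, energy, lintegral_expWeight _ (measurable_energy_density hΦ'),
    lintegral_expWeight _ (measurable_energy_density hΦ),
    ← lintegral_const_mul' _ _ ENNReal.ofReal_ne_top,
    ← lintegral_add_right_eq_self (fun s => ENNReal.ofReal (Real.exp 2) * _) τ]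
  refine lintegral_mono fun s => ?_
  simp only
  rw [mul_left_comm, ← ENNReal.ofReal_mul (Real.exp_pos _).le, ← Real.exp_add]
  gcongr
  nlinarith

theorem energy_expWeight_le_tsum_window {η : ℝ} (hη : 0 < η) {Φ : ι → ℝ → ℂ}
    (hΦ : ∀ j, Measurable (Φ j)) (h0 : ∀ j z, z ≤ -1 → Φ j z = 0) :
    energy (expWeight η) Φ ≤ ∑' i : ℕ,
      ENNReal.ofReal (Real.exp (-(2 + η) * ((i : ℝ) - 1))) * energy (window ((i : ℝ) - 1)) Φ := by
  let S : ℕ → Set ℝ := fun i => Set.Ioc ((i : ℝ) - 1) ((i : ℝ) - 1 + 1)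
  have hS : ∀ z, z ∉ ⋃ i, S i → z ≤ -1 := by
    intro z hz
    by_contra h
    push Not at h
    refine hz (Set.mem_iUnion.2 ⟨⌈z⌉₊, ?_, ?_⟩)
    · rcases lt_or_ge 0 z with hz0 | hz0
      · linarith [Nat.ceil_lt_add_one hz0.le]
      · rw [Nat.ceil_eq_zero.2 hz0]; simpa using h
    · linarith [Nat.le_ceil z]
  rw [energy, lintegral_expWeight _ (measurable_energy_density hΦ)]
  have h1 : ∀ z, (∑ j, ‖Φ j z‖ₑ ^ 2) * ENNReal.ofReal (Real.exp (-(1 + η) * z)) =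
      (⋃ i, S i).indicator (fun z => (∑ j, ‖Φ j z‖ₑ ^ 2) *
        ENNReal.ofReal (Real.exp (-(1 + η) * z))) z := by
    intro z
    by_cases hz : z ∈ ⋃ i, S i
    · rw [Set.indicator_of_mem hz]
    · rw [Set.indicator_of_notMem hz, Finset.sum_eq_zero, zero_mul]
      intro j _
      rw [h0 j z (hS z hz)]
      simp
  rw [lintegral_congr h1, lintegral_indicator (MeasurableSet.iUnion fun i => measurableSet_Ioc)]
  refine (lintegral_iUnion_le _ _).trans (ENNReal.tsum_le_tsum fun i => ?_)
  rw [energy, lintegral_window _ (measurable_energy_density hΦ),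
    ← lintegral_const_mul' _ _ ENNReal.ofReal_ne_top]
  refine setLIntegral_mono' measurableSet_Ioc fun z hz => ?_
  rw [mul_left_comm, ← ENNReal.ofReal_mul (Real.exp_pos _).le, ← Real.exp_add]
  gcongr
  nlinarith [hz.1]

theorem tsum_ofReal_exp_eq {η : ℝ} (hη : 0 < η) :
    ∑' i : ℕ, ENNReal.ofReal (Real.exp (-η * ((i : ℝ) - 1))) =
      ENNReal.ofReal (Real.exp η * (1 - Real.exp (-η))⁻¹) := by
  have h1 : ∀ i : ℕ, Real.exp (-η * ((i : ℝ) - 1)) = Real.exp η * Real.exp (-η) ^ i := fun i => by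
    rw [← Real.exp_nat_mul, ← Real.exp_add]; congr 1; ring
  have h2 : Real.exp (-η) < 1 := by rw [Real.exp_lt_one_iff]; linarith
  simp only [h1]
  rw [← ENNReal.ofReal_tsum_of_nonneg (fun i => by positivity)
    ((summable_geometric_of_lt_one (Real.exp_pos _).le h2).mul_left _), tsum_mul_left,
    tsum_geometric_of_lt_one (Real.exp_pos _).le h2]

end WeightedEnergy

section CorrEnergy

variable {q : ℕ} [NeZero q]

theorem hyperSum_eq_of_le {M M' : ℕ} (hM : M ≤ M') {h τ : ℝ} {z : ℝ}
    (hz : Real.exp ((z + τ) / 2) < M + 1) (j : ZMod q) :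
    hyperSum M h τ j z = hyperSum M' h τ j z := by
  rw [hyperSum, hyperSum]
  refine Finset.sum_subset (Finset.Icc_subset_Icc_right hM) fun n hn hn' => if_neg ?_
  rw [Finset.mem_Icc] at hn hn'
  have hn2 : M + 1 ≤ n := by omega
  have hn3 : Real.exp ((z + τ) / 2) < n := hz.trans_le (by exact_mod_cast hn2)
  rw [← Real.lt_log_iff_exp_lt (by exact_mod_cast hn.1)] at hn3
  linarith

theorem hyperSum_eq_of_lt {M M' : ℕ} {h τ : ℝ} {z : ℝ} (hz : Real.exp ((z + τ) / 2) < M + 1)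
    (hz' : Real.exp ((z + τ) / 2) < M' + 1) (j : ZMod q) :
    hyperSum M h τ j z = hyperSum M' h τ j z := by
  rcases le_total M M' with h' | h'
  · exact hyperSum_eq_of_le h' hz j
  · exact (hyperSum_eq_of_le h' hz' j).symm

/-- The full hyperbola sum. -/
noncomputable def hyperFull (h τ : ℝ) (j : ZMod q) (z : ℝ) : ℂ :=
  hyperSum ⌊Real.exp (z / 2 + 1)⌋₊ h τ j z

theorem measurable_hyperFull (h : ℝ) (j : ZMod q) :
    Measurable fun p : ℝ × ℝ => hyperFull h p.1 j p.2 := by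
  have h1 : Measurable fun x : (ℝ × ℝ) × ℕ => hyperSum x.2 h x.1.1 j x.1.2 := by
    refine measurable_from_prod_countable_left fun M => ?_
    simp only [hyperSum]
    refine Finset.measurable_fun_sum _ fun n _ => Measurable.ite ?_ ?_ measurable_const
    · exact measurableSet_lt (f := fun p : ℝ × ℝ => 2 * Real.log n - p.1) (by fun_prop)
        measurable_snd
    · exact (measurable_chiStep h _).comp (measurable_snd.sub_const _)
  have h2 : Measurable fun p : ℝ × ℝ => (p, ⌊Real.exp (p.2 / 2 + 1)⌋₊) :=
    measurable_id.prodMk (Nat.measurable_floor.comp (by fun_prop))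
  exact h1.comp h2

theorem measurable_hyperFull_comp (h : ℝ) (j : ZMod q) {α : Type*} [MeasurableSpace α]
    {f g : α → ℝ} (hf : Measurable f) (hg : Measurable g) :
    Measurable fun x => hyperFull h (f x) j (g x) := by
  have h1 := measurable_hyperFull h j
  generalize hyperFull (q := q) h = F at h1 ⊢
  exact h1.comp (hf.prodMk hg)

theorem measurable_hyperFull_right (h τ : ℝ) (j : ZMod q) : Measurable (hyperFull h τ j) :=
  Measurable.of_uncurry_left (f := fun τ z => hyperFull h τ j z) (measurable_hyperFull h j)

theorem hyperFull_eq {M : ℕ} {h τ : ℝ} (hτ : τ ≤ 1) {z : ℝ}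
    (hz : Real.exp ((z + τ) / 2) < M + 1) (j : ZMod q) :
    hyperFull h τ j z = hyperSum M h τ j z :=
  hyperSum_eq_of_lt ((Real.exp_le_exp.2 (by linarith)).trans_lt (Nat.lt_floor_add_one _)) hz j

theorem hyperFull_eq_zero {h τ : ℝ} (hτ : τ ≤ 1) {z : ℝ} (hz : z ≤ -1) (j : ZMod q) :
    hyperFull h τ j z = 0 := by
  rw [hyperFull, hyperSum]
  refine Finset.sum_eq_zero fun n hn => if_neg ?_
  rw [Finset.mem_Icc] at hn
  have : 0 ≤ Real.log n := Real.log_natCast_nonneg n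
  linarith

theorem twistCorr_eq_integral_hyperFull {h : ℝ} (hh : 0 < h) (hh1 : h ≤ 1) (j : ZMod q) (s : ℝ) :
    twistCorr h j s = 2 * (∫ τ in Set.Ioc 0 h, hyperFull h τ j (s + τ)) -
      (corrMain h j s : ℂ) := by
  have hM : Real.exp (s / 2 + h) < ⌊Real.exp (s / 2 + 1)⌋₊ + 1 :=
    (Real.exp_le_exp.2 (by linarith)).trans_lt (Nat.lt_floor_add_one _)
  rw [twistCorr_eq hh j hM]
  congr 2
  refine setIntegral_congr_fun measurableSet_Ioc fun τ hτ => ?_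
  refine (hyperFull_eq (hτ.2.trans hh1) ?_ j).symm
  refine lt_of_le_of_lt (Real.exp_le_exp.2 ?_) hM
  linarith [hτ.2]

theorem measurable_corrMain (h : ℝ) (j : ZMod q) : Measurable (corrMain h j) := by
  have h1 : Measurable fun p : ℝ × ℝ => (Set.Iio (p.1 / 2)).indicator (fun v => Real.exp v *
      (annDisc j (p.1 - v + h) - annDisc j (p.1 - v))) p.2 := by
    have hs : Measurable fun p : ℝ × ℝ => p.1 - p.2 := measurable_fst.sub measurable_snd
    have hf : Measurable fun p : ℝ × ℝ => Real.exp p.2 *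
        (annDisc j (p.1 - p.2 + h) - annDisc j (p.1 - p.2)) :=
      (Real.measurable_exp.comp measurable_snd).mul
        (((measurable_annDisc j).comp (hs.add_const h)).sub ((measurable_annDisc j).comp hs))
    exact hf.indicator (s := {p : ℝ × ℝ | p.2 < p.1 / 2})
      (measurableSet_lt measurable_snd (measurable_fst.div_const 2))
  have h2 : Measurable fun s => ∫ v, (Set.Iio (s / 2)).indicator (fun v => Real.exp v *
      (annDisc j (s - v + h) - annDisc j (s - v))) v :=
    (h1.stronglyMeasurable.integral_prod_right' (ν := volume)).measurable
  have h3 : corrMain h j = fun s => 2 * ((Real.exp h - 1) * ∫ v, (Set.Iio (s / 2)).indicator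
      (fun v => Real.exp v * (annDisc j (s - v + h) - annDisc j (s - v))) v) := by
    ext s
    rw [corrMain, integral_indicator measurableSet_Iio]
  rw [h3]
  exact (h2.const_mul _).const_mul _

theorem energy_corrMain_le {η : ℝ} (hη : 0 < η) (hη1 : η ≤ 1 / 4) {h : ℝ} (hh : 0 < h)
    (hh1 : h ≤ 1) : energy (expWeight η) (fun (j : ZMod q) s => (corrMain h j s : ℂ)) ≤
      ENNReal.ofReal (q * (400 * h ^ 4 * (2 / η))) := by
  have hm : ∀ j : ZMod q, Measurable fun s => (corrMain h j s : ℂ) := fun j =>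
    Complex.measurable_ofReal.comp (measurable_corrMain h j)
  have key : ∀ (j : ZMod q) s, corrMain h j s ^ 2 * Real.exp (-(1 + η) * s) ≤
      400 * h ^ 4 * Real.exp (-(η * |s|)) := by
    intro j s
    have h1 : ∀ θ : ℝ, 0 ≤ θ → θ ≤ 1 / 2 → (1 + θ) * s + -(1 + η) * s ≤ -(η * |s|) →
        corrMain h j s ^ 2 * Real.exp (-(1 + η) * s) ≤ 400 * h ^ 4 * Real.exp (-(η * |s|)) := by
      intro θ h0 h1 h2
      have h3 := pow_le_pow_left₀ (abs_nonneg _) (abs_corrMain_le hh hh1 j h0 h1 s) 2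
      rw [sq_abs, mul_pow, ← Real.exp_nat_mul] at h3
      calc _ ≤ (20 * h ^ 2) ^ 2 * Real.exp ((2 : ℕ) * ((1 + θ) * s / 2)) *
            Real.exp (-(1 + η) * s) := by gcongr
        _ = 400 * h ^ 4 * Real.exp ((1 + θ) * s + -(1 + η) * s) := by
            rw [Real.exp_add]; push_cast; ring_nf
        _ ≤ _ := by gcongr
    rcases le_total 0 s with hs | hs
    · refine h1 0 le_rfl (by norm_num) ?_
      rw [abs_of_nonneg hs]; linarith
    · refine h1 (1 / 2) (by norm_num) le_rfl ?_
      rw [abs_of_nonpos hs]; nlinarith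
  rw [energy, lintegral_expWeight _ (measurable_energy_density hm)]
  have hi := (integrable_exp_neg_abs hη).const_mul (q * (400 * h ^ 4))
  have h2 : (q : ℝ) * (400 * h ^ 4 * (2 / η)) =
      ∫ s, q * (400 * h ^ 4) * Real.exp (-(η * |s|)) := by
    rw [integral_const_mul, integral_exp_neg_abs hη]; ring
  rw [h2, ofReal_integral_eq_lintegral_ofReal hi
    (Filter.Eventually.of_forall fun s => by positivity)]
  refine lintegral_mono fun s => ?_
  simp only [enorm_ofReal_sq]
  rw [Finset.sum_mul]
  calc _ ≤ ∑ _j : ZMod q, ENNReal.ofReal (400 * h ^ 4 * Real.exp (-(η * |s|))) := by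
        refine Finset.sum_le_sum fun j _ => ?_
        rw [← ENNReal.ofReal_mul (sq_nonneg _)]
        exact ENNReal.ofReal_le_ofReal (key j s)
    _ = _ := by
        rw [Finset.sum_const, Finset.card_univ, ZMod.card, nsmul_eq_mul,
          mul_assoc (q : ℝ), ENNReal.ofReal_mul (p := (q : ℝ)) (by positivity),
          ENNReal.ofReal_natCast]

theorem exists_energy_hyperFull_le {η : ℝ} (hη : 0 < η) (hη1 : η ≤ 1 / 2) : ∃ C : ℝ, 1 ≤ C ∧
    ∀ (q : ℕ) [NeZero q] (h τ : ℝ), 0 < h → h ≤ 1 → τ ≤ 1 →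
      energy (expWeight η) (hyperFull (q := q) h τ) ≤
        ENNReal.ofReal (C * ((q : ℝ) ^ (1 + 3 * η) * h ^ (1 - 2 * η))) := by
  obtain ⟨C, hC, H⟩ := exists_energy_hyperSum_le hη hη1
  have hS0 : 0 ≤ Real.exp η * (1 - Real.exp (-η))⁻¹ := by
    have h2 : Real.exp (-η) < 1 := by rw [Real.exp_lt_one_iff]; linarith
    have h3 : 0 < 1 - Real.exp (-η) := by linarith
    positivity
  refine ⟨C * (Real.exp η * (1 - Real.exp (-η))⁻¹) + 1, by
    linarith [mul_nonneg (zero_le_one.trans hC) hS0], fun q _ h τ h0 h1 hτ => ?_⟩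
  have hm : ∀ j : ZMod q, Measurable (hyperFull h τ j) := fun j =>
    measurable_hyperFull_right h τ j
  set Q : ℝ := (q : ℝ) ^ (1 + 3 * η) * h ^ (1 - 2 * η) with hQ
  have hQ0 : 0 ≤ Q := by positivity
  refine (energy_expWeight_le_tsum_window hη hm fun j z hz => hyperFull_eq_zero hτ hz j).trans ?_
  have hwin : ∀ k : ℝ, energy (window k) (hyperFull (q := q) h τ) ≤
      ENNReal.ofReal (C * (Q * Real.exp k ^ 2)) := by
    intro k
    have h3 : Real.exp 1 < 3 := Real.exp_one_lt_three
    have hfl : (⌊3 * Real.exp (k / 2)⌋₊ : ℝ) ≤ 3 * Real.exp (k / 2) :=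
      Nat.floor_le (by positivity)
    rw [energy_congr (Ψ := hyperSum ⌊3 * Real.exp (k / 2)⌋₊ h τ)]
    · refine H q h τ k _ h0 h1 ((pow_le_pow_left₀ (by positivity) hfl 2).trans (le_of_eq ?_))
      rw [mul_pow, ← Real.exp_nat_mul]
      push_cast
      ring_nf
    · refine ae_window fun z _ hz2 j => hyperFull_eq hτ ?_ j
      refine lt_of_le_of_lt ?_ (Nat.lt_floor_add_one _)
      calc _ ≤ Real.exp (1 + k / 2) := Real.exp_le_exp.2 (by linarith)
        _ = Real.exp 1 * Real.exp (k / 2) := Real.exp_add _ _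
        _ ≤ _ := by gcongr
  clear_value Q
  calc _ ≤ ∑' i : ℕ, ENNReal.ofReal (C * Q) * ENNReal.ofReal (Real.exp (-η * ((i : ℝ) - 1))) := by
        refine ENNReal.tsum_le_tsum fun i => (mul_le_mul_right (hwin _) _).trans (le_of_eq ?_)
        rw [← ENNReal.ofReal_mul (Real.exp_pos _).le, ← ENNReal.ofReal_mul (by positivity)]
        congr 1
        rw [← Real.exp_nat_mul, show -η * ((i : ℝ) - 1) =
          -(2 + η) * ((i : ℝ) - 1) + (2 : ℕ) * ((i : ℝ) - 1) by push_cast; ring, Real.exp_add]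
        ring
    _ = ENNReal.ofReal (C * Q * (Real.exp η * (1 - Real.exp (-η))⁻¹)) := by
        rw [ENNReal.tsum_mul_left, tsum_ofReal_exp_eq hη, ENNReal.ofReal_mul (p := C * Q)
          (by positivity)]
    _ ≤ _ := ENNReal.ofReal_le_ofReal (by nlinarith)

theorem exists_energy_twistCorr_le {η : ℝ} (hη : 0 < η) (hη1 : η ≤ 1 / 4) : ∃ C : ℝ, 1 ≤ C ∧
    ∀ (q : ℕ) [NeZero q] (h : ℝ), 0 < h → h ≤ 1 →
      energy (expWeight η) (twistCorr (q := q) h) ≤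
        ENNReal.ofReal (C * ((q : ℝ) ^ (1 + 3 * η) * h ^ (3 - 2 * η))) := by
  obtain ⟨C, hC, H⟩ := exists_energy_hyperFull_le hη (by linarith : η ≤ 1 / 2)
  refine ⟨2 * (4 * (Real.exp 2 * C) + 400 * (2 / η)), ?_, fun q _ h h0 h1 => ?_⟩
  · have h2 : 8 ≤ 2 / η := by rw [le_div_iff₀ hη]; linarith
    have := mul_pos (Real.exp_pos 2) (one_pos.trans_le hC)
    linarith
  have hq1 : (1 : ℝ) ≤ q := by exact_mod_cast NeZero.one_le
  set Q : ℝ := (q : ℝ) ^ (1 + 3 * η) * h ^ (1 - 2 * η) with hQ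
  have hQ0 : 0 ≤ Q := by positivity
  have hQh : (q : ℝ) ^ (1 + 3 * η) * h ^ (3 - 2 * η) = Q * h ^ 2 := by
    rw [hQ, mul_assoc, ← Real.rpow_natCast h 2, ← Real.rpow_add h0]
    congr 2
    push_cast
    ring
  have hFm : ∀ j : ZMod q, Measurable fun p : ℝ × ℝ => hyperFull h p.1 j (p.2 + p.1) := fun j =>
    measurable_hyperFull_comp h j measurable_fst (measurable_snd.add measurable_fst)
  have hIm : ∀ j : ZMod q, Measurable fun s => ∫ τ in Set.Ioc 0 h, hyperFull h τ j (s + τ) :=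
    fun j => ((hFm j).stronglyMeasurable.integral_prod_left').measurable
  have hA : energy (expWeight η) (fun (j : ZMod q) s => ∫ τ in Set.Ioc 0 h, hyperFull h τ j (s + τ))
      ≤ ENNReal.ofReal (Real.exp 2 * C * (Q * h ^ 2)) := by
    refine (energy_integral_le _ _ (F := fun τ (j : ZMod q) s => hyperFull h τ j (s + τ)) hFm).trans ?_
    have h3 : ∫⁻ τ in Set.Ioc 0 h, energy (expWeight η) (fun (j : ZMod q) s =>
        hyperFull h τ j (s + τ)) ≤ ∫⁻ τ in Set.Ioc 0 h, ENNReal.ofReal (Real.exp 2 * (C * Q)) := by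
      refine setLIntegral_mono' measurableSet_Ioc fun τ hτ => ?_
      refine (energy_expWeight_translate_le (by linarith) hτ.1.le (hτ.2.trans h1)
        (Φ := hyperFull h τ) (measurable_hyperFull_right h τ)).trans ?_
      rw [ENNReal.ofReal_mul (p := Real.exp 2) (Real.exp_pos _).le]
      gcongr
      exact H q h τ h0 h1 (hτ.2.trans h1)
    refine (mul_le_mul_right h3 _).trans (le_of_eq ?_)
    rw [setLIntegral_const, Real.volume_Ioc, sub_zero, ← ENNReal.ofReal_mul (by positivity),
      ← ENNReal.ofReal_mul h0.le]
    congr 1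
    ring
  have hB := energy_corrMain_le (q := q) hη hη1 h0 h1
  have hdom : (q : ℝ) * h ^ 4 ≤ Q * h ^ 2 := by
    have h3 : (q : ℝ) ≤ (q : ℝ) ^ (1 + 3 * η) := by
      conv_lhs => rw [← Real.rpow_one (q : ℝ)]
      exact Real.rpow_le_rpow_of_exponent_le hq1 (by linarith)
    have h4 : h ^ 2 ≤ h ^ (1 - 2 * η) := by
      rw [← Real.rpow_natCast]
      exact Real.rpow_le_rpow_of_exponent_ge h0 h1 (by push_cast; linarith)
    calc (q : ℝ) * h ^ 4 = q * h ^ 2 * h ^ 2 := by ring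
      _ ≤ _ := by rw [hQ]; gcongr
  have heq : energy (expWeight η) (twistCorr (q := q) h) = energy (expWeight η) (fun (j : ZMod q) s =>
      2 * (∫ τ in Set.Ioc 0 h, hyperFull h τ j (s + τ)) - (corrMain h j s : ℂ)) :=
    energy_congr (Filter.Eventually.of_forall fun s j => twistCorr_eq_integral_hyperFull h0 h1 j s)
  rw [heq, hQh]
  refine (energy_sub_le _ (fun j => (hIm j).const_mul 2) _).trans ?_
  have hA2 := energy_mul_le (expWeight η) (fun (j : ZMod q) s =>
    ∫ τ in Set.Ioc 0 h, hyperFull h τ j (s + τ)) (g := fun _ => 2) (B := 2)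
    (Filter.Eventually.of_forall fun _ => by simp)
  calc _ ≤ 2 * (ENNReal.ofReal (2 ^ 2) * ENNReal.ofReal (Real.exp 2 * C * (Q * h ^ 2)) +
          ENNReal.ofReal (q * (400 * h ^ 4 * (2 / η)))) := by
        gcongr
        exact hA2.trans (by gcongr)
    _ = ENNReal.ofReal (2 * (2 ^ 2 * (Real.exp 2 * C * (Q * h ^ 2)) +
          q * (400 * h ^ 4 * (2 / η)))) := by
        rw [ENNReal.ofReal_mul (p := (2 : ℝ)) (by norm_num), ENNReal.ofReal_add (by positivity)
          (by positivity), ENNReal.ofReal_mul (p := (2 : ℝ) ^ 2) (by norm_num), ENNReal.ofReal_ofNat]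
    _ ≤ _ := by
        refine ENNReal.ofReal_le_ofReal ?_
        have : (q : ℝ) * h ^ 4 * (400 * (2 / η)) ≤ Q * h ^ 2 * (400 * (2 / η)) := by gcongr
        linarith

end CorrEnergy

section TriStep

variable {q : ℕ} [NeZero q]

theorem sq_lintegral_mul_le {α : Type*} [MeasurableSpace α] (μ : Measure α) {f g : α → ENNReal}
    (hf : AEMeasurable f μ) (hg : AEMeasurable g μ) :
    (∫⁻ x, f x * g x ∂μ) ^ 2 ≤ (∫⁻ x, f x ^ 2 ∂μ) * ∫⁻ x, g x ^ 2 ∂μ := by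
  have h := ENNReal.lintegral_mul_le_Lp_mul_Lq μ Real.HolderConjugate.two_two hf hg
  simp only [Pi.mul_apply] at h
  have h2 := pow_le_pow_left₀ zero_le h 2
  rw [mul_pow, ← ENNReal.rpow_natCast (_ ^ _), ← ENNReal.rpow_natCast (_ ^ _), ← ENNReal.rpow_mul,
    ← ENNReal.rpow_mul] at h2
  norm_num at h2
  exact h2

theorem ofReal_l2_integral_le {k : ℝ → ZMod q → ℂ} (hk : ∀ a, Integrable fun s => k s a) :
    ENNReal.ofReal (l2 (fun a => ∫ s, k s a)) ≤ ∫⁻ s, ENNReal.ofReal (l2 (k s)) := by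
  have h1 : WithLp.toLp 2 (fun a => ∫ s, k s a) = ∫ s, WithLp.toLp 2 (k s) := by
    ext a
    exact (eval_integral_piLp (f := fun s => WithLp.toLp 2 (k s)) hk a).symm
  rw [l2, h1]
  simp only [l2, ofReal_norm]
  exact enorm_integral_le_lintegral_enorm _

theorem integrable_tri_term (h t : ℝ) (c : ℂ) (r₁ r₂ r₃ : ZMod q) : Integrable fun s =>
    c * ((step h r₁ (t - s) * conv (step h r₂) (step h r₃) s : ℝ) : ℂ) := by
  have h1 : Adm (1 / 4) (conv (step h r₂) (step h r₃)) := by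
    have := (adm_step h r₂).conv (adm_step h r₃) (by norm_num)
    norm_num at this
    norm_num
    exact this
  exact ((((adm_step h r₁).mono (by norm_num)).integrable_conv h1 (by norm_num) t).ofReal).const_mul _

theorem stepOp_twistCorr_eq (h t s : ℝ) (a : ZMod q) :
    stepOp h (t - s) (fun c => twistCorr h c s) a = ∑ r₁, ∑ r₂, ∑ r₃, χ (a * r₁ * r₂ * r₃) *
      ((step h r₁ (t - s) * conv (step h r₂) (step h r₃) s : ℝ) : ℂ) := by
  simp only [stepOp, twistCorr, Finset.mul_sum]
  refine Finset.sum_congr rfl fun r₁ _ => Finset.sum_congr rfl fun r₂ _ =>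
    Finset.sum_congr rfl fun r₃ _ => ?_
  push_cast
  ring

theorem integrable_stepOp_twistCorr (h t : ℝ) (a : ZMod q) :
    Integrable fun s => stepOp h (t - s) (fun c => twistCorr h c s) a := by
  simp only [stepOp_twistCorr_eq]
  exact integrable_finsetSum _ fun r₁ _ => integrable_finsetSum _ fun r₂ _ =>
    integrable_finsetSum _ fun r₃ _ => integrable_tri_term h t _ r₁ r₂ r₃

theorem tri_step_eq_integral (h t : ℝ) (a : ZMod q) :
    tri (step h) a t = ∫ s, stepOp h (t - s) (fun c => twistCorr h c s) a := by
  simp only [stepOp_twistCorr_eq]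
  rw [tri, integral_finsetSum _ fun r₁ _ => integrable_finsetSum _ fun r₂ _ =>
    integrable_finsetSum _ fun r₃ _ => integrable_tri_term h t _ r₁ r₂ r₃]
  refine Finset.sum_congr rfl fun r₁ _ => ?_
  rw [integral_finsetSum _ fun r₂ _ =>
    integrable_finsetSum _ fun r₃ _ => integrable_tri_term h t _ r₁ r₂ r₃]
  refine Finset.sum_congr rfl fun r₂ _ => ?_
  rw [integral_finsetSum _ fun r₃ _ => integrable_tri_term h t _ r₁ r₂ r₃]
  refine Finset.sum_congr rfl fun r₃ _ => ?_
  rw [integral_const_mul, integral_complex_ofReal]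
  rfl

theorem exists_l2_tri_step_sq_le {η : ℝ} (hη : 0 < η) (hη1 : η ≤ 1 / 4) : ∃ C : ℝ, 1 ≤ C ∧
    ∀ (q : ℕ) [NeZero q] (h t : ℝ), 0 < h → h ≤ 1 →
      l2 (fun a : ZMod q => tri (step h) a t) ^ 2 ≤
        C * ((q : ℝ) ^ (3 / 2 + 7 * η) * h ^ (4 - 2 * η) * Real.exp ((1 + η) * t)) := by
  obtain ⟨C1, hC1, H1⟩ := exists_opBound hη (by linarith : η ≤ 1 / 2)
  obtain ⟨C2, hC2, H2⟩ := exists_energy_twistCorr_le hη hη1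
  refine ⟨C1 * C2, one_le_mul_of_one_le_of_one_le hC1 hC2, fun q _ h t h0 h1 => ?_⟩
  obtain ⟨W, hW, hW0, hop, hWi⟩ := H1 q h h0 h1
  have hE := H2 q h h0 h1
  have hq : (0 : ℝ) < q := q_pos
  let f : ℝ → ENNReal := fun s =>
    ENNReal.ofReal (Real.sqrt (W (t - s) * Real.exp (-(1 + η) * (t - s))))
  let g : ℝ → ENNReal := fun s =>
    ENNReal.ofReal (Real.sqrt ((∑ a : ZMod q, ‖twistCorr h a s‖ ^ 2) * Real.exp (-(1 + η) * s)))
  have hf : Measurable f := by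
    have : Measurable fun s => W (t - s) := hW.comp (measurable_const.sub measurable_id)
    exact ENNReal.measurable_ofReal.comp (Real.continuous_sqrt.measurable.comp
      (this.mul (by fun_prop)))
  have hg : Measurable g := by
    have : Measurable fun s => ∑ a : ZMod q, ‖twistCorr h a s‖ ^ 2 :=
      Finset.measurable_fun_sum _ fun a _ => (measurable_twistCorr h a).norm.pow_const 2
    exact ENNReal.measurable_ofReal.comp (Real.continuous_sqrt.measurable.comp
      (this.mul (by fun_prop)))
  have hf2 : ∫⁻ s, f s ^ 2 ≤ ENNReal.ofReal (C1 * (Real.sqrt q * h * (q : ℝ) ^ (4 * η))) := by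
    refine le_trans (le_of_eq ?_) hWi
    rw [← lintegral_sub_left_eq_self (fun z => ENNReal.ofReal (W z * Real.exp (-(1 + η) * z))) t]
    refine lintegral_congr fun s => ?_
    simp only [f]
    rw [← ENNReal.ofReal_pow (Real.sqrt_nonneg _),
      Real.sq_sqrt (mul_nonneg (hW0 _) (Real.exp_pos _).le)]
  have hg2 : ∫⁻ s, g s ^ 2 ≤ ENNReal.ofReal (C2 * ((q : ℝ) ^ (1 + 3 * η) * h ^ (3 - 2 * η))) := by
    refine le_trans (le_of_eq ?_) hE
    rw [energy, lintegral_expWeight _ (measurable_energy_density (measurable_twistCorr h))]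
    refine lintegral_congr fun s => ?_
    simp only [g]
    rw [← ENNReal.ofReal_pow (Real.sqrt_nonneg _), Real.sq_sqrt (by positivity),
      ENNReal.ofReal_mul (by positivity), ENNReal.ofReal_sum_of_nonneg fun _ _ => by positivity]
    simp only [ENNReal.ofReal_pow (norm_nonneg _), ofReal_norm]
  have hpt : ∀ s, ENNReal.ofReal (l2 (fun a : ZMod q => stepOp h (t - s) (fun c => twistCorr h c s) a)) ≤
      ENNReal.ofReal (Real.exp ((1 + η) * t / 2)) * (f s * g s) := by
    intro s
    simp only [f, g]
    rw [← ENNReal.ofReal_mul (Real.sqrt_nonneg _), ← ENNReal.ofReal_mul (Real.exp_pos _).le]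
    refine ENNReal.ofReal_le_ofReal ((sq_le_sq₀ (l2_nonneg _) (by positivity)).1 ?_)
    rw [mul_pow, mul_pow, Real.sq_sqrt (mul_nonneg (hW0 _) (Real.exp_pos _).le),
      Real.sq_sqrt (by positivity), ← l2_sq, ← Real.exp_nat_mul]
    refine (hop _ _).trans (le_of_eq ?_)
    have h3 : Real.exp ((2 : ℕ) * ((1 + η) * t / 2)) * (Real.exp (-(1 + η) * (t - s)) *
        Real.exp (-(1 + η) * s)) = 1 := by
      rw [← Real.exp_add, ← Real.exp_add, Real.exp_eq_one_iff]
      push_cast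
      ring
    calc W (t - s) * l2 (fun c => twistCorr h c s) ^ 2
        = W (t - s) * l2 (fun c => twistCorr h c s) ^ 2 *
          (Real.exp ((2 : ℕ) * ((1 + η) * t / 2)) * (Real.exp (-(1 + η) * (t - s)) *
        Real.exp (-(1 + η) * s))) := by rw [h3, mul_one]
      _ = _ := by ring
  have hY : ENNReal.ofReal (l2 (fun a : ZMod q => tri (step h) a t)) ^ 2 ≤
      ENNReal.ofReal (C1 * C2 * ((q : ℝ) ^ (3 / 2 + 7 * η) * h ^ (4 - 2 * η) *
        Real.exp ((1 + η) * t))) := by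
    simp only [tri_step_eq_integral]
    calc _ ≤ (∫⁻ s, ENNReal.ofReal (Real.exp ((1 + η) * t / 2)) * (f s * g s)) ^ 2 := by
          gcongr
          exact (ofReal_l2_integral_le fun a => integrable_stepOp_twistCorr h t a).trans
            (lintegral_mono hpt)
      _ = ENNReal.ofReal (Real.exp ((1 + η) * t)) * (∫⁻ s, f s * g s) ^ 2 := by
          rw [lintegral_const_mul' _ _ ENNReal.ofReal_ne_top, mul_pow,
            ← ENNReal.ofReal_pow (Real.exp_pos _).le, ← Real.exp_nat_mul]
          congr 3
          push_cast
          ring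
      _ ≤ ENNReal.ofReal (Real.exp ((1 + η) * t)) *
          (ENNReal.ofReal (C1 * (Real.sqrt q * h * (q : ℝ) ^ (4 * η))) *
            ENNReal.ofReal (C2 * ((q : ℝ) ^ (1 + 3 * η) * h ^ (3 - 2 * η)))) := by
          gcongr
          exact (sq_lintegral_mul_le _ hf.aemeasurable hg.aemeasurable).trans (by gcongr)
      _ = _ := by
          rw [← ENNReal.ofReal_mul (by positivity), ← ENNReal.ofReal_mul (by positivity)]
          congr 1
          have h4 : (q : ℝ) ^ (3 / 2 + 7 * η) =
              Real.sqrt q * (q : ℝ) ^ (4 * η) * (q : ℝ) ^ (1 + 3 * η) := by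
            rw [Real.sqrt_eq_rpow, ← Real.rpow_add hq, ← Real.rpow_add hq]
            congr 1
            ring
          have h5 : h ^ (4 - 2 * η) = h * h ^ (3 - 2 * η) := by
            rw [show 4 - 2 * η = 1 + (3 - 2 * η) by ring, Real.rpow_add h0, Real.rpow_one]
          rw [h4, h5]
          ring
  rw [← ENNReal.ofReal_pow (l2_nonneg _)] at hY
  exact (ENNReal.ofReal_le_ofReal_iff (by positivity)).1 hY

end TriStep

/-! ### Second differences of `tri disc` by dyadic telescoping -/

section SecondDiff

variable {q : ℕ} [NeZero q]

/-- The normalised second difference of `tri disc a`. -/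
noncomputable def secondDiff (h t : ℝ) (a : ZMod q) : ℂ :=
  (tri disc a (t + 2 * h) - 2 * tri disc a (t + h) + tri disc a t) / h ^ 2

theorem secondDiff_eq_two_mul {h : ℝ} (h0 : 0 < h) (t : ℝ) (a : ZMod q) :
    secondDiff h t a = secondDiff (2 * h) t a -
      1 / (4 * h ^ 2) * (tri (step h) a (t + h) + 3 * tri (step h) a t) := by
  have hh : (h : ℂ) ≠ 0 := by exact_mod_cast h0.ne'
  rw [secondDiff, secondDiff, tri_step, tri_step, show t + h + 3 * h = t + 2 * (2 * h) by ring,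
    show t + h + 2 * h = t + 3 * h by ring, show t + h + h = t + 2 * h by ring]
  push_cast
  field_simp
  ring

theorem secondDiff_one_eq (t : ℝ) (a : ZMod q) :
    secondDiff 1 t a = secondDiff 1 (t - 1) a + tri (step 1) a (t - 1) := by
  rw [secondDiff, secondDiff, tri_step, show t - 1 + 3 * 1 = t + 2 * 1 by ring,
    show t - 1 + 2 * 1 = t + 1 by ring, show t - 1 + 1 = t by ring]
  push_cast
  ring

theorem tendsto_tri_disc (a : ZMod q) :
    Filter.Tendsto (fun t => tri disc a t) Filter.atBot (nhds 0) := by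
  have h1 : Filter.Tendsto (fun t : ℝ => (1 - 1 / 2) * t) Filter.atBot Filter.atBot :=
    Filter.tendsto_id.const_mul_atBot (by norm_num)
  refine squeeze_zero_norm (norm_tri_disc_le (by norm_num) le_rfl a) ?_
  have h2 := (Real.tendsto_exp_atBot.comp h1).const_mul
    (32 / (1 / 2 : ℝ) ^ 2 * (q : ℝ) ^ (3 * (1 / 2) : ℝ))
  rwa [mul_zero] at h2

theorem tendsto_secondDiff_one (t : ℝ) (a : ZMod q) :
    Filter.Tendsto (fun n : ℕ => secondDiff 1 (t - n) a) Filter.atTop (nhds 0) := by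
  have h1 : ∀ c : ℝ, Filter.Tendsto (fun n : ℕ => tri disc a (t - n + c)) Filter.atTop (nhds 0) := by
    intro c
    refine (tendsto_tri_disc a).comp ?_
    refine Filter.tendsto_atBot_add_const_right _ c ?_
    simp only [sub_eq_add_neg]
    exact Filter.tendsto_atBot_add_const_left _ t
      (Filter.tendsto_neg_atTop_atBot.comp tendsto_natCast_atTop_atTop)
  have h2 := (((h1 (2 * 1)).sub ((h1 1).const_mul 2)).add (h1 0)).div_const ((1 : ℂ) ^ 2)
  simpa [secondDiff] using h2

theorem tendsto_l2_secondDiff_one (t : ℝ) :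
    Filter.Tendsto (fun n : ℕ => l2 (secondDiff (q := q) 1 (t - n))) Filter.atTop (nhds 0) := by
  have h1 : Filter.Tendsto (fun n : ℕ => l2 (secondDiff (q := q) 1 (t - n)) ^ 2) Filter.atTop
      (nhds 0) := by
    simp only [l2_sq]
    have := tendsto_finsetSum Finset.univ fun (a : ZMod q) _ =>
      ((tendsto_secondDiff_one t a).norm.pow 2)
    simpa using this
  have h2 := (Real.continuous_sqrt.tendsto 0).comp h1
  simpa [Function.comp_def, Real.sqrt_sq (l2_nonneg _)] using h2

/-- If the third differences are small in mean square, so are the second differences. -/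
theorem l2_secondDiff_le {η B : ℝ} (hη : 0 < η) (hη1 : η ≤ 1 / 4) (hB : 0 ≤ B)
    (H : ∀ h t : ℝ, 0 < h → h ≤ 1 → l2 (fun a : ZMod q => tri (step h) a t) ≤
      B * (h ^ (2 - η) * Real.exp ((1 + η) * t / 2))) (I : ℕ) (t : ℝ) :
    l2 (secondDiff (q := q) ((1 / 2) ^ I) t) ≤
      (2 + 2 / (1 - 2 ^ (-η))) * B * (2 ^ (I * η) * Real.exp ((1 + η) * t / 2)) := by
  have h21 : (2 : ℝ) ^ (-η) < 1 := Real.rpow_lt_one_of_one_lt_of_neg (by norm_num) (by linarith)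
  set D := 2 / (1 - (2 : ℝ) ^ (-η)) with hD
  have hD0 : 0 ≤ D := div_nonneg (by norm_num) (by linarith)
  have hDe : D * (1 - 2 ^ (-η)) = 2 := div_mul_cancel₀ _ (by linarith)
  induction I with
  | zero =>
    have hstep : ∀ n : ℕ, l2 (secondDiff (q := q) 1 t) ≤ l2 (secondDiff (q := q) 1 (t - n)) +
        2 * B * (Real.exp ((1 + η) * t / 2) - Real.exp ((1 + η) * (t - n) / 2)) := by
      intro n
      induction n with
      | zero => simp
      | succ n ih =>
        refine ih.trans ?_
        have h1 : l2 (secondDiff (q := q) 1 (t - n)) ≤ l2 (secondDiff (q := q) 1 (t - (n + 1 : ℕ))) +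
            B * Real.exp ((1 + η) * (t - (n + 1 : ℕ)) / 2) := by
          have h2 := H 1 (t - (n + 1 : ℕ)) one_pos le_rfl
          rw [Real.one_rpow, one_mul] at h2
          have h3 : secondDiff (q := q) 1 (t - n) = fun a => secondDiff 1 (t - (n + 1 : ℕ)) a +
              tri (step 1) a (t - (n + 1 : ℕ)) := by
            funext a
            rw [secondDiff_one_eq]
            push_cast
            rw [sub_sub]
          rw [h3]
          exact (l2_add_le _ _).trans (by gcongr)
        have h4 : 3 / 2 * Real.exp ((1 + η) * (t - (n + 1 : ℕ)) / 2) ≤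
            Real.exp ((1 + η) * (t - n) / 2) := by
          rw [show (1 + η) * (t - n) / 2 = (1 + η) / 2 + (1 + η) * (t - (n + 1 : ℕ)) / 2 by
            push_cast; ring, Real.exp_add]
          gcongr
          have := Real.add_one_le_exp ((1 + η) / 2)
          linarith
        nlinarith
    have hlim := ge_of_tendsto' ((tendsto_l2_secondDiff_one (q := q) t).add_const
      (2 * B * Real.exp ((1 + η) * t / 2))) (b := l2 (secondDiff (q := q) 1 t)) (fun n => by
        refine (hstep n).trans ?_
        gcongr
        linarith [Real.exp_pos ((1 + η) * (t - n) / 2)])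
    simp only [pow_zero, Nat.cast_zero, zero_mul, Real.rpow_zero, one_mul]
    refine hlim.trans ?_
    rw [zero_add]
    have : 0 ≤ D * B * Real.exp ((1 + η) * t / 2) := by positivity
    nlinarith
  | succ I ih =>
    set h : ℝ := (1 / 2) ^ (I + 1) with hh
    have h0 : 0 < h := by positivity
    have h1 : h ≤ 1 / 2 := by
      rw [hh, pow_succ]
      have : ((1 : ℝ) / 2) ^ I ≤ 1 := pow_le_one₀ (by norm_num) (by norm_num)
      linarith
    have h2h : 2 * h = (1 / 2) ^ I := by rw [hh, pow_succ]; ring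
    rw [← h2h] at ih
    have heq : secondDiff (q := q) h t = fun a => secondDiff (2 * h) t a -
        ((1 / (4 * h ^ 2) : ℝ) : ℂ) * (tri (step h) a (t + h) + (3 : ℂ) * tri (step h) a t) := by
      funext a
      rw [secondDiff_eq_two_mul h0]
      push_cast
      ring
    have hp : h ^ (2 - η) = h ^ 2 * 2 ^ ((I + 1 : ℕ) * η) := by
      rw [sub_eq_add_neg, Real.rpow_add h0, Real.rpow_two]
      congr 1
      rw [hh, ← Real.rpow_natCast, ← Real.rpow_mul (by norm_num), one_div,
        Real.inv_rpow (by norm_num), ← Real.rpow_neg (by norm_num)]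
      congr 1
      ring
    have hI : (2 : ℝ) ^ (I * η) = 2 ^ ((I + 1 : ℕ) * η) * 2 ^ (-η) := by
      rw [← Real.rpow_add (by norm_num)]
      congr 1
      push_cast
      ring
    have hexp : Real.exp ((1 + η) * (t + h) / 2) ≤ 3 * Real.exp ((1 + η) * t / 2) := by
      rw [show (1 + η) * (t + h) / 2 = (1 + η) * h / 2 + (1 + η) * t / 2 by ring, Real.exp_add]
      gcongr
      have : Real.exp ((1 + η) * h / 2) ≤ Real.exp 1 := by
        gcongr
        nlinarith
      linarith [Real.exp_one_lt_d9]
    set X := Real.exp ((1 + η) * t / 2) with hX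
    have hX0 : 0 < X := Real.exp_pos _
    set P : ℝ := 2 ^ ((I + 1 : ℕ) * η) with hPdef
    have hP0 : 0 < P := by positivity
    have hthird : 1 / (4 * h ^ 2) * (l2 (fun a : ZMod q => tri (step h) a (t + h)) +
        3 * l2 (fun a : ZMod q => tri (step h) a t)) ≤ 2 * (B * (P * X)) := by
      have e1 := H h (t + h) h0 (by linarith)
      have e2 := H h t h0 (by linarith)
      rw [hp] at e1 e2
      rw [div_mul_eq_mul_div, one_mul, div_le_iff₀ (by positivity)]
      have e3 : B * (h ^ 2 * P * Real.exp ((1 + η) * (t + h) / 2)) ≤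
          B * (h ^ 2 * P * (3 * X)) := by gcongr
      have e4 : 0 ≤ B * (h ^ 2 * P * X) := by positivity
      nlinarith
    rw [heq]
    refine (l2_sub_le _ _).trans ?_
    rw [l2_const_mul, Complex.norm_real, Real.norm_of_nonneg (by positivity)]
    have hadd : l2 (fun a : ZMod q => tri (step h) a (t + h) + (3 : ℂ) * tri (step h) a t) ≤
        l2 (fun a : ZMod q => tri (step h) a (t + h)) +
        3 * l2 (fun a : ZMod q => tri (step h) a t) := by
      refine (l2_add_le _ _).trans (le_of_eq ?_)
      rw [l2_const_mul]
      norm_num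
    have h5 := mul_le_mul_of_nonneg_left hadd (by positivity : 0 ≤ 1 / (4 * h ^ 2))
    rw [hI] at ih
    have h6 : (2 : ℝ) ^ (-η) ≤ 1 := h21.le
    have h7 : (2 + D) * B * (P * 2 ^ (-η) * X) + 2 * (B * (P * X)) ≤ (2 + D) * B * (P * X) := by
      have e1 : (2 + D) * 2 ^ (-η) + 2 ≤ 2 + D := by nlinarith
      have e2 : 0 ≤ B * (P * X) := by positivity
      nlinarith [mul_le_mul_of_nonneg_right e1 e2]
    linarith

theorem exists_l2_secondDiff_sq_le {η : ℝ} (hη : 0 < η) (hη1 : η ≤ 1 / 4) : ∃ C : ℝ, 1 ≤ C ∧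
    ∀ (q : ℕ) [NeZero q] (I : ℕ) (t : ℝ), l2 (secondDiff (q := q) ((1 / 2) ^ I) t) ^ 2 ≤
      C * ((q : ℝ) ^ (3 / 2 + 7 * η) * (2 ^ I) ^ (2 * η) * Real.exp ((1 + η) * t)) := by
  obtain ⟨C, hC, H⟩ := exists_l2_tri_step_sq_le hη hη1
  have h21 : (2 : ℝ) ^ (-η) < 1 := Real.rpow_lt_one_of_one_lt_of_neg (by norm_num) (by linarith)
  have hD0 : (0 : ℝ) ≤ 2 / (1 - (2 : ℝ) ^ (-η)) := div_nonneg (by norm_num) (by linarith)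
  refine ⟨(2 + 2 / (1 - 2 ^ (-η))) ^ 2 * C, ?_, fun q _ I t => ?_⟩
  · nlinarith
  have hq : (0 : ℝ) < q := q_pos
  have key := l2_secondDiff_le (q := q) (B := Real.sqrt (C * (q : ℝ) ^ (3 / 2 + 7 * η))) hη hη1
    (Real.sqrt_nonneg _) (fun h t h0 h1 => by
      refine (sq_le_sq₀ (l2_nonneg _) (by positivity)).1 ((H q h t h0 h1).trans (le_of_eq ?_))
      rw [mul_pow, Real.sq_sqrt (by positivity), mul_pow, ← Real.rpow_mul_natCast h0.le,
        ← Real.exp_nat_mul, show (2 - η) * (2 : ℕ) = 4 - 2 * η by push_cast; ring,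
        show ((2 : ℕ) : ℝ) * ((1 + η) * t / 2) = (1 + η) * t by push_cast; ring]
      ring) I t
  refine (pow_le_pow_left₀ (l2_nonneg _) key 2).trans (le_of_eq ?_)
  rw [mul_pow, mul_pow, Real.sq_sqrt (by positivity), mul_pow,
    ← Real.rpow_mul_natCast (by norm_num : (0 : ℝ) ≤ 2), ← Real.exp_nat_mul,
    ← Real.rpow_natCast 2 I, ← Real.rpow_mul (by norm_num : (0 : ℝ) ≤ 2),
    show ((2 : ℕ) : ℝ) * ((1 + η) * t / 2) = (1 + η) * t by push_cast; ring,
    show (I : ℝ) * η * (2 : ℕ) = I * (2 * η) by push_cast; ring]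
  ring

end SecondDiff

/-! ### Second differences approximate the sharp cut-off -/

section Approx

variable {q : ℕ} [NeZero q]

/-- The second difference of `ramp 2 c / 2`, as a weight. -/
noncomputable def bump (h t c : ℝ) : ℝ :=
  (ramp 2 c (t + 2 * h) - 2 * ramp 2 c (t + h) + ramp 2 c t) / (2 * h ^ 2)

theorem bump_of_le {h t c : ℝ} (h0 : 0 < h) (hc : c ≤ t) : bump h t c = 1 := by
  rw [bump, ramp, ramp, ramp, max_eq_left (by linarith), max_eq_left (by linarith),
    max_eq_left (by linarith), div_eq_one_iff_eq (by positivity)]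
  ring

theorem abs_bump_le_one {h t c : ℝ} (h0 : 0 < h) (hc : t ≤ c) : |bump h t c| ≤ 1 := by
  rw [bump, abs_div, abs_of_pos (by positivity : 0 < 2 * h ^ 2), div_le_one (by positivity),
    ramp, ramp, ramp, max_eq_right (by linarith : t - c ≤ 0), abs_le]
  rcases le_total c (t + h) with h1 | h1
  · rw [max_eq_left (by linarith), max_eq_left (by linarith)]
    constructor <;> nlinarith
  · rw [max_eq_right (by linarith : t + h - c ≤ 0)]
    rcases le_total c (t + 2 * h) with h2 | h2
    · rw [max_eq_left (by linarith)]
      constructor <;> nlinarith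
    · rw [max_eq_right (by linarith)]
      constructor <;> nlinarith

theorem abs_exp_sub_quadratic_le {h : ℝ} (h0 : 0 ≤ h) (h1 : h ≤ 1) :
    |Real.exp h - (1 + h + h ^ 2 / 2)| ≤ h ^ 3 := by
  have := Real.exp_bound (x := h) (by rwa [abs_of_nonneg h0]) (n := 3) (by norm_num)
  rw [abs_of_nonneg h0] at this
  norm_num [Finset.sum_range_succ, Nat.factorial] at this
  refine this.trans ?_
  have : 0 ≤ h ^ 3 := by positivity
  linarith

theorem abs_secondDiff_exp_mul_le {h t : ℝ} (h0 : 0 < h) (h1 : h ≤ 1 / 2) (ht : 0 ≤ t) :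
    |Real.exp (2 * h) - 2 * Real.exp h + 1 - h ^ 2| ≤ 100 * h ^ 3 * (1 + t) ^ 2 ∧
    |Real.exp (2 * h) * (t + 2 * h) - 2 * Real.exp h * (t + h) + t - h ^ 2 * (2 + t)| ≤
      100 * h ^ 3 * (1 + t) ^ 2 ∧
    |Real.exp (2 * h) * (t + 2 * h) ^ 2 - 2 * Real.exp h * (t + h) ^ 2 + t ^ 2 -
      h ^ 2 * (2 + 4 * t + t ^ 2)| ≤ 100 * h ^ 3 * (1 + t) ^ 2 := by
  obtain ⟨r, hr⟩ : ∃ r, Real.exp h = 1 + h + h ^ 2 / 2 + h ^ 3 * r :=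
    ⟨(Real.exp h - (1 + h + h ^ 2 / 2)) / h ^ 3, by field_simp; ring⟩
  obtain ⟨u, hu⟩ : ∃ u, Real.exp (2 * h) = 1 + 2 * h + 2 * h ^ 2 + h ^ 3 * u :=
    ⟨(Real.exp (2 * h) - (1 + 2 * h + 2 * h ^ 2)) / h ^ 3, by field_simp; ring⟩
  have h3 : 0 < h ^ 3 := by positivity
  have hr1 : |r| ≤ 1 := by
    have := abs_exp_sub_quadratic_le h0.le (by linarith)
    rw [hr, add_sub_cancel_left, abs_mul, abs_of_pos h3] at this
    nlinarith
  have hu1 : |u| ≤ 8 := by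
    have := abs_exp_sub_quadratic_le (h := 2 * h) (by linarith) (by linarith)
    rw [hu, show 1 + 2 * h + 2 * h ^ 2 + h ^ 3 * u - (1 + 2 * h + (2 * h) ^ 2 / 2) = h ^ 3 * u by
      ring, abs_mul, abs_of_pos h3] at this
    nlinarith
  have ht2 : 0 ≤ t ^ 2 := by positivity
  have hv : |u - 2 * r| ≤ 10 := by
    refine (abs_sub _ _).trans ?_
    rw [abs_mul, abs_two]
    linarith
  have hw : |u - r| ≤ 9 := (abs_sub _ _).trans (by linarith)
  have hz : |4 * u - 2 * r| ≤ 34 := by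
    refine (abs_sub _ _).trans ?_
    rw [abs_mul, abs_mul, abs_two, abs_of_pos (by norm_num : (0 : ℝ) < 4)]
    linarith
  rw [hr, hu]
  refine ⟨?_, ?_, ?_⟩
  · rw [show 1 + 2 * h + 2 * h ^ 2 + h ^ 3 * u - 2 * (1 + h + h ^ 2 / 2 + h ^ 3 * r) + 1 - h ^ 2 =
      h ^ 3 * (u - 2 * r) by ring, abs_mul, abs_of_pos h3]
    nlinarith [mul_nonneg h3.le ht, mul_nonneg h3.le ht2]
  · rw [show (1 + 2 * h + 2 * h ^ 2 + h ^ 3 * u) * (t + 2 * h) -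
        2 * (1 + h + h ^ 2 / 2 + h ^ 3 * r) * (t + h) + t - h ^ 2 * (2 + t) =
      h ^ 3 * ((u - 2 * r) * t + (3 + 2 * h * (u - r))) by ring, abs_mul, abs_of_pos h3,
      mul_assoc (100 : ℝ), mul_left_comm (100 : ℝ)]
    have e1 : |(u - 2 * r) * t + (3 + 2 * h * (u - r))| ≤ 10 * t + (3 + 2 * h * 9) := by
      refine (abs_add_le _ _).trans (add_le_add ?_ ((abs_add_le _ _).trans (add_le_add ?_ ?_)))
      · rw [abs_mul, abs_of_nonneg ht]; gcongr
      · norm_num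
      · rw [abs_mul, abs_of_pos (by linarith : 0 < 2 * h)]; gcongr
    refine mul_le_mul_of_nonneg_left (e1.trans ?_) h3.le
    nlinarith
  · rw [show (1 + 2 * h + 2 * h ^ 2 + h ^ 3 * u) * (t + 2 * h) ^ 2 -
        2 * (1 + h + h ^ 2 / 2 + h ^ 3 * r) * (t + h) ^ 2 + t ^ 2 - h ^ 2 * (2 + 4 * t + t ^ 2) =
      h ^ 3 * ((u - 2 * r) * t ^ 2 + ((6 + 4 * h * (u - r)) * t + (6 + 7 * h +
        h ^ 2 * (4 * u - 2 * r)))) by ring, abs_mul, abs_of_pos h3,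
      mul_assoc (100 : ℝ), mul_left_comm (100 : ℝ)]
    have e1 : |(u - 2 * r) * t ^ 2 + ((6 + 4 * h * (u - r)) * t + (6 + 7 * h +
        h ^ 2 * (4 * u - 2 * r)))| ≤ 10 * t ^ 2 + ((6 + 4 * h * 9) * t + (6 + 7 * h + h ^ 2 * 34)) := by
      refine (abs_add_le _ _).trans (add_le_add ?_ ((abs_add_le _ _).trans (add_le_add ?_ ?_)))
      · rw [abs_mul, abs_of_nonneg ht2]; gcongr
      · rw [abs_mul, abs_of_nonneg ht]
        gcongr
        refine (abs_add_le _ _).trans (add_le_add (by norm_num) ?_)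
        rw [abs_mul, abs_of_pos (by linarith : 0 < 4 * h)]; gcongr
      · refine (abs_add_le _ _).trans (add_le_add (abs_of_pos (by linarith)).le ?_)
        rw [abs_mul, abs_of_pos (by positivity : 0 < h ^ 2)]; gcongr
    refine mul_le_mul_of_nonneg_left (e1.trans ?_) h3.le
    nlinarith

/-- The error between the sharp sum with its main term removed and the second difference. -/
theorem MainCoeff.norm_sub_secondDiff_le {a : ZMod q} {γ : Fin 3 → ℂ} (hγ : MainCoeff a γ)
    {h t : ℝ} (h0 : 0 < h) (h1 : h ≤ 1 / 2) (ht : 0 ≤ t) :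
    ‖(∑ k ∈ Finset.Icc 1 ⌊Real.exp t⌋₊, (d3 k : ℂ) * χ (a * (k : ZMod q))) -
        Real.exp t * (γ 0 + γ 1 * (2 + t) + γ 2 * (2 + 4 * t + t ^ 2)) - secondDiff h t a‖ ≤
      (∑ k ∈ Finset.Ioc ⌊Real.exp t⌋₊ ⌊Real.exp (t + 2 * h)⌋₊, (d3 k : ℝ)) +
        3 * 10 ^ 9 * (q : ℝ) ^ ((1 : ℝ) / 8) * (Real.exp t * h * (1 + t) ^ 2) := by
  have hh : (h : ℂ) ≠ 0 := by exact_mod_cast h0.ne'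
  set N := ⌊Real.exp (t + 2 * h)⌋₊ with hN
  have hNle : ∀ s ≤ t + 2 * h, Real.exp s < N + 1 := fun s hs =>
    (Real.exp_le_exp.2 hs).trans_lt (Nat.lt_floor_add_one _)
  have hle : ⌊Real.exp t⌋₊ ≤ N := Nat.floor_le_floor (Real.exp_le_exp.2 (by linarith))
  set b : ℕ → ℂ := fun k => (d3 k : ℂ) * χ (a * (k : ZMod q)) with hb
  have hbn : ∀ k, ‖b k‖ = d3 k := fun k => by simp [hb]
  set A₀ : ℝ := Real.exp (2 * h) - 2 * Real.exp h + 1 - h ^ 2 with hA₀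
  set A₁ : ℝ := Real.exp (2 * h) * (t + 2 * h) - 2 * Real.exp h * (t + h) + t - h ^ 2 * (2 + t)
    with hA₁
  set A₂ : ℝ := Real.exp (2 * h) * (t + 2 * h) ^ 2 - 2 * Real.exp h * (t + h) ^ 2 + t ^ 2 -
      h ^ 2 * (2 + 4 * t + t ^ 2) with hA₂
  obtain ⟨b0, b1, b2⟩ := abs_secondDiff_exp_mul_le h0 h1 ht
  rw [← hA₀] at b0
  rw [← hA₁] at b1
  rw [← hA₂] at b2
  have hsd : secondDiff h t a = (∑ k ∈ Finset.Icc 1 N, b k * (bump h t (Real.log k) : ℝ)) -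
      Real.exp t * (γ 0 + γ 1 * (2 + t) + γ 2 * (2 + 4 * t + t ^ 2)) -
      Real.exp t / h ^ 2 * (γ 0 * A₀ + γ 1 * A₁ + γ 2 * A₂) := by
    rw [secondDiff, hγ.eq (t + 2 * h) N (hNle _ le_rfl), hγ.eq (t + h) N (hNle _ (by linarith)),
      hγ.eq t N (hNle _ (by linarith))]
    have hs : ∑ k ∈ Finset.Icc 1 N, b k * (bump h t (Real.log k) : ℝ) =
        ((∑ k ∈ Finset.Icc 1 N, (d3 k : ℂ) * (χ (a * (k : ZMod q)) *
          (ramp 2 (Real.log k) (t + 2 * h) / 2 : ℝ))) - 2 * (∑ k ∈ Finset.Icc 1 N,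
          (d3 k : ℂ) * (χ (a * (k : ZMod q)) * (ramp 2 (Real.log k) (t + h) / 2 : ℝ))) +
        ∑ k ∈ Finset.Icc 1 N, (d3 k : ℂ) * (χ (a * (k : ZMod q)) *
          (ramp 2 (Real.log k) t / 2 : ℝ))) / h ^ 2 := by
      rw [Finset.mul_sum, ← Finset.sum_sub_distrib, ← Finset.sum_add_distrib, Finset.sum_div]
      refine Finset.sum_congr rfl fun k _ => ?_
      rw [bump, hb]
      push_cast
      field_simp
    rw [hs, hA₀, hA₁, hA₂, Real.exp_add, Real.exp_add]
    push_cast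
    field_simp
    ring
  have hsplit : ∑ k ∈ Finset.Icc 1 N, b k * (bump h t (Real.log k) : ℝ) =
      (∑ k ∈ Finset.Icc 1 ⌊Real.exp t⌋₊, b k) +
      ∑ k ∈ Finset.Ioc ⌊Real.exp t⌋₊ N, b k * (bump h t (Real.log k) : ℝ) := by
    have hI : ∀ n : ℕ, Finset.Icc 1 n = Finset.Ioc 0 n := fun n => by ext; simp; omega
    rw [hI, hI, ← Finset.sum_Ioc_consecutive _ (Nat.zero_le _) hle]
    congr 1
    refine Finset.sum_congr rfl fun k hk => ?_
    rw [Finset.mem_Ioc] at hk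
    have hk0 : (0 : ℝ) < k := by exact_mod_cast hk.1
    rw [bump_of_le h0, Complex.ofReal_one, mul_one]
    exact (Real.log_le_iff_le_exp hk0).2 ((Nat.le_floor_iff (Real.exp_pos t).le).1 hk.2)
  rw [hsd, hsplit, show ∀ S M T Z : ℂ, S - M - (S + T - M - Z) = -T + Z by intros; ring]
  refine (norm_add_le _ _).trans (add_le_add ?_ ?_)
  · rw [norm_neg]
    refine (norm_sum_le _ _).trans (Finset.sum_le_sum fun k hk => ?_)
    rw [Finset.mem_Ioc] at hk
    have hk0 : (0 : ℝ) < k := by exact_mod_cast (Nat.zero_le _).trans_lt hk.1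
    rw [norm_mul, hbn, Complex.norm_real, Real.norm_eq_abs]
    refine mul_le_of_le_one_right (by positivity) (abs_bump_le_one h0 ?_)
    exact (Real.le_log_iff_exp_le hk0).2 (Nat.lt_of_floor_lt hk.1).le
  · set Q := 10 ^ 7 * (q : ℝ) ^ ((1 : ℝ) / 8) with hQ
    have hterm : ∀ i, ∀ A : ℝ, |A| ≤ 100 * h ^ 3 * (1 + t) ^ 2 →
        ‖γ i * A‖ ≤ Q * (100 * h ^ 3 * (1 + t) ^ 2) := fun i A hA => by
      rw [norm_mul, Complex.norm_real, Real.norm_eq_abs]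
      exact mul_le_mul (hγ.norm_le i) hA (abs_nonneg _) (by positivity)
    have hn : ‖γ 0 * A₀ + γ 1 * A₁ + γ 2 * A₂‖ ≤ 3 * (Q * (100 * h ^ 3 * (1 + t) ^ 2)) := by
      have := norm_add₃_le (a := γ 0 * A₀) (b := γ 1 * A₁) (c := γ 2 * A₂)
      linarith [hterm 0 A₀ b0, hterm 1 A₁ b1, hterm 2 A₂ b2]
    have hc : ‖(Real.exp t : ℂ) / (h : ℂ) ^ 2‖ = Real.exp t / h ^ 2 := by
      rw [norm_div, norm_pow, Complex.norm_real, Complex.norm_real, Real.norm_of_nonneg h0.le,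
        Real.norm_of_nonneg (Real.exp_pos t).le]
    rw [norm_mul, hc]
    refine (mul_le_mul_of_nonneg_left hn (by positivity)).trans (le_of_eq ?_)
    rw [hQ]
    field_simp
    ring

end Approx

/-! ### The mean square of the error term -/

section MeanSquare

variable {q : ℕ} [NeZero q]

/-- The error term of the twisted ternary divisor sum with main term coefficients `γ`. -/
noncomputable def remainder (γ : ZMod q → Fin 3 → ℂ) (x : ℝ) (a : ZMod q) : ℂ :=
  (∑ k ∈ Finset.Icc 1 ⌊x⌋₊, (d3 k : ℂ) * χ (a * (k : ZMod q))) -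
    x * (γ a 0 + γ a 1 * (2 + Real.log x) + γ a 2 * (2 + 4 * Real.log x + Real.log x ^ 2))

theorem l2_sq_le_of_norm_le {F : ZMod q → ℂ} {c : ℝ} (h : ∀ a, ‖F a‖ ≤ c) :
    l2 F ^ 2 ≤ q * c ^ 2 := by
  rw [l2_sq]
  refine (Finset.sum_le_card_nsmul _ _ (c ^ 2) fun a _ =>
    pow_le_pow_left₀ (norm_nonneg _) (h a) 2).trans (le_of_eq ?_)
  rw [Finset.card_univ, ZMod.card, nsmul_eq_mul]

theorem norm_remainder_le {γ : ZMod q → Fin 3 → ℂ} (hγ : ∀ a, MainCoeff a (γ a)) {x : ℝ}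
    (hx : 2 ≤ x) (a : ZMod q) :
    ‖remainder γ x a‖ ≤ 10 ^ 8 * (x ^ 3 * (q : ℝ) ^ ((1 : ℝ) / 8)) := by
  have hx0 : 0 < x := by linarith
  have hq1 : (1 : ℝ) ≤ (q : ℝ) ^ ((1 : ℝ) / 8) :=
    Real.one_le_rpow (by exact_mod_cast NeZero.one_le) (by norm_num)
  set Q := 10 ^ 7 * (q : ℝ) ^ ((1 : ℝ) / 8) with hQ
  set L := Real.log x with hL
  have hL0 : 0 ≤ L := Real.log_nonneg (by linarith)
  have hLx : L ≤ x - 1 := Real.log_le_sub_one_of_pos hx0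
  have h1 : ‖∑ k ∈ Finset.Icc 1 ⌊x⌋₊, (d3 k : ℂ) * χ (a * (k : ZMod q))‖ ≤ x ^ 3 := by
    have hfl : (⌊x⌋₊ : ℝ) ≤ x := Nat.floor_le hx0.le
    refine (norm_sum_le_of_le (f := fun k : ℕ => (d3 k : ℂ) * χ (a * (k : ZMod q)))
      (n := fun _ => x ^ 2) _ fun k hk => ?_).trans ?_
    · rw [norm_mul, norm_χ, mul_one, Complex.norm_natCast]
      have h2 : (k : ℝ) ≤ x := (Nat.cast_le.2 (Finset.mem_Icc.1 hk).2).trans hfl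
      calc (d3 k : ℝ) ≤ (k : ℝ) ^ 2 := by exact_mod_cast d3_le_self_sq k
        _ ≤ x ^ 2 := by gcongr
    · rw [Finset.sum_const, Nat.card_Icc, nsmul_eq_mul, Nat.add_sub_cancel]
      calc _ ≤ x * x ^ 2 := by gcongr
        _ = x ^ 3 := by ring
  have hg := fun i => (hγ a).norm_le i
  have h2 : ‖(x : ℂ) * (γ a 0 + γ a 1 * (2 + L) + γ a 2 * (2 + 4 * L + L ^ 2))‖ ≤
      x * (Q + Q * (2 + L) + Q * (2 + 4 * L + L ^ 2)) := by
    rw [norm_mul, Complex.norm_real, Real.norm_of_nonneg hx0.le]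
    refine mul_le_mul_of_nonneg_left (norm_add₃_le.trans ?_) hx0.le
    have e1 : ‖(2 + L : ℂ)‖ = 2 + L := by
      rw [← Real.norm_of_nonneg (by positivity : 0 ≤ 2 + L), ← Complex.norm_real]
      push_cast; rfl
    have e2 : ‖(2 + 4 * L + L ^ 2 : ℂ)‖ = 2 + 4 * L + L ^ 2 := by
      rw [← Real.norm_of_nonneg (by positivity : 0 ≤ 2 + 4 * L + L ^ 2), ← Complex.norm_real]
      push_cast; rfl
    rw [norm_mul, norm_mul, e1, e2]
    gcongr <;> exact hg _
  have h3 : x * (Q + Q * (2 + L) + Q * (2 + 4 * L + L ^ 2)) ≤ 9 * (Q * x ^ 3) := by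
    have e1 : 5 + 5 * L + L ^ 2 ≤ 9 * x ^ 2 := by nlinarith
    have e2 : 0 ≤ Q * x := by positivity
    nlinarith [mul_le_mul_of_nonneg_left e1 e2]
  refine (norm_sub_le _ _).trans ((add_le_add h1 (h2.trans h3)).trans ?_)
  have e3 : x ^ 3 * 1 ≤ x ^ 3 * (q : ℝ) ^ ((1 : ℝ) / 8) := by gcongr
  have e4 : 0 ≤ x ^ 3 * (q : ℝ) ^ ((1 : ℝ) / 8) := by positivity
  rw [hQ]
  nlinarith

theorem l2_remainder_sq_le_of_pow_le {γ : ZMod q → Fin 3 → ℂ} (hγ : ∀ a, MainCoeff a (γ a)) {x : ℝ}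
    (hx : 2 ≤ x) (hq : x ^ 20 ≤ q) :
    l2 (remainder γ x) ^ 2 ≤ 10 ^ 16 * (x * (q : ℝ) ^ ((3 : ℝ) / 2)) := by
  have hx0 : 0 < x := by linarith
  have hq0 : (0 : ℝ) < q := q_pos
  refine (l2_sq_le_of_norm_le (norm_remainder_le hγ hx)).trans ?_
  have h1 : x ^ 5 ≤ (q : ℝ) ^ ((1 : ℝ) / 4) := by
    calc x ^ 5 = (x ^ 20) ^ ((1 : ℝ) / 4) := by
          rw [← Real.rpow_natCast x 20, ← Real.rpow_mul hx0.le, ← Real.rpow_natCast x 5]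
          norm_num
      _ ≤ _ := by gcongr
  have h2 : (q : ℝ) ^ ((3 : ℝ) / 2) = q * ((q : ℝ) ^ ((1 : ℝ) / 8)) ^ 2 *
      (q : ℝ) ^ ((1 : ℝ) / 4) := by
    rw [← Real.rpow_mul_natCast hq0.le, mul_assoc, ← Real.rpow_add hq0]
    nth_rewrite 2 [← Real.rpow_one (q : ℝ)]
    rw [← Real.rpow_add hq0]
    norm_num
  rw [h2]
  calc _ = 10 ^ 16 * (x * (q * ((q : ℝ) ^ ((1 : ℝ) / 8)) ^ 2 * x ^ 5)) := by ring
    _ ≤ _ := by gcongr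

theorem exists_sum_Ioc_d3_le {δ : ℝ} (hδ : 0 < δ) : ∃ C : ℝ, 1 ≤ C ∧ ∀ x y : ℝ, 1 ≤ x → x ≤ y →
    y ≤ x + 1 → ∑ k ∈ Finset.Ioc ⌊x⌋₊ ⌊y⌋₊, (d3 k : ℝ) ≤ C * x ^ δ := by
  obtain ⟨C, hC, H⟩ := exists_d3_le hδ
  have h2 : (1 : ℝ) ≤ 2 ^ δ := Real.one_le_rpow (by norm_num) hδ.le
  refine ⟨C * 2 ^ δ, one_le_mul_of_one_le_of_one_le hC h2, fun x y hx hxy hy => ?_⟩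
  have hcard : (Finset.Ioc ⌊x⌋₊ ⌊y⌋₊).card ≤ 1 := by
    rw [Nat.card_Ioc]
    have : ⌊y⌋₊ ≤ ⌊x⌋₊ + 1 := by
      rw [← Nat.floor_add_one (by linarith)]
      exact Nat.floor_le_floor hy
    omega
  refine (Finset.sum_le_card_nsmul _ _ (C * 2 ^ δ * x ^ δ) fun k hk => ?_).trans ?_
  · rw [Finset.mem_Ioc] at hk
    refine (H k (by omega)).trans ?_
    rw [mul_assoc, ← Real.mul_rpow (by norm_num) (by linarith)]
    have : (k : ℝ) ≤ 2 * x := by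
      have := (Nat.le_floor_iff (by linarith)).1 hk.2
      linarith
    gcongr
  · rw [nsmul_eq_mul]
    refine mul_le_of_le_one_left (by positivity) ?_
    exact_mod_cast hcard

theorem one_add_log_sq_le {δ x : ℝ} (hδ : 0 < δ) (hx : 1 ≤ x) :
    (1 + Real.log x) ^ 2 ≤ (1 + 1 / δ) ^ 2 * x ^ (2 * δ) := by
  have h1 := Real.log_le_rpow_div (by linarith : 0 ≤ x) hδ
  have h2 := Real.one_le_rpow hx hδ.le
  have h3 := Real.log_nonneg hx
  rw [mul_comm 2 δ, show δ * 2 = δ * (2 : ℕ) by norm_num, Real.rpow_mul_natCast (by linarith),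
    ← mul_pow]
  refine pow_le_pow_left₀ (by linarith) ?_ 2
  calc 1 + Real.log x ≤ x ^ δ + x ^ δ / δ := add_le_add h2 h1
    _ = _ := by ring

theorem exists_norm_remainder_sub_le {η : ℝ} (hη : 0 < η) : ∃ C : ℝ, 1 ≤ C ∧
    ∀ (q : ℕ) [NeZero q] (γ : ZMod q → Fin 3 → ℂ), (∀ a, MainCoeff a (γ a)) →
    ∀ (x h : ℝ) (a : ZMod q), 2 ≤ x → 0 < h → h * (4 * x) ≤ 1 →
      ‖remainder γ x a - secondDiff h (Real.log x) a‖ ≤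
        C * (x ^ (2 * η) * (q : ℝ) ^ ((1 : ℝ) / 8)) := by
  obtain ⟨C, hC, H⟩ := exists_sum_Ioc_d3_le (by positivity : 0 < 2 * η)
  refine ⟨C + 10 ^ 9 * (1 + 1 / η) ^ 2, by nlinarith [sq_nonneg (1 + 1 / η)],
    fun q _ γ hγ x h a hx h0 h1 => ?_⟩
  have hx0 : 0 < x := by linarith
  have h2 : h ≤ 1 / 8 := by nlinarith
  have hq1 : (1 : ℝ) ≤ (q : ℝ) ^ ((1 : ℝ) / 8) :=
    Real.one_le_rpow (by exact_mod_cast NeZero.one_le) (by norm_num)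
  have key := (hγ a).norm_sub_secondDiff_le h0 (by linarith) (Real.log_nonneg (by linarith : 1 ≤ x))
  rw [Real.exp_add, Real.exp_log hx0] at key
  have hy1 : 1 ≤ Real.exp (2 * h) := Real.one_le_exp (by linarith)
  have hy2 := exp_sub_one_le_two_mul (h := 2 * h) (by linarith) (by linarith)
  have hs := H x (x * Real.exp (2 * h)) (by linarith) (by nlinarith) (by nlinarith)
  have hl := one_add_log_sq_le hη (by linarith : 1 ≤ x)
  refine key.trans ?_
  set Q := (q : ℝ) ^ ((1 : ℝ) / 8) with hQ
  have e1 : C * x ^ (2 * η) * 1 ≤ C * x ^ (2 * η) * Q := by gcongr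
  have e2 : 3 * 10 ^ 9 * Q * (x * h * (1 + Real.log x) ^ 2) ≤
      3 * 10 ^ 9 * Q * (1 / 4 * ((1 + 1 / η) ^ 2 * x ^ (2 * η))) := by
    gcongr
    linarith
  have e3 : 0 ≤ Q * ((1 + 1 / η) ^ 2 * x ^ (2 * η)) := by positivity
  nlinarith

theorem exists_l2_remainder_sq_le_of_le_pow {η : ℝ} (hη : 0 < η) (hη1 : η ≤ 1 / 4) : ∃ C : ℝ, 1 ≤ C ∧
    ∀ (q : ℕ) [NeZero q] (γ : ZMod q → Fin 3 → ℂ), (∀ a, MainCoeff a (γ a)) →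
    ∀ x : ℝ, 2 ≤ x → (q : ℝ) ≤ x ^ 20 →
      l2 (remainder γ x) ^ 2 ≤ C * (x ^ (1 + 143 * η) * (q : ℝ) ^ ((3 : ℝ) / 2)) := by
  obtain ⟨C1, hC1, H1⟩ := exists_norm_remainder_sub_le hη
  obtain ⟨C2, hC2, H2⟩ := exists_l2_secondDiff_sq_le hη hη1
  refine ⟨2 * C1 ^ 2 + 2 * (8 ^ (2 * η) * C2), ?_, fun q _ γ hγ x hx hqx => ?_⟩
  · have : 0 ≤ 8 ^ (2 * η) * C2 := by positivity
    nlinarith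
  have hx0 : 0 < x := by linarith
  have hx1 : 1 ≤ x := by linarith
  have hq0 : (0 : ℝ) < q := q_pos
  have hq1 : (1 : ℝ) ≤ q := by exact_mod_cast NeZero.one_le
  obtain ⟨n, hn1, hn2⟩ := exists_nat_pow_near (by linarith : 1 ≤ 4 * x) (one_lt_two (α := ℝ))
  set h : ℝ := (1 / 2) ^ (n + 1) with hh
  have hpow : h * 2 ^ (n + 1) = 1 := by
    rw [hh, ← mul_pow]
    norm_num
  have h0 : 0 < h := by positivity
  have hh1 : h * (4 * x) ≤ 1 := by nlinarith
  have hd : l2 (fun a => remainder γ x a - secondDiff h (Real.log x) a) ^ 2 ≤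
      C1 ^ 2 * (x ^ (1 + 143 * η) * (q : ℝ) ^ ((3 : ℝ) / 2)) := by
    refine (l2_sq_le_of_norm_le fun a => H1 q γ hγ x h a hx h0 hh1).trans ?_
    have e1 : (x ^ (2 * η)) ^ 2 ≤ x ^ (1 + 143 * η) := by
      rw [← Real.rpow_mul_natCast hx0.le]
      refine Real.rpow_le_rpow_of_exponent_le hx1 ?_
      push_cast
      linarith
    have e2 : q * ((q : ℝ) ^ ((1 : ℝ) / 8)) ^ 2 ≤ (q : ℝ) ^ ((3 : ℝ) / 2) := by
      nth_rewrite 1 [← Real.rpow_one (q : ℝ)]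
      rw [← Real.rpow_mul_natCast hq0.le, ← Real.rpow_add hq0]
      exact Real.rpow_le_rpow_of_exponent_le hq1 (by norm_num)
    calc _ = C1 ^ 2 * ((x ^ (2 * η)) ^ 2 * (q * ((q : ℝ) ^ ((1 : ℝ) / 8)) ^ 2)) := by ring
      _ ≤ _ := by gcongr
  have hs : l2 (secondDiff (q := q) h (Real.log x)) ^ 2 ≤
      8 ^ (2 * η) * C2 * (x ^ (1 + 143 * η) * (q : ℝ) ^ ((3 : ℝ) / 2)) := by
    refine (H2 q (n + 1) (Real.log x)).trans ?_
    have e1 : (q : ℝ) ^ (3 / 2 + 7 * η) ≤ (q : ℝ) ^ ((3 : ℝ) / 2) * x ^ (140 * η) := by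
      rw [Real.rpow_add hq0]
      gcongr
      calc (q : ℝ) ^ (7 * η) ≤ (x ^ 20) ^ (7 * η) := by gcongr
        _ = _ := by
          rw [← Real.rpow_natCast, ← Real.rpow_mul hx0.le]
          congr 1
          push_cast
          ring
    have e2 : ((2 : ℝ) ^ (n + 1)) ^ (2 * η) ≤ 8 ^ (2 * η) * x ^ (2 * η) := by
      rw [← Real.mul_rpow (by norm_num) hx0.le]
      gcongr
      rw [pow_succ]
      linarith
    have e3 : Real.exp ((1 + η) * Real.log x) = x ^ (1 + η) := by
      rw [Real.rpow_def_of_pos hx0, mul_comm]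
    have e4 : x ^ (1 + 143 * η) = x ^ (140 * η) * x ^ (2 * η) * x ^ (1 + η) := by
      rw [← Real.rpow_add hx0, ← Real.rpow_add hx0]
      congr 1
      ring
    rw [e3, e4]
    calc _ ≤ C2 * ((q : ℝ) ^ ((3 : ℝ) / 2) * x ^ (140 * η) * (8 ^ (2 * η) * x ^ (2 * η)) *
          x ^ (1 + η)) := by gcongr
      _ = _ := by ring
  have htri : l2 (remainder γ x) ≤ l2 (fun a => remainder γ x a - secondDiff h (Real.log x) a) +
      l2 (secondDiff (q := q) h (Real.log x)) := by
    refine le_trans (le_of_eq ?_) (l2_add_le _ _)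
    simp only [sub_add_cancel]
  have := pow_le_pow_left₀ (l2_nonneg _) htri 2
  nlinarith [sq_nonneg (l2 (fun a => remainder γ x a - secondDiff h (Real.log x) a) -
    l2 (secondDiff (q := q) h (Real.log x)))]

theorem exists_l2_remainder_sq_le {ε : ℝ} (hε : 0 < ε) : ∃ C : ℝ, 1 ≤ C ∧
    ∀ (q : ℕ) [NeZero q] (γ : ZMod q → Fin 3 → ℂ), (∀ a, MainCoeff a (γ a)) →
    ∀ x : ℝ, 2 ≤ x → l2 (remainder γ x) ^ 2 ≤ C * (x ^ (1 + ε) * (q : ℝ) ^ ((3 : ℝ) / 2)) := by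
  have hη : 0 < min (ε / 143) (1 / 4) := by positivity
  obtain ⟨C, hC, H⟩ := exists_l2_remainder_sq_le_of_le_pow hη (min_le_right _ _)
  refine ⟨C + 10 ^ 16, by linarith, fun q _ γ hγ x hx => ?_⟩
  have hx1 : 1 ≤ x := by linarith
  rcases le_total (q : ℝ) (x ^ 20) with hq | hq
  · refine (H q γ hγ x hx hq).trans ?_
    gcongr
    · linarith
    · linarith [min_le_left (ε / 143) (1 / 4)]
  · refine (l2_remainder_sq_le_of_pow_le hγ hx hq).trans ?_
    have : x ≤ x ^ (1 + ε) := Real.self_le_rpow_of_one_le hx1 (by linarith)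
    gcongr
    linarith

end MeanSquare

theorem sum_Icc_natCast_eq {q : ℕ} [NeZero q] (f : ZMod q → ℝ) :
    ∑ a ∈ Finset.Icc 1 q, f (a : ZMod q) = ∑ a, f a := by
  refine Finset.sum_bij (fun a _ => (a : ZMod q)) (fun _ _ => Finset.mem_univ _) ?_ ?_
    fun _ _ => rfl
  · intro a ha b hb hab
    rw [Finset.mem_Icc] at ha hb
    rw [ZMod.natCast_eq_natCast_iff] at hab
    have h1 := Nat.ModEq.add_right_cancel' 1 (by
      rwa [Nat.sub_add_cancel ha.1, Nat.sub_add_cancel hb.1] : a - 1 + 1 ≡ b - 1 + 1 [MOD q])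
    have := Nat.ModEq.eq_of_lt_of_lt h1 (by omega) (by omega)
    omega
  · intro b _
    by_cases hb : b = 0
    · exact ⟨q, Finset.mem_Icc.2 ⟨NeZero.one_le, le_rfl⟩, by simp [hb]⟩
    · refine ⟨b.val, Finset.mem_Icc.2 ⟨?_, b.val_lt.le⟩, ZMod.natCast_zmod_val b⟩
      rwa [Nat.one_le_iff_ne_zero, Ne, ZMod.val_eq_zero]

theorem e_mul_div_eq_χ {q : ℕ} [NeZero q] (n a : ℕ) :
    e ((n : ℝ) * a / q) = χ ((a : ZMod q) * (n : ZMod q)) := by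
  have h := χ_natCast (q := q) (a * n)
  push_cast at h
  rw [h, mul_comm (n : ℝ)]

end TernaryDivisor

/-- For every `ε > 0` there is a constant `C = C(ε)` such that for every
real `x ≥ 2` and integer `q ≥ 1` we have `Σ_{a=1}^{q} |Δ(a/q)|² ≤ C · x^{1+ε} q^{3/2}`.
Here, for each `a`, `E a` is the meromorphic continuation of
`E_{a/q}(s) = Σ_{n≥1} d₃(n) e(na/q) n^{-s}` (characterised by the `HasSum` hypothesis on
`Re s > 1`, with its only pole at `s = 1` of order at most `3`, as expressed by the existence
of the analytic function `g` with `g(s) = (s-1)³ E_{a/q}(s) x^s / s` near `s = 1`), and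
`R a = Res_{s=1} { E_{a/q}(s) x^s / s } = (1/2!) g''(1)` and
`Δ(a/q) = Σ_{n ≤ x} d₃(n) e(na/q) − R a`. -/
theorem stmt0 :
    ∀ ε : ℝ, 0 < ε → ∃ C : ℝ, 0 < C ∧
      ∀ x : ℝ, 2 ≤ x → ∀ q : ℕ, 1 ≤ q →
      ∀ E : ℕ → ℂ → ℂ, ∀ R : ℕ → ℂ,
      (∀ a : ℕ, ∀ s : ℂ, 1 < s.re →
        HasSum (fun n : ℕ => (d3 n : ℂ) * e ((n : ℝ) * a / q) / (n : ℂ) ^ s) (E a s)) →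
      (∀ a : ℕ, ∃ g : ℂ → ℂ, AnalyticAt ℂ g 1 ∧
        (∀ᶠ s in nhdsWithin (1 : ℂ) {(1 : ℂ)}ᶜ,
          g s = (s - 1) ^ 3 * E a s * (x : ℂ) ^ s / s) ∧
        R a = iteratedDeriv 2 g 1 / 2) →
      ∑ a ∈ Finset.Icc 1 q,
          ‖(∑ n ∈ Finset.Icc 1 ⌊x⌋₊, (d3 n : ℂ) * e ((n : ℝ) * a / q)) - R a‖ ^ 2
        ≤ C * x ^ (1 + ε) * (q : ℝ) ^ ((3 : ℝ) / 2) := by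
  intro ε hε
  obtain ⟨C, hC, H⟩ := TernaryDivisor.exists_l2_remainder_sq_le hε
  refine ⟨C, by linarith, fun x hx q hq E R hE hR => ?_⟩
  have : NeZero q := ⟨by omega⟩
  choose γ hγ using fun a : ZMod q => TernaryDivisor.exists_mainCoeff a
  have h1 := H q γ hγ x hx
  rw [TernaryDivisor.l2_sq, ← TernaryDivisor.sum_Icc_natCast_eq, ← mul_assoc] at h1
  refine le_trans (le_of_eq (Finset.sum_congr rfl fun a _ => ?_)) h1
  obtain ⟨g, hg, hgE, hRa⟩ := hR a
  have h2 := (hγ (a : ZMod q)).residue_eq (by linarith : 0 < x)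
    (fun s hs => by simpa only [TernaryDivisor.e_mul_div_eq_χ] using hE a s hs) hg hgE
  rw [hRa, h2, TernaryDivisor.remainder]
  simp only [TernaryDivisor.e_mul_div_eq_χ]
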